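/- There exists a function P(m,n,d), independent of N and of K, with the following property: for every algebraically closed field K, every N, and every m × n matrix 𝓜 over R = K[x_1,…,x_N] whose entries have degree at most d, if M ⊆ R^m is the column space of 𝓜 (the submodule generated by the n columns), then M admits a finite free resolution 0 → R^{b_k} → … → R^{b_1} → R^{b_0} → M → 0 in which k ≤ P(m,n,d), each rank b_i is at most P(m,n,d), and the matrix of each map R^{b_i} → R^{b_{i−1}} with respect to the standard bases has all entries of degree at most P(m,n,d). -/

import Mathlib

universe u

open Finset in
/-- Iterative (Hasse) derivations on a graded `K`-algebra, each lowering the degree. -/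
structure HasseGraded (K S V : Type*) [Field K] [CommRing S] [Algebra K S] where
  /-- the Hasse derivations -/
  D : V → ℕ → S →ₗ[K] S
  /-- the projections to the graded pieces -/
  pr : ℕ → S →ₗ[K] S
  D_zero : ∀ v s, D v 0 s = s
  D_mul : ∀ v n a b, D v n (a * b) = ∑ x ∈ antidiagonal n, D v x.1 a * D v x.2 b
  D_alg : ∀ v n k, n ≠ 0 → D v n (algebraMap K S k) = 0
  pr_same : ∀ e s, pr e (pr e s) = pr e s
  pr_ne : ∀ e f s, e ≠ f → pr e (pr f s) = 0
  pr_mul : ∀ n a b, pr n (a * b) = ∑ x ∈ antidiagonal n, pr x.1 a * pr x.2 b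
  pr_alg : ∀ k, pr 0 (algebraMap K S k) = algebraMap K S k
  pr_zero_mem : ∀ s, ∃ k, pr 0 s = algebraMap K S k
  pr_sum : ∀ s, ∃ n, s = ∑ e ∈ range n, pr e s
  D_pr : ∀ v n e s, pr e (D v n s) = D v n (pr (e + n) s)

namespace HasseGraded

variable {K S V : Type*} [Field K] [CommRing S] [Algebra K S] (G : HasseGraded K S V)

/-- `s` has degree at most `e`. -/
def DegLE (e : ℕ) (s : S) : Prop := ∀ k, e < k → G.pr k s = 0

/-- All first derivatives of `s` vanish. -/
def Killed (s : S) : Prop := ∀ v, G.D v 1 s = 0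

/-- The Hasse derivations interact with `p`-th powers as in characteristic `p`, and elements
with zero first derivatives are `p`-th powers. -/
structure FrobeniusData (p : ℕ) : Prop where
  frob : ∀ v n s, G.D v (p * n) (s ^ p) = G.D v n s ^ p
  root : ∀ e s, G.Killed s → G.DegLE e s → ∃ u, G.DegLE (e / p) u ∧ u ^ p = s

lemma exists_degLE (s : S) : ∃ e, G.DegLE e s := by
  obtain ⟨n, hn⟩ := G.pr_sum s
  refine ⟨n, fun k hk => ?_⟩
  rw [hn, map_sum]
  refine Finset.sum_eq_zero fun e he => G.pr_ne _ _ _ ?_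
  have := Finset.mem_range.1 he
  omega

lemma DegLE.D {e : ℕ} {s : S} (h : G.DegLE e s) (v : V) (n : ℕ) : G.DegLE (e - n) (G.D v n s) := by
  intro k hk
  rw [G.D_pr, h (k + n) (by omega), map_zero]

lemma DegLE.mem_range {s : S} (h : G.DegLE 0 s) : ∃ k, s = algebraMap K S k := by
  obtain ⟨n, hn⟩ := G.pr_sum s
  obtain ⟨k, hk⟩ := G.pr_zero_mem s
  rcases Nat.eq_zero_or_pos n with rfl | hn0
  · exact ⟨0, by simpa using hn⟩
  refine ⟨k, ?_⟩
  rw [← hk]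
  conv_lhs => rw [hn]
  rw [Finset.sum_eq_single 0]
  · intro b _ hb
    exact h b (Nat.pos_of_ne_zero hb)
  · intro h0
    exact absurd (Finset.mem_range.2 hn0) h0

lemma killed_algebraMap (k : K) : G.Killed (algebraMap K S k) :=
  fun v => G.D_alg v 1 k one_ne_zero

/-- The first derivation as a `Derivation`. -/
def der (v : V) : Derivation K S S :=
  Derivation.mk' (G.D v 1) (by
    intro a b
    rw [G.D_mul, Finset.Nat.sum_antidiagonal_succ]
    simp [G.D_zero, mul_comm])

lemma der_apply (v : V) (s : S) : G.der v s = G.D v 1 s := rfl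

/-- The total derivative of a polynomial evaluated at `z`. -/
lemma exists_total_derivative (v : V) (z : S) (f : Polynomial S) :
    ∃ h : Polynomial S,
      (∀ j, h.coeff j = G.D v 1 (f.coeff j) + (j + 1) * f.coeff (j + 1) * G.D v 1 z) ∧
      h.eval z = G.D v 1 (f.eval z) := by
  induction f using Polynomial.induction_on' with
  | add f g hf hg =>
    obtain ⟨a, ha, ha'⟩ := hf
    obtain ⟨b, hb, hb'⟩ := hg
    refine ⟨a + b, fun j => ?_, ?_⟩
    · simp only [Polynomial.coeff_add, ha, hb, map_add]
      ring
    · simp [ha', hb']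
  | monomial n s =>
    refine ⟨Polynomial.monomial n (G.D v 1 s)
      + Polynomial.derivative (Polynomial.monomial n s) * Polynomial.C (G.D v 1 z), fun j => ?_, ?_⟩
    · rw [Polynomial.coeff_add, Polynomial.coeff_mul_C, Polynomial.coeff_derivative,
        Polynomial.coeff_monomial, Polynomial.coeff_monomial, Polynomial.coeff_monomial]
      congr 1
      · split_ifs <;> simp
      · ring
    · simp only [← G.der_apply]
      simp [Derivation.leibniz_pow, Polynomial.derivative_monomial]
      ring

variable {G}

/-- A point derivation at the irrelevant ideal. -/
structure PointDerivation (G : HasseGraded K S V) where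
  /-- the underlying functional -/
  toFun : S →ₗ[K] K
  /-- the augmentation -/
  aug : S → K
  pr_zero : ∀ s, G.pr 0 s = algebraMap K S (aug s)
  map_alg : ∀ k, toFun (algebraMap K S k) = 0
  map_mul_eq_zero : ∀ a b, G.pr 0 a = 0 → G.pr 0 b = 0 → toFun (a * b) = 0

namespace PointDerivation

variable (l : PointDerivation G)

lemma leibniz (a b : S) : l.toFun (a * b) = l.aug a * l.toFun b + l.aug b * l.toFun a := by
  set α := algebraMap K S (l.aug a) with hα
  set β := algebraMap K S (l.aug b) with hβ
  have h1 : a * b = (a - α) * (b - β) + (l.aug a • b + l.aug b • a)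
      - algebraMap K S (l.aug a * l.aug b) := by
    simp only [Algebra.smul_def, map_mul]
    rw [← hα, ← hβ]
    ring
  rw [h1, map_sub, map_add, map_add, l.map_alg, l.map_mul_eq_zero]
  · simp
  · rw [map_sub, l.pr_zero, hα, G.pr_alg, sub_self]
  · rw [map_sub, l.pr_zero, hβ, G.pr_alg, sub_self]

lemma toFun_pow_char [FaithfulSMul K S] (p : ℕ) [CharP K p] (s : S) :
    l.toFun (s ^ p) = 0 := by
  have key : ∀ n : ℕ, l.toFun (s ^ n) = n * (l.aug s) ^ (n - 1) * l.toFun s := by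
    intro n
    have hinj := FaithfulSMul.algebraMap_injective K S
    have haug : ∀ n : ℕ, l.aug (s ^ n) = l.aug s ^ n := by
      intro n
      apply hinj
      rw [← l.pr_zero]
      induction n with
      | zero => simpa using G.pr_alg 1
      | succ n ih =>
        rw [pow_succ, G.pr_mul]
        simp [ih, l.pr_zero s, pow_succ]
    induction n with
    | zero => simpa using l.map_alg 1
    | succ n ih =>
      rw [pow_succ, l.leibniz, ih, haug]
      rcases n with _ | n
      · simp
      · simp only [Nat.add_sub_cancel]
        push_cast
        ring
  rw [key]
  simp

lemma eq_zero_of_mem_adjoin {s : Set S} (h : ∀ x ∈ s, l.toFun x = 0) {x : S}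
    (hx : x ∈ Algebra.adjoin K s) : l.toFun x = 0 := by
  induction hx using Algebra.adjoin_induction with
  | mem x hx => exact h x hx
  | algebraMap r => exact l.map_alg r
  | add x y _ _ hx hy => rw [map_add, hx, hy, add_zero]
  | mul x y _ _ hx hy => rw [l.leibniz, hx, hy]; simp

end PointDerivation

end HasseGraded

namespace HasseGraded

variable {K S V : Type*} [Field K] [CommRing S] [Algebra K S] {G : HasseGraded K S V}

lemma FrobeniusData.frob_pow {p : ℕ} (F : G.FrobeniusData p) (v : V) (n j : ℕ) (s : S) :
    G.D v (p ^ j * n) (s ^ p ^ j) = G.D v n s ^ p ^ j := by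
  induction j with
  | zero => simp
  | succ j ih =>
    rw [pow_succ p j, pow_mul, mul_comm (p ^ j) p, mul_assoc, F.frob, ih, mul_comm p, pow_mul]

/-- `z` is a new variable over the differentially closed subalgebra `P`. -/
structure NewVariable (l : PointDerivation G) (P : Subalgebra K S) (z : S) : Prop where
  D_mem : ∀ v n, ∀ s ∈ P, G.D v n s ∈ P
  D_mem' : ∀ v n, 1 ≤ n → G.D v n z ∈ P
  vanish : ∀ s ∈ P, l.toFun s = 0
  ne_zero : l.toFun z ≠ 0

variable (G) in
/-- Elements of `P` with vanishing derivatives have `p`-th roots in `P`. -/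
def HasRoots (p : ℕ) (P : Set S) : Prop := ∀ g ∈ P, G.Killed g → ∃ u ∈ P, u ^ p = g

variable (G) in
/-- Polynomials over `P` whose formal total derivatives vanish are `p`-th powers. -/
def PolyHasRoots (p : ℕ) (P : Subalgebra K S) (z : S) : Prop :=
  ∀ f : Polynomial S, (∀ j, f.coeff j ∈ P) →
    (∀ v j, G.D v 1 (f.coeff j) + (j + 1) * f.coeff (j + 1) * G.D v 1 z = 0) →
    ∃ g : Polynomial S, (∀ j, g.coeff j ∈ P) ∧ g ^ p = f

section NewVariable

variable {l : PointDerivation G} {P : Subalgebra K S} {z : S}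

lemma NewVariable.eq_zero_of_pow [IsDomain S] (h : NewVariable l P z) {p : ℕ} (hp : p.Prime) [CharP K p]
    (F : G.FrobeniusData p) (hP : G.HasRoots p P) (e : ℕ) :
    ∀ γ ∈ P, G.DegLE e γ → ∀ j, 1 ≤ j → ∀ b ∈ P, ∀ s, γ ^ p ^ j * z + b = s ^ p → γ = 0 := by
  have : CharP S p := charP_of_injective_algebraMap (algebraMap K S).injective p
  have : Fact p.Prime := ⟨hp⟩
  induction e using Nat.strong_induction_on with
  | _ e ih =>
  intro γ hγ hdeg j hj b hb s hs
  rcases Nat.eq_zero_or_pos e with rfl | he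
  · obtain ⟨k, rfl⟩ := hdeg.mem_range
    have h1 := congrArg l.toFun hs
    rw [l.toFun_pow_char p, map_add, h.vanish b hb, add_zero, ← map_pow, ← Algebra.smul_def,
      map_smul, smul_eq_mul, mul_eq_zero, or_iff_left h.ne_zero] at h1
    rw [eq_zero_of_pow_eq_zero h1, map_zero]
  · have hk : G.Killed γ := by
      intro v
      have h1 := congrArg (G.D v (p ^ j)) hs
      obtain ⟨i, rfl⟩ : ∃ i, j = i + 1 := ⟨j - 1, by omega⟩
      rw [pow_succ' p i, F.frob, ← pow_succ' p i, map_add, G.D_mul,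
        ← Finset.add_sum_erase _ _ (show (p ^ (i + 1), 0) ∈ Finset.HasAntidiagonal.antidiagonal _ by simp), add_assoc,
        G.D_zero] at h1
      have h2 := F.frob_pow v 1 (i + 1) γ
      rw [mul_one] at h2
      simp only [h2] at h1
      refine ih (e - 1) (by omega) _ (h.D_mem v 1 γ hγ) (hdeg.D G v 1) (i + 1) hj _ ?_ _ h1
      refine P.add_mem (P.sum_mem fun x hx => ?_) (h.D_mem _ _ _ hb)
      refine P.mul_mem (h.D_mem _ _ _ (P.pow_mem hγ _)) (h.D_mem' _ _ ?_)
      rw [Finset.mem_erase, Finset.HasAntidiagonal.mem_antidiagonal] at hx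
      by_contra h0
      apply hx.1
      ext <;> simp <;> omega
    obtain ⟨u', hu', hu'e⟩ := F.root e γ hk hdeg
    obtain ⟨u, hu, hue⟩ := hP γ hγ hk
    have : u = u' := frobenius_inj S p (by simp [frobenius_def, hue, hu'e])
    subst this
    have h0 : u = 0 := ih (e / p) (Nat.div_lt_self he hp.one_lt) u hu hu' (j + 1) (by omega) b hb s
      (by rw [pow_succ', pow_mul, hue, hs])
    rw [← hue, h0, zero_pow hp.ne_zero]

lemma killed_top {f : Polynomial S} {n : ℕ} (hn : ∀ j, n < j → f.coeff j = 0)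
    (hf : ∀ v j, G.D v 1 (f.coeff j) + (j + 1) * f.coeff (j + 1) * G.D v 1 z = 0) :
    G.Killed (f.coeff n) := by
  intro v
  have := hf v n
  rwa [hn (n + 1) (by omega), mul_zero, zero_mul, add_zero] at this

lemma killed_subtop {f : Polynomial S} {n : ℕ} (hn : ∀ j, n + 1 < j → f.coeff j = 0)
    (hf : ∀ v j, G.D v 1 (f.coeff j) + (j + 1) * f.coeff (j + 1) * G.D v 1 z = 0) :
    G.Killed (((n + 1 : ℕ) : S) * f.coeff (n + 1) * z + f.coeff n) := by
  intro v
  have h1 := killed_top hn hf v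
  have h2 := hf v n
  rw [← G.der_apply] at h1 h2 ⊢
  rw [← G.der_apply] at h2
  simp only [map_add, Derivation.leibniz, h1, Derivation.map_natCast, smul_eq_mul]
  push_cast
  linear_combination h2

lemma NewVariable.polyHasRoots [IsDomain S] (h : NewVariable l P z) {p : ℕ} (hp : p.Prime) [CharP K p]
    (F : G.FrobeniusData p) (hP : G.HasRoots p P) : G.PolyHasRoots p P z := by
  have : CharP S p := charP_of_injective_algebraMap (algebraMap K S).injective p
  have : Fact p.Prime := ⟨hp⟩
  intro f
  obtain ⟨n, hn⟩ : ∃ n, ∀ j, n ≤ j → f.coeff j = 0 :=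
    ⟨f.natDegree + 1, fun j hj => Polynomial.coeff_eq_zero_of_natDegree_lt (by omega)⟩
  revert f
  induction n with
  | zero =>
    intro f hn _ _
    refine ⟨0, fun j => by simp, ?_⟩
    rw [zero_pow hp.ne_zero]
    ext j
    simp [hn j]
  | succ n ih =>
    intro f hn hfP hf
    have hn' : ∀ j, n < j → f.coeff j = 0 := fun j hj => hn j hj
    obtain ⟨u, hu, hue⟩ := hP _ (hfP n) (killed_top hn' hf)
    by_cases hdvd : p ∣ n
    · obtain ⟨i, hi⟩ := hdvd
      have hn0 : (n : S) = 0 := (CharP.cast_eq_zero_iff S p n).2 ⟨i, hi⟩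
      have hc : ∀ j, (f - Polynomial.monomial n (f.coeff n)).coeff j
          = if j = n then 0 else f.coeff j := by
        intro j
        rw [Polynomial.coeff_sub, Polynomial.coeff_monomial]
        split_ifs with h1 h2 h2
        · subst h1; simp
        · exact absurd h1.symm h2
        · exact absurd h2.symm h1
        · simp
      obtain ⟨g, hg, hge⟩ := ih (f - Polynomial.monomial n (f.coeff n))
        (by
          intro j hj
          rw [hc]
          split_ifs with h1
          · rfl
          · exact hn j (by omega))
        (by
          intro j
          rw [hc]
          split_ifs
          · exact P.zero_mem
          · exact hfP j)
        (by
          intro v j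
          have h1 := hf v j
          rw [hc, hc]
          rcases eq_or_ne j n with rfl | hjn
          · rw [if_pos rfl, if_neg (by omega), hn (j + 1) le_rfl]
            simp
          · rw [if_neg hjn]
            rcases eq_or_ne (j + 1) n with rfl | hjn'
            · rw [if_pos rfl]
              push_cast at hn0
              rw [hn0] at h1
              simpa using h1
            · rwa [if_neg hjn'])
      refine ⟨g + Polynomial.monomial i u, ?_, ?_⟩
      · intro j
        rw [Polynomial.coeff_add, Polynomial.coeff_monomial]
        refine P.add_mem (hg j) ?_
        split_ifs
        · exact hu
        · exact P.zero_mem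
      · rw [add_pow_char, hge, Polynomial.monomial_pow, hue, mul_comm i p, ← hi]
        simp
    · refine ih f ?_ hfP hf
      have hne : (n : S) ≠ 0 := fun h0 => hdvd ((CharP.cast_eq_zero_iff S p n).1 h0)
      obtain ⟨i, rfl⟩ : ∃ i, n = i + 1 := ⟨n - 1, by
        have : n ≠ 0 := by rintro rfl; simp at hdvd
        omega⟩
      have hk := killed_subtop (z := z) hn' hf
      obtain ⟨e, he⟩ := G.exists_degLE (((i + 1 : ℕ) : S) * f.coeff (i + 1) * z + f.coeff i)
      obtain ⟨s, -, hs⟩ := F.root e _ hk he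
      obtain ⟨e', he'⟩ := G.exists_degLE (((i + 1 : ℕ) : S) * u)
      have h0 := h.eq_zero_of_pow hp F hP e' (((i + 1 : ℕ) : S) * u)
        (P.mul_mem (natCast_mem P _) hu) he' 1 le_rfl (f.coeff i) (hfP i) s (by
          rw [hs, pow_one, mul_pow, hue]
          congr 3
          exact map_natCast (frobenius S p) _)
      have hu0 : u = 0 := (mul_eq_zero.1 h0).resolve_left hne
      intro j hj
      rcases eq_or_lt_of_le hj with rfl | hj
      · rw [← hue, hu0, zero_pow hp.ne_zero]
      · exact hn j hj

lemma NewVariable.polyHasRoots_of_charZero (h : NewVariable l P z) [CharZero K]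
    (hconst : ∀ s, G.Killed s → ∃ k, s = algebraMap K S k) (hsq : ∀ k : K, ∃ c, c ^ 2 = k) :
    G.PolyHasRoots 2 P z := by
  intro f
  obtain ⟨n, hn⟩ : ∃ n, ∀ j, n ≤ j → f.coeff j = 0 :=
    ⟨f.natDegree + 1, fun j hj => Polynomial.coeff_eq_zero_of_natDegree_lt (by omega)⟩
  revert f
  induction n with
  | zero =>
    intro f hn _ _
    refine ⟨0, fun j => by simp, ?_⟩
    rw [zero_pow two_ne_zero]
    ext j
    simp [hn j]
  | succ n ih =>
    intro f hn hfP hf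
    have hn' : ∀ j, n < j → f.coeff j = 0 := fun j hj => hn j hj
    obtain ⟨k, hk⟩ := hconst _ (killed_top hn' hf)
    rcases n with _ | n
    · obtain ⟨c, rfl⟩ := hsq k
      refine ⟨Polynomial.C (algebraMap K S c), ?_, ?_⟩
      · intro j
        rw [Polynomial.coeff_C]
        split_ifs
        · exact P.algebraMap_mem c
        · exact P.zero_mem
      · rw [← Polynomial.C_pow, ← map_pow, ← hk]
        ext j
        rw [Polynomial.coeff_C]
        split_ifs with h0
        · rw [h0]
        · rw [hn j (by omega)]
    · refine ih f ?_ hfP hf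
      obtain ⟨c, hc⟩ := hconst _ (killed_subtop (z := z) hn' hf)
      have h1 := congrArg l.toFun hc
      rw [l.map_alg, map_add, h.vanish _ (hfP n), add_zero, hk, ← map_natCast (algebraMap K S),
        ← map_mul, ← Algebra.smul_def, map_smul, smul_eq_mul, mul_eq_zero, or_iff_left h.ne_zero,
        mul_eq_zero, or_iff_right (Nat.cast_ne_zero.2 (Nat.succ_ne_zero n))] at h1
      intro j hj
      rcases eq_or_lt_of_le hj with rfl | hj
      · rw [hk, h1, map_zero]
      · exact hn j hj

lemma NewVariable.transcendental [IsDomain S] (h : NewVariable l P z) {p : ℕ} (hp : 2 ≤ p)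
    (hT : G.PolyHasRoots p P z) (f : Polynomial S) (hf : ∀ j, f.coeff j ∈ P)
    (h0 : f.eval z = 0) : f = 0 := by
  obtain ⟨n, hn⟩ : ∃ n, ∀ j, n < j → f.coeff j = 0 :=
    ⟨f.natDegree, fun j hj => Polynomial.coeff_eq_zero_of_natDegree_lt hj⟩
  induction n using Nat.strong_induction_on generalizing f with
  | _ n ihn =>
  obtain ⟨e, he⟩ := G.exists_degLE (f.coeff n)
  induction e generalizing f with
  | zero =>
    exact eq_zero_of_descent n ihn f hf h0 hn (fun v g hg hg0 hgn hgtop => by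
      obtain ⟨k, hk⟩ := he.mem_range
      have hgn' : g.coeff n = 0 := by rw [hgtop, hk, G.D_alg v 1 k one_ne_zero]
      rcases n with _ | n
      · ext j
        rcases Nat.eq_zero_or_pos j with rfl | hj
        · simpa using hgn'
        · simpa using hgn j hj
      · refine ihn n (by omega) g hg hg0 fun j hj => ?_
        rcases eq_or_lt_of_le (show n + 1 ≤ j from hj) with rfl | hj
        · exact hgn'
        · exact hgn j hj)
  | succ e ihe =>
    exact eq_zero_of_descent n ihn f hf h0 hn (fun v g hg hg0 hgn hgtop =>
      ihe g hg hg0 hgn (by rw [hgtop]; exact he.D G v 1))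
where
  eq_zero_of_descent (n : ℕ) (ihn : ∀ m < n, ∀ f : Polynomial S, (∀ j, f.coeff j ∈ P) → f.eval z = 0 →
      (∀ j, m < j → f.coeff j = 0) → f = 0)
      (f : Polynomial S) (hf : ∀ j, f.coeff j ∈ P) (h0 : f.eval z = 0)
      (hn : ∀ j, n < j → f.coeff j = 0)
      (hlow : ∀ (v : V) (g : Polynomial S), (∀ j, g.coeff j ∈ P) → g.eval z = 0 →
        (∀ j, n < j → g.coeff j = 0) → g.coeff n = G.D v 1 (f.coeff n) → g = 0) : f = 0 := by
    obtain ⟨g, hg, hgf⟩ := hT f hf (by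
      intro v
      obtain ⟨d, hd, hdz⟩ := G.exists_total_derivative v z f
      have hd0 : d = 0 := by
        refine hlow v d (fun j => ?_) (by rw [hdz, h0, map_zero]) (fun j hj => ?_) ?_
        · rw [hd]
          exact P.add_mem (h.D_mem _ _ _ (hf j)) (P.mul_mem (P.mul_mem
            (P.add_mem (natCast_mem P j) P.one_mem) (hf _)) (h.D_mem' v 1 le_rfl))
        · rw [hd, hn j hj, hn (j + 1) (by omega)]
          simp
        · rw [hd, hn (n + 1) (by omega)]
          simp
      intro j
      rw [← hd, hd0, Polynomial.coeff_zero])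
    rcases Nat.eq_zero_or_pos n with rfl | hn0
    · have hC : f = Polynomial.C (f.coeff 0) := by
        ext j
        rw [Polynomial.coeff_C]
        split_ifs with hj
        · rw [hj]
        · exact hn j (Nat.pos_of_ne_zero hj)
      rw [hC, Polynomial.eval_C] at h0
      rw [hC, h0, map_zero]
    · have hnd : p * g.natDegree ≤ n := by
        rw [← Polynomial.natDegree_pow, hgf]
        exact Polynomial.natDegree_le_iff_coeff_eq_zero.2 hn
      have hlt : g.natDegree < n := by
        rcases Nat.eq_zero_or_pos g.natDegree with h1 | h1
        · omega
        · nlinarith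
      have hg0 : g = 0 := by
        refine ihn _ hlt g hg ?_ fun j hj => Polynomial.coeff_eq_zero_of_natDegree_lt hj
        rw [← hgf, Polynomial.eval_pow] at h0
        exact eq_zero_of_pow_eq_zero h0
      rw [← hgf, hg0, zero_pow (by omega)]

/-- Existence of roots propagates to the algebra generated by a new variable. -/
lemma NewVariable.hasRoots [IsDomain S] (h : NewVariable l P z) {p : ℕ} (hp : 2 ≤ p)
    (hT : G.PolyHasRoots p P z) :
    G.HasRoots p {s | ∃ f : Polynomial S, (∀ j, f.coeff j ∈ P) ∧ f.eval z = s} := by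
  rintro _ ⟨f, hf, rfl⟩ hk
  obtain ⟨g, hg, hgf⟩ := hT f hf (by
    intro v
    obtain ⟨d, hd, hdz⟩ := G.exists_total_derivative v z f
    have hd0 : d = 0 := by
      refine h.transcendental hp hT d (fun j => ?_) (by rw [hdz, hk v])
      rw [hd]
      exact P.add_mem (h.D_mem _ _ _ (hf j)) (P.mul_mem (P.mul_mem
        (P.add_mem (natCast_mem P j) P.one_mem) (hf _)) (h.D_mem' v 1 le_rfl))
    intro j
    rw [← hd, hd0, Polynomial.coeff_zero])
  exact ⟨g.eval z, ⟨g, hg, rfl⟩, by rw [← Polynomial.eval_pow, hgf]⟩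

end NewVariable

end HasseGraded

section

universe v

namespace HasseGraded

variable {K S V : Type*} [Field K] [CommRing S] [Algebra K S] (G : HasseGraded K S V)

/-- Homogeneous algebra generators which are linearly independent modulo decomposables. -/
structure Generators (ι : Type*) where
  /-- the generators -/
  gen : ι → S
  /-- their degrees -/
  deg : ι → ℕ
  /-- the dual point derivations -/
  dual : ι → PointDerivation G
  deg_pos : ∀ i, 1 ≤ deg i
  pr_gen : ∀ i, G.pr (deg i) (gen i) = gen i
  dual_self : ∀ i, (dual i).toFun (gen i) ≠ 0
  dual_ne : ∀ i j, i ≠ j → (dual i).toFun (gen j) = 0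
  mem_adjoin : ∀ e s, G.pr e s = s → s ∈ Algebra.adjoin K (gen '' {i | deg i ≤ e})

/-- Scalars and decomposable elements. -/
def decomposables : Submodule K S :=
  Submodule.span K ({1} ∪ {x | ∃ a b, G.pr 0 a = 0 ∧ G.pr 0 b = 0 ∧ x = a * b})

lemma pr_mem_adjoin_of_mem_decomposables {e : ℕ} (he : 1 ≤ e) {A : Subalgebra K S}
    (hA : ∀ k < e, ∀ s, G.pr k s = s → s ∈ A) {w : S} (hw : w ∈ G.decomposables) :
    G.pr e w ∈ A := by
  induction hw using Submodule.span_induction with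
  | mem x hx =>
    rcases hx with rfl | ⟨a, b, ha, hb, rfl⟩
    · have h1 := G.pr_ne e 0 1 (by omega)
      rw [← map_one (algebraMap K S), G.pr_alg, map_one] at h1
      rw [h1]
      exact A.zero_mem
    · rw [G.pr_mul]
      refine A.sum_mem fun x hx => ?_
      rw [Finset.HasAntidiagonal.mem_antidiagonal] at hx
      rcases Nat.eq_zero_or_pos x.1 with h1 | h1
      · rw [h1, ha, zero_mul]
        exact A.zero_mem
      rcases Nat.eq_zero_or_pos x.2 with h2 | h2
      · rw [h2, hb, mul_zero]
        exact A.zero_mem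
      exact A.mul_mem (hA _ (by omega) _ (G.pr_same _ _)) (hA _ (by omega) _ (G.pr_same _ _))
  | zero => rw [map_zero]; exact A.zero_mem
  | add x y _ _ hx hy => rw [map_add]; exact A.add_mem hx hy
  | smul c x _ hx => rw [map_smul]; exact A.smul_mem hx c

lemma exists_generators {S : Type v} [CommRing S] [Algebra K S] (G : HasseGraded K S V) :
    ∃ ι : Type v, Nonempty (G.Generators ι) := by
  classical
  set W := G.decomposables with hW
  set H : Set S := {s | ∃ e, 1 ≤ e ∧ G.pr e s = s} with hH
  obtain ⟨b, hbH, hspan, hli⟩ := exists_linearIndependent K (W.mkQ '' H)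
  have hHtop : Submodule.span K (W.mkQ '' H) = ⊤ := by
    rw [eq_top_iff]
    intro q _
    obtain ⟨s, rfl⟩ := W.mkQ_surjective q
    obtain ⟨n, hn⟩ := G.pr_sum s
    rw [hn, map_sum]
    refine Submodule.sum_mem _ fun e _ => ?_
    rcases Nat.eq_zero_or_pos e with rfl | he
    · obtain ⟨k, hk⟩ := G.pr_zero_mem s
      have : W.mkQ (G.pr 0 s) = 0 := by
        rw [hk, Submodule.mkQ_apply, Submodule.Quotient.mk_eq_zero, Algebra.algebraMap_eq_smul_one]
        exact W.smul_mem _ (Submodule.subset_span (Or.inl rfl))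
      rw [this]
      exact Submodule.zero_mem _
    · exact Submodule.subset_span ⟨_, ⟨e, he, G.pr_same _ _⟩, rfl⟩
  choose gen hgen using fun q : b => hbH q.2
  choose deg hdeg hpr using fun q : b => (hgen q).1
  have hmk : ∀ q, W.mkQ (gen q) = q := fun q => (hgen q).2
  obtain ⟨B, hB⟩ : ∃ B : Module.Basis b K (S ⧸ W), ∀ q, B q = q :=
    ⟨Module.Basis.mk hli (by rw [Subtype.range_coe, hspan, hHtop]), fun q => by simp⟩
  choose aug haug using G.pr_zero_mem
  let dual : b → PointDerivation G := fun q =>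
    { toFun := (B.coord q).comp W.mkQ
      aug := aug
      pr_zero := haug
      map_alg := by
        intro k
        have : W.mkQ (algebraMap K S k) = 0 := by
          rw [Submodule.mkQ_apply, Submodule.Quotient.mk_eq_zero, Algebra.algebraMap_eq_smul_one]
          exact W.smul_mem _ (Submodule.subset_span (Or.inl rfl))
        rw [LinearMap.comp_apply, this, map_zero]
      map_mul_eq_zero := by
        intro x y hx hy
        have : W.mkQ (x * y) = 0 := by
          rw [Submodule.mkQ_apply, Submodule.Quotient.mk_eq_zero]
          exact Submodule.subset_span (Or.inr ⟨x, y, hx, hy, rfl⟩)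
        rw [LinearMap.comp_apply, this, map_zero] }
  have hdual : ∀ i j, (dual i).toFun (gen j) = if j = i then 1 else 0 := by
    intro i j
    change B.coord i (W.mkQ (gen j)) = _
    rw [hmk, ← hB, B.coord_apply, B.repr_self, Finsupp.single_apply]
  refine ⟨b, ⟨⟨gen, deg, dual, hdeg, hpr, fun i => ?_, fun i j hij => ?_, ?_⟩⟩⟩
  · rw [hdual, if_pos rfl]
    exact one_ne_zero
  · rw [hdual, if_neg hij.symm]
  · intro e
    induction e using Nat.strong_induction_on with
    | _ e ih =>
    intro s hs
    rcases Nat.eq_zero_or_pos e with rfl | he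
    · obtain ⟨k, hk⟩ := G.pr_zero_mem s
      rw [← hs, hk]
      exact Subalgebra.algebraMap_mem _ k
    have h1 : s - (B.repr (W.mkQ s)).sum (fun q c => c • gen q) ∈ W := by
      rw [← Submodule.Quotient.mk_eq_zero, ← Submodule.mkQ_apply, map_sub, Finsupp.sum, map_sum]
      simp only [map_smul, hmk]
      rw [sub_eq_zero]
      conv_lhs => rw [← B.linearCombination_repr (W.mkQ s)]
      rw [Finsupp.linearCombination_apply, Finsupp.sum]
      simp only [hB]
    have h2 : G.pr e (s - (B.repr (W.mkQ s)).sum (fun q c => c • gen q)) ∈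
        Algebra.adjoin K (gen '' {i | deg i ≤ e}) :=
      G.pr_mem_adjoin_of_mem_decomposables he (fun k hk s hs =>
        Algebra.adjoin_mono (Set.image_mono fun i (hi : deg i ≤ k) => le_trans hi hk.le)
          (ih k hk s hs)) h1
    have h3 : G.pr e ((B.repr (W.mkQ s)).sum (fun q c => c • gen q)) ∈
        Algebra.adjoin K (gen '' {i | deg i ≤ e}) := by
      rw [Finsupp.sum, map_sum]
      refine Subalgebra.sum_mem _ fun q _ => ?_
      rw [map_smul]
      refine Subalgebra.smul_mem _ ?_ _
      by_cases hq : deg q = e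
      · rw [← hq, hpr]
        exact Algebra.subset_adjoin ⟨q, le_refl (deg q), rfl⟩
      · rw [← hpr, G.pr_ne _ _ _ (Ne.symm hq)]
        exact Subalgebra.zero_mem _
    rw [map_sub, hs] at h2
    have := Subalgebra.add_mem _ h2 h3
    rwa [sub_add_cancel] at this

namespace Generators

variable {G} {ι : Type*} (E : G.Generators ι)

lemma adjoin_eq_top : Algebra.adjoin K (Set.range E.gen) = ⊤ := by
  rw [eq_top_iff]
  intro s _
  obtain ⟨n, hn⟩ := G.pr_sum s
  rw [hn]
  exact Subalgebra.sum_mem _ fun e _ => Algebra.adjoin_mono (Set.image_subset_range _ _)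
    (E.mem_adjoin e _ (G.pr_same _ _))

lemma D_gen_mem (v : V) (n : ℕ) (hn : 1 ≤ n) (i : ι) {T : Set ι}
    (hT : ∀ j, E.deg j < E.deg i → j ∈ T) :
    G.D v n (E.gen i) ∈ Algebra.adjoin K (E.gen '' T) := by
  by_cases h : n ≤ E.deg i
  · refine Algebra.adjoin_mono (Set.image_mono fun j hj => hT j ?_)
      (E.mem_adjoin (E.deg i - n) _ ?_)
    · have : E.deg j ≤ E.deg i - n := hj
      have := E.deg_pos i
      omega
    · rw [G.D_pr, Nat.sub_add_cancel h, E.pr_gen]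
  · obtain ⟨m, hm⟩ := G.pr_sum (G.D v n (E.gen i))
    have : G.D v n (E.gen i) = 0 := by
      rw [hm]
      refine Finset.sum_eq_zero fun e _ => ?_
      rw [G.D_pr, ← E.pr_gen, G.pr_ne _ _ _ (by omega), map_zero]
    rw [this]
    exact Subalgebra.zero_mem _

lemma D_mem_adjoin {T : Set ι} (hT : ∀ i ∈ T, ∀ j, E.deg j < E.deg i → j ∈ T) (v : V) (n : ℕ)
    {s : S} (hs : s ∈ Algebra.adjoin K (E.gen '' T)) :
    G.D v n s ∈ Algebra.adjoin K (E.gen '' T) := by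
  induction hs using Algebra.adjoin_induction generalizing n with
  | mem x hx =>
    obtain ⟨i, hi, rfl⟩ := hx
    rcases Nat.eq_zero_or_pos n with rfl | hn
    · rw [G.D_zero]
      exact Algebra.subset_adjoin ⟨i, hi, rfl⟩
    · exact E.D_gen_mem v n hn i (hT i hi)
  | algebraMap r =>
    rcases Nat.eq_zero_or_pos n with rfl | hn
    · rw [G.D_zero]
      exact Subalgebra.algebraMap_mem _ r
    · rw [G.D_alg v n r (by omega)]
      exact Subalgebra.zero_mem _
  | add x y _ _ hx hy => rw [map_add]; exact Subalgebra.add_mem _ (hx n) (hy n)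
  | mul x y _ _ hx hy =>
    rw [G.D_mul]
    exact Subalgebra.sum_mem _ fun z _ => Subalgebra.mul_mem _ (hx _) (hy _)

/-- Elements of `P[z]` are values of polynomials with coefficients in `P`. -/
lemma exists_eval_of_mem_adjoin {s : Set S} {P : Subalgebra K S} {z : S} (hs : s ⊆ P ∪ {z}) {x : S}
    (hx : x ∈ Algebra.adjoin K s) :
    ∃ f : Polynomial S, (∀ j, f.coeff j ∈ P) ∧ f.eval z = x := by
  induction hx using Algebra.adjoin_induction with
  | mem x hx =>
    rcases hs hx with h | rfl
    · refine ⟨Polynomial.C x, fun j => ?_, by simp⟩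
      rw [Polynomial.coeff_C]
      split_ifs
      exacts [h, P.zero_mem]
    · refine ⟨Polynomial.X, fun j => ?_, by simp⟩
      rw [Polynomial.coeff_X]
      split_ifs
      exacts [P.one_mem, P.zero_mem]
  | algebraMap r =>
    refine ⟨Polynomial.C (algebraMap K S r), fun j => ?_, by simp⟩
    rw [Polynomial.coeff_C]
    split_ifs
    exacts [P.algebraMap_mem r, P.zero_mem]
  | add x y _ _ hx hy =>
    obtain ⟨f, hf, rfl⟩ := hx
    obtain ⟨g, hg, rfl⟩ := hy
    exact ⟨f + g, fun j => by rw [Polynomial.coeff_add]; exact P.add_mem (hf j) (hg j), by simp⟩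
  | mul x y _ _ hx hy =>
    obtain ⟨f, hf, rfl⟩ := hx
    obtain ⟨g, hg, rfl⟩ := hy
    refine ⟨f * g, fun j => ?_, by simp⟩
    rw [Polynomial.coeff_mul]
    exact P.sum_mem fun x _ => P.mul_mem (hf _) (hg _)

lemma eval_mem_subalgebra {P : Subalgebra K S} {f : Polynomial S} {z : S}
    (hf : ∀ n, f.coeff n ∈ P) (hz : z ∈ P) : f.eval z ∈ P := by
  rw [Polynomial.eval_eq_sum, Polynomial.sum_def]
  exact P.sum_mem fun n _ => P.mul_mem (hf n) (P.pow_mem hz n)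

/-- A criterion for algebraic independence along a linear order. -/
lemma algebraicIndependent_of_lt {κ : Type*} [LinearOrder κ] {f : ι → κ} (hf : f.Injective)
    [IsDomain S] {x : ι → S}
    (h : ∀ i, ∀ g : Polynomial S, (∀ n, g.coeff n ∈ Algebra.adjoin K (x '' {j | f j < f i})) →
      g.eval (x i) = 0 → g = 0) : AlgebraicIndependent K x := by
  classical
  refine algebraicIndependent_of_finite_type fun t ht => ?_
  obtain ⟨t, rfl⟩ := ht.exists_finset_coe
  change AlgebraicIndepOn K x _
  induction t using Finset.induction_on_max_value f with
  | empty =>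
    rw [Finset.coe_empty]
    exact algebraicIndependent_empty_type_iff.2 (algebraMap K S).injective
  | insert a s ha hs ih =>
    rw [Finset.coe_insert]
    refine (ih s.finite_toSet).insert ?_
    rw [transcendental_iff]
    intro p hp
    have hinj : Function.Injective (algebraMap (Algebra.adjoin K (x '' (s : Set ι))) S) :=
      Subtype.val_injective
    rw [Polynomial.aeval_def, ← Polynomial.eval_map] at hp
    refine (Polynomial.map_eq_zero_iff hinj).1 (h a _ (fun n => ?_) hp)
    rw [Polynomial.coeff_map]
    refine Algebra.adjoin_mono (Set.image_mono fun j hj => ?_) (p.coeff n).2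
    refine lt_of_le_of_ne (hs j hj) fun he => ha ?_
    rw [← hf he]
    exact hj

/-- The generators are algebraically independent as soon as roots propagate to new variables. -/
theorem algebraicIndependent [IsDomain S] {p : ℕ} (hp : 2 ≤ p)
    (hstep : ∀ (l : PointDerivation G) (P : Subalgebra K S) (z : S), NewVariable l P z →
      G.HasRoots p P → G.PolyHasRoots p P z)
    (hbot : ∀ k : K, ∃ c, c ^ p = k) : AlgebraicIndependent K E.gen := by
  classical
  let r : LinearOrder ι := linearOrderOfSTO (WellOrderingRel (α := ι))
  have hwf : @WellFounded ι (· < ·) := (WellOrderingRel.isWellOrder (α := ι)).toIsWellFounded.wf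
  let κ : ι → ℕ ×ₗ ι := fun i => toLex (E.deg i, i)
  have hκ : Function.Injective κ := fun i j h => congrArg Prod.snd (toLex.injective h)
  have hκwf : WellFounded (fun i j => κ i < κ j) := by
    have : WellFoundedLT ι := ⟨hwf⟩
    exact InvImage.wf κ wellFounded_lt
  have hκdeg : ∀ i j, E.deg i < E.deg j → κ i < κ j := fun i j h => Prod.Lex.toLex_lt_toLex.2 (Or.inl h)
  clear_value κ
  have hnew : ∀ i, NewVariable (E.dual i) (Algebra.adjoin K (E.gen '' {j | κ j < κ i}))
      (E.gen i) := fun i =>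
    { D_mem := fun v n s hs => E.D_mem_adjoin (fun j hj k hk => (hκdeg k j hk).trans hj) v n hs
      D_mem' := fun v n hn => E.D_gen_mem v n hn i fun j hj => hκdeg j i hj
      vanish := fun s hs => (E.dual i).eq_zero_of_mem_adjoin (by
        rintro _ ⟨j, hj, rfl⟩
        exact E.dual_ne i j fun h => (lt_irrefl _ (h ▸ hj : κ i < κ i))) hs
      ne_zero := E.dual_self i }
  have hroots : ∀ i, G.HasRoots p (Algebra.adjoin K (E.gen '' {j | κ j < κ i}) : Subalgebra K S) := by
    intro i
    induction i using hκwf.induction with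
    | _ i ih =>
    intro g hg hk
    have hcase : (∃ k, g = algebraMap K S k) ∨
        ∃ j, κ j < κ i ∧ g ∈ Algebra.adjoin K (E.gen '' {l | κ l ≤ κ j}) := by
      have hmono : ∀ j l, κ j ≤ κ l → Algebra.adjoin K (E.gen '' {l | κ l ≤ κ j}) ≤
          Algebra.adjoin K (E.gen '' {m | κ m ≤ κ l}) := fun j l hjl =>
        Algebra.adjoin_mono (Set.image_mono fun m hm => le_trans hm hjl)
      have hcomb : ∀ a b : S, ((∃ k, a = algebraMap K S k) ∨
          ∃ j, κ j < κ i ∧ a ∈ Algebra.adjoin K (E.gen '' {l | κ l ≤ κ j})) →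
          ((∃ k, b = algebraMap K S k) ∨
          ∃ j, κ j < κ i ∧ b ∈ Algebra.adjoin K (E.gen '' {l | κ l ≤ κ j})) →
          ((∃ k k', a = algebraMap K S k ∧ b = algebraMap K S k') ∨
          ∃ j, κ j < κ i ∧ a ∈ Algebra.adjoin K (E.gen '' {l | κ l ≤ κ j}) ∧
            b ∈ Algebra.adjoin K (E.gen '' {l | κ l ≤ κ j})) := by
        rintro a b (⟨k, rfl⟩ | ⟨j, hj, ha⟩) (⟨k', rfl⟩ | ⟨j', hj', hb⟩)
        · exact Or.inl ⟨k, k', rfl, rfl⟩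
        · exact Or.inr ⟨j', hj', Subalgebra.algebraMap_mem _ _, hb⟩
        · exact Or.inr ⟨j, hj, ha, Subalgebra.algebraMap_mem _ _⟩
        · rcases le_total (κ j) (κ j') with h | h
          · exact Or.inr ⟨j', hj', hmono _ _ h ha, hb⟩
          · exact Or.inr ⟨j, hj, ha, hmono _ _ h hb⟩
      clear hk
      induction hg using Algebra.adjoin_induction with
      | mem x hx =>
        obtain ⟨j, hj, rfl⟩ := hx
        exact Or.inr ⟨j, hj, Algebra.subset_adjoin ⟨j, le_refl (κ j), rfl⟩⟩
      | algebraMap c => exact Or.inl ⟨c, rfl⟩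
      | add x y _ _ hx hy =>
        rcases hcomb x y hx hy with ⟨k, k', rfl, rfl⟩ | ⟨j, hj, h1, h2⟩
        · exact Or.inl ⟨k + k', (map_add _ _ _).symm⟩
        · exact Or.inr ⟨j, hj, Subalgebra.add_mem _ h1 h2⟩
      | mul x y _ _ hx hy =>
        rcases hcomb x y hx hy with ⟨k, k', rfl, rfl⟩ | ⟨j, hj, h1, h2⟩
        · exact Or.inl ⟨k * k', (map_mul _ _ _).symm⟩
        · exact Or.inr ⟨j, hj, Subalgebra.mul_mem _ h1 h2⟩
    rcases hcase with ⟨k, rfl⟩ | ⟨j, hj, hgj⟩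
    · obtain ⟨c, rfl⟩ := hbot k
      exact ⟨algebraMap K S c, Subalgebra.algebraMap_mem _ _, (map_pow _ _ _).symm⟩
    · have hsub : Algebra.adjoin K (E.gen '' {l | κ l < κ j}) ≤
          Algebra.adjoin K (E.gen '' {l | κ l < κ i}) :=
        Algebra.adjoin_mono (Set.image_mono fun m hm => lt_trans hm hj)
      obtain ⟨_, ⟨f, hf, rfl⟩, hu⟩ := (hnew j).hasRoots hp (hstep _ _ _ (hnew j) (ih j hj)) g
        (exists_eval_of_mem_adjoin (by
          rintro _ ⟨l, hl, rfl⟩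
          rcases eq_or_lt_of_le (show κ l ≤ κ j from hl) with h | h
          · exact Or.inr (by rw [hκ h]; rfl)
          · exact Or.inl (Algebra.subset_adjoin ⟨l, h, rfl⟩)) hgj) hk
      refine ⟨_, ?_, hu⟩
      exact eval_mem_subalgebra (fun n => hsub (hf n))
        (Algebra.subset_adjoin (Set.mem_image_of_mem _ hj))
  exact algebraicIndependent_of_lt hκ fun i g hg h0 =>
    (hnew i).transcendental hp (hstep _ _ _ (hnew i) (hroots i)) g hg h0

end Generators

/-- A graded algebra with Hasse derivations in which elements with zero derivatives are
`p`-th powers is a polynomial algebra on homogeneous generators. -/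
theorem exists_generators_of_frobeniusData {S : Type v} [CommRing S] [Algebra K S] [IsDomain S]
    (G : HasseGraded K S V) {p : ℕ} (hp : p.Prime) [CharP K p] (F : G.FrobeniusData p) :
    ∃ (ι : Type v) (E : G.Generators ι), AlgebraicIndependent K E.gen := by
  obtain ⟨ι, ⟨E⟩⟩ := G.exists_generators
  refine ⟨ι, E, E.algebraicIndependent hp.two_le (fun l P z h hP => h.polyHasRoots hp F hP)
    fun k => ?_⟩
  obtain ⟨u, hu, huk⟩ := F.root 0 (algebraMap K S k) (G.killed_algebraMap k) (by
    intro j hj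
    rw [← G.pr_alg, G.pr_ne _ _ _ (by omega)])
  rw [Nat.zero_div] at hu
  obtain ⟨c, rfl⟩ := hu.mem_range
  exact ⟨c, (algebraMap K S).injective (by rw [map_pow, huk])⟩

/-- A graded algebra of characteristic zero with Hasse derivations in which only scalars have zero
derivatives is a polynomial algebra on homogeneous generators. -/
theorem exists_generators_of_charZero {S : Type v} [CommRing S] [Algebra K S] [IsDomain S]
    (G : HasseGraded K S V) [CharZero K] (hconst : ∀ s, G.Killed s → ∃ k, s = algebraMap K S k)
    (hsq : ∀ k : K, ∃ c, c ^ 2 = k) :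
    ∃ (ι : Type v) (E : G.Generators ι), AlgebraicIndependent K E.gen := by
  obtain ⟨ι, ⟨E⟩⟩ := G.exists_generators
  exact ⟨ι, E, E.algebraicIndependent le_rfl
    (fun l P z h _ => h.polyHasRoots_of_charZero hconst hsq) hsq⟩

end HasseGraded

end

section Generators

open MvPolynomial (aeval)

variable {K S ι : Type*} [Field K] [CommRing S] [Algebra K S] {x : ι → S}

lemma MvPolynomial.mem_span_X_image_of_X_mul_mem {T : Set ι} {i : ι} (hi : i ∉ T)
    {g : MvPolynomial ι K} (h : MvPolynomial.X i * g ∈ Ideal.span (MvPolynomial.X '' T)) :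
    g ∈ Ideal.span (MvPolynomial.X '' T : Set (MvPolynomial ι K)) := by
  rw [MvPolynomial.mem_ideal_span_X_image] at h ⊢
  intro m hm
  obtain ⟨j, hj, hne⟩ := h (Finsupp.single i 1 + m) (by
    rw [MvPolynomial.support_X_mul]
    exact Finset.mem_map_of_mem _ hm)
  refine ⟨j, hj, ?_⟩
  rwa [Finsupp.add_apply, Finsupp.single_eq_of_ne (by rintro rfl; exact hi hj), zero_add] at hne

/-- Distinct members of a free generating family form regular sequences. -/
lemma AlgebraicIndependent.mem_span_of_mul_mem (hx : AlgebraicIndependent K x)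
    (htop : Algebra.adjoin K (Set.range x) = ⊤) {T : Set ι} {i : ι} (hi : i ∉ T) {g : S}
    (h : x i * g ∈ Ideal.span (x '' T)) : g ∈ Ideal.span (x '' T) := by
  have hbij : Function.Bijective (aeval x : MvPolynomial ι K →ₐ[K] S) := by
    refine ⟨hx, ?_⟩
    rw [← AlgHom.range_eq_top, ← Algebra.adjoin_range_eq_range_aeval, htop]
  have hmap : Ideal.span (x '' T) = Ideal.map (aeval x : MvPolynomial ι K →ₐ[K] S)
      (Ideal.span (MvPolynomial.X '' T)) := by
    rw [Ideal.map_span, Set.image_image]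
    simp
  have hmem : ∀ q : MvPolynomial ι K, aeval x q ∈ Ideal.span (x '' T) →
      q ∈ Ideal.span (MvPolynomial.X '' T : Set (MvPolynomial ι K)) := by
    intro q hq
    rw [hmap, Ideal.mem_map_iff_of_surjective _ hbij.2] at hq
    obtain ⟨q', hq', he⟩ := hq
    rwa [← hbij.1 he]
  obtain ⟨G, rfl⟩ := hbij.2 g
  rw [hmap]
  refine Ideal.mem_map_of_mem _ (MvPolynomial.mem_span_X_image_of_X_mul_mem hi (hmem _ ?_))
  simpa using h

/-- Finitely many elements involve only finitely many generators. -/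
lemma exists_finset_forall_mem_adjoin (htop : Algebra.adjoin K (Set.range x) = ⊤) (F : Finset S) :
    ∃ T : Finset ι, ∀ s ∈ F, s ∈ Algebra.adjoin K (x '' T) := by
  classical
  induction F using Finset.induction_on with
  | empty => exact ⟨∅, by simp⟩
  | insert a F _ ih =>
    obtain ⟨T, hT⟩ := ih
    have ha : a ∈ Algebra.adjoin K (Set.range x) := htop ▸ Algebra.mem_top
    rw [Algebra.adjoin_range_eq_range_aeval] at ha
    obtain ⟨q, rfl⟩ := ha
    refine ⟨T ∪ q.vars, fun s hs => ?_⟩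
    rw [Finset.mem_insert] at hs
    rcases hs with rfl | hs
    · refine Algebra.adjoin_mono (Set.image_mono ?_) (?_ : _ ∈ Algebra.adjoin K (x '' q.vars))
      · simp
      · have h1 : aeval x q ∈ (Algebra.adjoin K (MvPolynomial.X '' (q.vars : Set ι))).map
            (aeval x : MvPolynomial ι K →ₐ[K] S) := ⟨q, q.mem_supported_vars, rfl⟩
        rw [AlgHom.map_adjoin, Set.image_image] at h1
        simpa using h1
    · exact Algebra.adjoin_mono (Set.image_mono (by simp)) (hT s hs)

end Generators

/-- `M` has a finite free resolution of length at most `k`. -/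
def HasFiniteFreeResolution (R : Type u) [Ring R] :
    ℕ → ∀ (M : Type u) [AddCommGroup M] [Module R M], Prop
  | 0, M, _, _ => Subsingleton M
  | k + 1, M, _, _ => ∃ (b : ℕ) (f : (Fin b → R) →ₗ[R] M), Function.Surjective f ∧
      HasFiniteFreeResolution R k (LinearMap.ker f)

namespace HasFiniteFreeResolution

section Ring

variable {R : Type u} [Ring R] {M N F : Type u} [AddCommGroup M] [Module R M] [AddCommGroup N]
  [Module R N] [AddCommGroup F] [Module R F]

lemma of_equiv {k : ℕ} (e : M ≃ₗ[R] N) (h : HasFiniteFreeResolution R k M) :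
    HasFiniteFreeResolution R k N := by
  cases k with
  | zero =>
    have : Subsingleton M := h
    exact e.symm.toEquiv.subsingleton
  | succ k =>
    obtain ⟨b, f, hf, hk⟩ := h
    refine ⟨b, e.toLinearMap ∘ₗ f, e.surjective.comp hf, ?_⟩
    rwa [LinearEquiv.ker_comp]

lemma succ {k : ℕ} (h : HasFiniteFreeResolution R k M) : HasFiniteFreeResolution R (k + 1) M := by
  induction k generalizing M with
  | zero =>
    have : Subsingleton M := h
    refine ⟨0, 0, fun m => ⟨0, Subsingleton.elim _ _⟩, ?_⟩
    change Subsingleton _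
    infer_instance
  | succ k ih =>
    obtain ⟨b, f, hf, hk⟩ := h
    exact ⟨b, f, hf, ih hk⟩

lemma mono {k l : ℕ} (hkl : k ≤ l) (h : HasFiniteFreeResolution R k M) :
    HasFiniteFreeResolution R l M := by
  induction hkl with
  | refl => exact h
  | step _ ih => exact ih.succ

lemma of_surjective {k n : ℕ} (e : (Fin n → R) ≃ₗ[R] F) (f : F →ₗ[R] M)
    (hf : Function.Surjective f) (h : HasFiniteFreeResolution R k (LinearMap.ker f)) :
    HasFiniteFreeResolution R (k + 1) M :=
  ⟨n, f ∘ₗ e.toLinearMap, hf.comp e.surjective, by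
    rw [LinearMap.ker_comp]
    exact h.of_equiv (e.ofSubmodule' (LinearMap.ker f)).symm⟩

lemma finEquiv (b : ℕ) : HasFiniteFreeResolution R 1 (Fin b → R) :=
  ⟨b, LinearMap.id, Function.surjective_id, by
    change Subsingleton _
    rw [LinearMap.ker_id]
    infer_instance⟩

/-- The horseshoe lemma. -/
lemma of_ker_of_range {k : ℕ} (g : M →ₗ[R] N) (hg : Function.Surjective g)
    (h1 : HasFiniteFreeResolution R k (LinearMap.ker g)) (h2 : HasFiniteFreeResolution R k N) :
    HasFiniteFreeResolution R k M := by
  induction k generalizing M N with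
  | zero =>
    have h1 : Subsingleton (LinearMap.ker g) := h1
    have h2 : Subsingleton N := h2
    refine ⟨fun x y => ?_⟩
    have h3 : (⟨x - y, by simpa using Subsingleton.elim _ _⟩ : LinearMap.ker g) = 0 :=
      Subsingleton.elim _ _
    exact sub_eq_zero.1 (congrArg Subtype.val h3)
  | succ k ih =>
    obtain ⟨a, f₁, hf₁, hk₁⟩ := h1
    obtain ⟨b, f₂, hf₂, hk₂⟩ := h2
    obtain ⟨f₃, hf₃⟩ := Module.projective_lifting_property g f₂ hg
    have hf₃' : ∀ y, g (f₃ y) = f₂ y := fun y => LinearMap.congr_fun hf₃ y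
    let f : (Fin a → R) × (Fin b → R) →ₗ[R] M :=
      LinearMap.coprod ((LinearMap.ker g).subtype ∘ₗ f₁) f₃
    have hfa : ∀ x y, f (x, y) = (f₁ x : M) + f₃ y := fun x y => by simp [f]
    have hgf : ∀ x y, g (f (x, y)) = f₂ y := fun x y => by
      rw [hfa, map_add, hf₃', LinearMap.mem_ker.1 (f₁ x).2, zero_add]
    have hf : Function.Surjective f := by
      intro m
      obtain ⟨y, hy⟩ := hf₂ (g m)
      obtain ⟨x, hx⟩ := hf₁ ⟨m - f₃ y, by
        rw [LinearMap.mem_ker, map_sub, hf₃', hy, sub_self]⟩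
      refine ⟨(x, y), ?_⟩
      rw [hfa, hx]
      simp
    let π : LinearMap.ker f →ₗ[R] LinearMap.ker f₂ :=
      (LinearMap.snd R _ _ ∘ₗ (LinearMap.ker f).subtype).codRestrict _ (by
        rintro ⟨⟨x, y⟩, h⟩
        have h' : f (x, y) = 0 := h
        change f₂ y = 0
        rw [← hgf x y, h', map_zero])
    have hπ : Function.Surjective π := by
      rintro ⟨y, hy⟩
      have hy' : f₂ y = 0 := hy
      obtain ⟨x, hx⟩ := hf₁ ⟨-f₃ y, by rw [LinearMap.mem_ker, map_neg, hf₃', hy', neg_zero]⟩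
      refine ⟨⟨(x, y), ?_⟩, rfl⟩
      rw [LinearMap.mem_ker, hfa, hx]
      simp
    let ε : LinearMap.ker f₁ →ₗ[R] LinearMap.ker π :=
      LinearMap.codRestrict _ ((LinearMap.inl R _ _ ∘ₗ (LinearMap.ker f₁).subtype).codRestrict _ (by
        rintro ⟨x, hx⟩
        have hx' : f₁ x = 0 := hx
        change f (x, 0) = 0
        rw [hfa, hx']
        simp)) (fun x => rfl)
    have hε : Function.Bijective ε := by
      constructor
      · intro x y hxy
        exact Subtype.ext (congrArg (fun z => z.1.1.1) hxy)
      · rintro ⟨⟨⟨x, y⟩, h⟩, h'⟩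
        have hy : y = 0 := congrArg Subtype.val h'
        subst hy
        have h'' : f (x, 0) = 0 := h
        rw [hfa, map_zero, add_zero] at h''
        exact ⟨⟨x, Subtype.ext h''⟩, rfl⟩
    have hker := ih π hπ (hk₁.of_equiv (LinearEquiv.ofBijective ε hε)) hk₂
    exact of_surjective ((LinearEquiv.sumArrowLequivProdArrow (Fin a) (Fin b) R R).symm.trans
      (LinearEquiv.funCongrLeft R R finSumFinEquiv.symm)).symm f hf hker

/-- The quotient term of a short exact sequence. -/
lemma of_ker {k : ℕ} (g : M →ₗ[R] N) (hg : Function.Surjective g)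
    (h1 : HasFiniteFreeResolution R k (LinearMap.ker g)) (h2 : HasFiniteFreeResolution R k M) :
    HasFiniteFreeResolution R (k + 1) N := by
  cases k with
  | zero =>
    have : Subsingleton M := h2
    have h3 : HasFiniteFreeResolution R 0 N := hg.subsingleton
    exact h3.succ
  | succ k =>
    obtain ⟨a, f, hf, hk⟩ := h2
    refine ⟨a, g ∘ₗ f, hg.comp hf, ?_⟩
    let π : LinearMap.ker (g ∘ₗ f) →ₗ[R] LinearMap.ker g :=
      (f ∘ₗ (LinearMap.ker (g ∘ₗ f)).subtype).codRestrict _ (fun x => x.2)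
    have hπ : Function.Surjective π := by
      rintro ⟨y, hy⟩
      obtain ⟨x, rfl⟩ := hf y
      exact ⟨⟨x, hy⟩, rfl⟩
    let ε : LinearMap.ker f →ₗ[R] LinearMap.ker π :=
      LinearMap.codRestrict _ (Submodule.inclusion (LinearMap.ker_le_ker_comp f g))
        (fun x => Subtype.ext x.2)
    have hε : Function.Bijective ε := by
      constructor
      · intro x y hxy
        exact Subtype.ext (congrArg (fun z => z.1.1) hxy)
      · rintro ⟨⟨x, h⟩, h'⟩
        exact ⟨⟨x, congrArg Subtype.val h'⟩, rfl⟩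
    exact of_ker_of_range π hπ (hk.of_equiv (LinearEquiv.ofBijective ε hε)).succ h1

end Ring

section BaseChange

variable {R : Type u} [CommRing R] (A : Type u) [CommRing A] [Algebra R A] [Module.Flat R A]

open TensorProduct in
/-- Flat base change of finite free resolutions. -/
lemma baseChange {k : ℕ} {M : Type u} [AddCommGroup M] [Module R M]
    (h : HasFiniteFreeResolution R k M) : HasFiniteFreeResolution A k (A ⊗[R] M) := by
  induction k generalizing M with
  | zero =>
    have : Subsingleton M := h
    exact (inferInstance : Subsingleton (A ⊗[R] M))
  | succ k ih =>
    obtain ⟨b, f, hf, hk⟩ := h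
    have hex : Function.Exact ((LinearMap.ker f).subtype.baseChange A) (f.baseChange A) :=
      lTensor_exact A (LinearMap.exact_subtype_ker_map f) hf
    have hinj : Function.Injective ((LinearMap.ker f).subtype.baseChange A) :=
      Module.Flat.lTensor_preserves_injective_linearMap _ Subtype.val_injective
    have e : (A ⊗[R] LinearMap.ker f) ≃ₗ[A] LinearMap.ker (f.baseChange A) :=
      (LinearEquiv.ofInjective _ hinj).trans (LinearEquiv.ofEq _ _ hex.linearMap_ker_eq.symm)
    refine of_surjective (TensorProduct.piScalarRight R A A (Fin b)).symm (f.baseChange A)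
      (LinearMap.lTensor_surjective A hf) ((ih hk).of_equiv e)

end BaseChange

end HasFiniteFreeResolution

section

open TensorProduct Polynomial

namespace HasFiniteFreeResolution

section Swan

variable {R : Type u} [CommRing R]

/-- The vectors in a submodule of `R[X]ⁿ` all of whose entries have degree less than `j`. -/
def truncation {n : ℕ} (N : Submodule R[X] (Fin n → R[X])) (j : ℕ) : Submodule R N where
  carrier := {v | ∀ i, v.1 i ∈ degreeLT R j}
  add_mem' ha hb i := (degreeLT R j).add_mem (ha i) (hb i)
  zero_mem' _ := (degreeLT R j).zero_mem
  smul_mem' c _ ha i := (degreeLT R j).smul_mem c (ha i)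

variable {n : ℕ} {N : Submodule R[X] (Fin n → R[X])}

lemma mem_truncation {j : ℕ} {v : N} :
    v ∈ truncation N j ↔ ∀ i k, j ≤ k → (v.1 i).coeff k = 0 := by
  refine forall_congr' fun i => ?_
  rw [mem_degreeLT, degree_lt_iff_coeff_zero]

lemma truncation_mono {j k : ℕ} (h : j ≤ k) : truncation N j ≤ truncation N k :=
  fun _ hv i => degreeLT_mono h (hv i)

lemma X_smul_mem_truncation {j : ℕ} {v : N} (hv : v ∈ truncation N j) :
    (X : R[X]) • v ∈ truncation N (j + 1) := by
  rw [mem_truncation] at hv ⊢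
  intro i k hk
  obtain ⟨k, rfl⟩ : ∃ l, k = l + 1 := ⟨k - 1, by omega⟩
  change (X * v.1 i).coeff (k + 1) = 0
  rw [coeff_X_mul, hv i k (by omega)]

instance [IsNoetherianRing R] (j : ℕ) : Module.Finite R (truncation N j) := by
  let f : truncation N j →ₗ[R] (Fin n → degreeLT R j) :=
    { toFun := fun v i => ⟨v.1.1 i, v.2 i⟩
      map_add' := fun _ _ => rfl
      map_smul' := fun _ _ => rfl }
  have hf : Function.Injective f := by
    intro v w h
    refine Subtype.ext (Subtype.ext (funext fun i => ?_))
    exact congrArg Subtype.val (congrFun h i)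
  have : Module.Finite R (degreeLT R j) := Module.Finite.equiv (degreeLTEquiv R j).symm
  exact Module.Finite.of_injective f hf

lemma exists_truncation_span [IsNoetherianRing R] (N : Submodule R[X] (Fin n → R[X])) :
    ∃ j, Submodule.span R[X] (truncation N j : Set N) = ⊤ := by
  obtain ⟨s, hs⟩ := (inferInstance : Module.Finite R[X] N).1
  refine ⟨(s.sup fun v => Finset.univ.sup fun i => (v.1 i).natDegree) + 1, ?_⟩
  rw [eq_top_iff, ← hs]
  refine Submodule.span_mono fun v hv => mem_truncation.2 fun i k hk =>
    coeff_eq_zero_of_natDegree_lt (lt_of_lt_of_le (Nat.lt_succ_of_le ?_) hk)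
  exact (Finset.le_sup (f := fun i => (v.1 i).natDegree) (Finset.mem_univ i)).trans
    (Finset.le_sup (f := fun v : N => Finset.univ.sup fun i => (v.1 i).natDegree) hv)

/-- Multiplication by `X` on truncations. -/
noncomputable def truncationX (N : Submodule R[X] (Fin n → R[X])) (j : ℕ) :
    truncation N j →ₗ[R] truncation N (j + 1) where
  toFun v := ⟨(X : R[X]) • v.1, X_smul_mem_truncation v.2⟩
  map_add' _ _ := Subtype.ext (smul_add _ _ _)
  map_smul' _ _ := Subtype.ext (smul_comm _ _ _)

/-- The surjection `R[X] ⊗ N_j → N`. -/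
noncomputable def ofTruncation (N : Submodule R[X] (Fin n → R[X])) (j : ℕ) :
    R[X] ⊗[R] truncation N j →ₗ[R[X]] N :=
  (truncation N j).subtype.liftBaseChange R[X]

/-- The map `R[X] ⊗ N_j → R[X] ⊗ N_{j+1}` sending `f ⊗ v` to `Xf ⊗ v - f ⊗ Xv`. -/
noncomputable def relTruncation (N : Submodule R[X] (Fin n → R[X])) (j : ℕ) :
    R[X] ⊗[R] truncation N j →ₗ[R[X]] R[X] ⊗[R] truncation N (j + 1) :=
  (X : R[X]) • (Submodule.inclusion (truncation_mono j.le_succ)).baseChange R[X]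
    - (truncationX N j).baseChange R[X]

lemma ofTruncation_tmul {j : ℕ} (f : R[X]) (v : truncation N j) :
    ofTruncation N j (f ⊗ₜ v) = f • v.1 := by
  simp [ofTruncation]

lemma relTruncation_tmul {j : ℕ} (f : R[X]) (v : truncation N j) :
    relTruncation N j (f ⊗ₜ v) =
      (X * f) ⊗ₜ Submodule.inclusion (truncation_mono j.le_succ) v - f ⊗ₜ truncationX N j v := by
  simp [relTruncation, TensorProduct.smul_tmul']

/-- Coefficients in `R[X] ⊗ M`. -/
noncomputable def tensorCoeff (M : Type u) [AddCommMonoid M] [Module R M] :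
    R[X] ⊗[R] M ≃ₗ[R] ℕ →₀ M :=
  TensorProduct.equivFinsuppOfBasisLeft (Polynomial.basisMonomials R)

lemma tensorCoeff_tmul {M : Type u} [AddCommMonoid M] [Module R M] (f : R[X]) (v : M) (i : ℕ) :
    tensorCoeff M (f ⊗ₜ[R] v) i = f.coeff i • v := by
  rw [tensorCoeff, TensorProduct.equivFinsuppOfBasisLeft_apply_tmul_apply]
  rfl

lemma exists_sum_range {M : Type u} [AddCommMonoid M] [Module R M] (z : R[X] ⊗[R] M) :
    ∃ (m : ℕ) (v : ℕ → M), z = ∑ i ∈ Finset.range m, (X ^ i : R[X]) ⊗ₜ[R] v i := by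
  obtain ⟨b, rfl⟩ := (tensorCoeff M).symm.surjective z
  obtain ⟨m, hm⟩ : ∃ m, b.support ⊆ Finset.range m :=
    ⟨b.support.sup id + 1, fun i hi =>
      Finset.mem_range.2 (Nat.lt_succ_of_le (Finset.le_sup (f := id) hi))⟩
  refine ⟨m, b, ?_⟩
  rw [tensorCoeff, TensorProduct.equivFinsuppOfBasisLeft_symm_apply,
    Finsupp.sum_of_support_subset _ hm _ (by simp)]
  refine Finset.sum_congr rfl fun i _ => ?_
  simp [Polynomial.X_pow_eq_monomial]

lemma injective_X_smul_sub {A B : Type u} [AddCommMonoid A] [Module R A] [AddCommMonoid B]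
    [Module R B] (f g : A →ₗ[R] B) (hg : ∀ a, g a = 0 → a = 0)
    (h : R[X] ⊗[R] A →ₗ[R[X]] R[X] ⊗[R] B)
    (htmul : ∀ (p : R[X]) (v : A), h (p ⊗ₜ v) + p ⊗ₜ g v = (X * p) ⊗ₜ f v) :
    ∀ z, h z = 0 → z = 0 := by
  have h0 : ∀ z, tensorCoeff B (h z) 0 + g (tensorCoeff A z 0) = 0 := by
    intro z
    induction z with
    | zero => simp
    | add x y hx hy =>
      simp only [map_add, Finsupp.add_apply]
      rw [add_add_add_comm, hx, hy, add_zero]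
    | tmul p v =>
      have := congrArg (fun t => tensorCoeff B t 0) (htmul p v)
      simp only [map_add, Finsupp.add_apply, tensorCoeff_tmul, coeff_X_mul_zero, zero_smul] at this
      rw [tensorCoeff_tmul, map_smul, this]
  have h1 : ∀ z i, tensorCoeff B (h z) (i + 1) + g (tensorCoeff A z (i + 1)) =
      f (tensorCoeff A z i) := by
    intro z i
    induction z with
    | zero => simp
    | add x y hx hy =>
      simp only [map_add, Finsupp.add_apply]
      rw [add_add_add_comm, hx, hy]
    | tmul p v =>
      have := congrArg (fun t => tensorCoeff B t (i + 1)) (htmul p v)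
      simp only [map_add, Finsupp.add_apply, tensorCoeff_tmul, coeff_X_mul] at this
      rw [tensorCoeff_tmul, map_smul, this, tensorCoeff_tmul, map_smul]
  intro z hz
  have hB : tensorCoeff (R := R) B 0 = 0 := (tensorCoeff B).map_zero
  rw [← (tensorCoeff A).map_eq_zero_iff]
  refine Finsupp.ext fun i => ?_
  induction i with
  | zero =>
    have := h0 z
    rw [hz, hB, Finsupp.coe_zero, Pi.zero_apply, zero_add] at this
    exact hg _ this
  | succ i ih =>
    have := h1 z i
    rw [hz, hB, ih, Finsupp.coe_zero, Finsupp.coe_zero, Pi.zero_apply, Pi.zero_apply, zero_add,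
      map_zero] at this
    exact hg _ this

lemma relTruncation_injective (N : Submodule R[X] (Fin n → R[X])) (j : ℕ) :
    Function.Injective (relTruncation N j) := by
  rw [injective_iff_map_eq_zero]
  refine injective_X_smul_sub (Submodule.inclusion (truncation_mono j.le_succ)) (truncationX N j)
    (fun v h => Subtype.ext (Subtype.ext (funext fun i => ?_))) _ fun p v => by
      rw [relTruncation_tmul, sub_add_cancel]
  have h2 : X * v.1.1 i = 0 := congrArg (fun t => t.1.1 i) h
  ext k
  rw [← coeff_X_mul, h2]
  rfl

lemma sum_mem_range_relTruncation {j : ℕ} (m : ℕ) (v : ℕ → truncation N (j + 1))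
    (h : ∑ i ∈ Finset.range m, (X ^ i : R[X]) • (v i).1 = 0) :
    ∑ i ∈ Finset.range m, (X ^ i : R[X]) ⊗ₜ[R] v i ∈ LinearMap.range (relTruncation N j) := by
  induction m generalizing v with
  | zero => simp
  | succ m ih =>
    rcases m with _ | m
    · have h0 : v 0 = 0 := Subtype.ext (by simpa using h)
      simp [h0]
    have hv : (v (m + 1)).1 ∈ truncation N j := by
      rw [mem_truncation]
      intro c k hk
      rcases eq_or_lt_of_le hk with rfl | hk
      · have h1 := congrArg (fun w : N => (w.1 c).coeff (j + (m + 1))) h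
        simp only [Submodule.coe_sum, Submodule.coe_smul, Finset.sum_apply, Pi.smul_apply,
          smul_eq_mul, finsetSum_coeff] at h1
        rw [Finset.sum_range_succ, Finset.sum_eq_zero, zero_add, mul_comm, coeff_mul_X_pow] at h1
        · simpa using h1
        · intro i hi
          rw [Finset.mem_range] at hi
          rw [mul_comm, show j + (m + 1) = (j + (m + 1) - i) + i by omega, coeff_mul_X_pow]
          exact mem_truncation.1 (v i).2 c _ (by omega)
      · exact mem_truncation.1 (v (m + 1)).2 c k hk
    set w : truncation N j := ⟨_, hv⟩ with hw
    have hrel := relTruncation_tmul (X ^ m : R[X]) w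
    have hincl : Submodule.inclusion (truncation_mono j.le_succ) w = v (m + 1) := rfl
    rw [hincl, ← pow_succ'] at hrel
    rw [Finset.sum_range_succ, ← sub_add_cancel ((X ^ (m + 1) : R[X]) ⊗ₜ[R] v (m + 1))
      ((X ^ m : R[X]) ⊗ₜ[R] truncationX N j w), ← hrel]
    have hsum := ih (Function.update v m (v m + truncationX N j w)) (by
      rw [Finset.sum_range_succ, Finset.sum_range_succ] at h
      rw [Finset.sum_range_succ, Function.update_self, Finset.sum_congr rfl fun i hi => by
        rw [Function.update_of_ne (Finset.mem_range.1 hi).ne]]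
      rw [← h]
      change _ + X ^ m • ((v m).1 + (X : R[X]) • (v (m + 1)).1) = _
      rw [smul_add, smul_smul, ← pow_succ, add_assoc])
    rw [Finset.sum_range_succ, Function.update_self, Finset.sum_congr rfl fun i hi => by
        rw [Function.update_of_ne (Finset.mem_range.1 hi).ne], tmul_add] at hsum
    rw [Finset.sum_range_succ]
    have := Submodule.add_mem _ hsum (LinearMap.mem_range_self (relTruncation N j)
      ((X ^ m : R[X]) ⊗ₜ[R] w))
    convert this using 1
    abel

lemma ker_ofTruncation (N : Submodule R[X] (Fin n → R[X])) (j : ℕ) :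
    LinearMap.ker (ofTruncation N (j + 1)) = LinearMap.range (relTruncation N j) := by
  apply le_antisymm
  · intro z hz
    obtain ⟨m, v, rfl⟩ := exists_sum_range z
    refine sum_mem_range_relTruncation m v ?_
    simpa [ofTruncation_tmul] using hz
  · rintro _ ⟨z, rfl⟩
    rw [LinearMap.mem_ker]
    induction z with
    | zero => simp
    | add x y hx hy => rw [map_add, map_add, hx, hy, add_zero]
    | tmul f v =>
      rw [relTruncation_tmul, map_sub, ofTruncation_tmul, ofTruncation_tmul, sub_eq_zero, mul_comm,
        mul_smul]
      rfl

/-- Finitely generated modules over `R[X]` have finite free resolutions if those over `R` do. -/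
theorem polynomial [IsNoetherianRing R]
    (h : ∀ (M : Type u) [AddCommGroup M] [Module R M] [Module.Finite R M],
      ∃ k, HasFiniteFreeResolution R k M)
    (M : Type u) [AddCommGroup M] [Module R[X] M] [Module.Finite R[X] M] :
    ∃ k, HasFiniteFreeResolution R[X] k M := by
  obtain ⟨n, f, hf⟩ := Module.Finite.exists_fin' R[X] M
  suffices H : ∃ k, HasFiniteFreeResolution R[X] k (LinearMap.ker f) by
    obtain ⟨k, hk⟩ := H
    exact ⟨k + 1, n, f, hf, hk⟩
  set N := LinearMap.ker f
  obtain ⟨j, hj⟩ := exists_truncation_span N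
  obtain ⟨k₁, hk₁⟩ := h (truncation N j)
  obtain ⟨k₂, hk₂⟩ := h (truncation N (j + 1))
  refine ⟨max k₁ k₂ + 1, of_ker (ofTruncation N (j + 1)) ?_ ?_
    ((hk₂.baseChange R[X]).mono (le_max_right _ _))⟩
  · rw [← LinearMap.range_eq_top, eq_top_iff, ← hj, Submodule.span_le]
    intro v hv
    exact ⟨1 ⊗ₜ ⟨v, truncation_mono j.le_succ hv⟩, by rw [ofTruncation_tmul, one_smul]⟩
  · rw [ker_ofTruncation]
    exact ((hk₁.baseChange R[X]).mono (le_max_left _ _)).of_equiv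
      (LinearEquiv.ofInjective _ (relTruncation_injective N j))

end Swan

section RingEquiv

variable {R' : Type u} [Ring R'] {R : Type u} [Ring R]

/-- Finite free resolutions along a semilinear equivalence. -/
lemma of_addEquiv (σ : R ≃+* R') {k : ℕ} {M M' : Type u} [AddCommGroup M] [Module R M] [AddCommGroup M']
    [Module R' M'] (φ : M ≃+ M') (hφ : ∀ r m, φ (r • m) = σ r • φ m)
    (h : HasFiniteFreeResolution R k M) : HasFiniteFreeResolution R' k M' := by
  induction k generalizing M M' with
  | zero =>
    have : Subsingleton M := h
    exact φ.symm.toEquiv.subsingleton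
  | succ k ih =>
    obtain ⟨b, f, hf, hk⟩ := h
    let τ : (Fin b → R) ≃+ (Fin b → R') := AddEquiv.piCongrRight fun _ => σ.toAddEquiv
    have hτ : ∀ (r : R) (x : Fin b → R), τ (r • x) = σ r • τ x := by
      intro r x
      ext i
      exact map_mul σ r (x i)
    have hτ' : ∀ (r : R') (x : Fin b → R'), τ.symm (r • x) = σ.symm r • τ.symm x := by
      intro r x
      apply τ.injective
      rw [hτ]
      simp
    let g : (Fin b → R') →ₗ[R'] M' :=
      { toFun := fun x => φ (f (τ.symm x))
        map_add' := fun x y => by simp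
        map_smul' := fun r x => by rw [hτ', map_smul, hφ]; simp }
    refine ⟨b, g, φ.surjective.comp (hf.comp τ.symm.surjective), ?_⟩
    let ψ : LinearMap.ker f ≃+ LinearMap.ker g :=
      { toFun := fun x => ⟨τ x.1, by
          change φ (f (τ.symm (τ x.1))) = 0
          rw [τ.symm_apply_apply, LinearMap.mem_ker.1 x.2, map_zero]⟩
        invFun := fun y => ⟨τ.symm y.1, by
          have : φ (f (τ.symm y.1)) = 0 := y.2
          exact φ.map_eq_zero_iff.1 this⟩
        left_inv := fun x => Subtype.ext (τ.symm_apply_apply _)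
        right_inv := fun y => Subtype.ext (τ.apply_symm_apply _)
        map_add' := fun x y => Subtype.ext (map_add τ _ _) }
    exact ih ψ (fun r x => Subtype.ext (hτ r x.1)) hk

lemma of_ringEquiv (σ : R ≃+* R') (h : ∀ (M : Type u) [AddCommGroup M] [Module R M] [Module.Finite R M],
      ∃ k, HasFiniteFreeResolution R k M)
    (M : Type u) [AddCommGroup M] [Module R' M] [Module.Finite R' M] :
    ∃ k, HasFiniteFreeResolution R' k M := by
  let _ : Module R M := Module.compHom M σ.toRingHom
  have hsmul : ∀ (r : R) (m : M), r • m = σ r • m := fun _ _ => rfl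
  have : Module.Finite R M := by
    obtain ⟨s, hs⟩ := (inferInstance : Module.Finite R' M).1
    refine ⟨s, ?_⟩
    rw [eq_top_iff]
    intro m _
    have hm : m ∈ Submodule.span R' (s : Set M) := hs ▸ Submodule.mem_top
    induction hm using Submodule.span_induction with
    | mem x hx => exact Submodule.subset_span hx
    | zero => exact Submodule.zero_mem _
    | add x y _ _ hx hy => exact Submodule.add_mem _ (hx trivial) (hy trivial)
    | smul a x _ hx =>
      have := Submodule.smul_mem _ (σ.symm a) (hx trivial)
      rwa [hsmul, σ.apply_symm_apply] at this
  obtain ⟨k, hk⟩ := h M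
  exact ⟨k, of_addEquiv σ (AddEquiv.refl M) hsmul hk⟩

end RingEquiv

/-- Hilbert's syzygy theorem, without a bound on the length. -/
theorem mvPolynomial {K : Type u} [Field K] (r : ℕ) (M : Type u) [AddCommGroup M]
    [Module (MvPolynomial (Fin r) K) M] [Module.Finite (MvPolynomial (Fin r) K) M] :
    ∃ k, HasFiniteFreeResolution (MvPolynomial (Fin r) K) k M := by
  induction r generalizing M with
  | zero =>
    refine of_ringEquiv (MvPolynomial.isEmptyRingEquiv K (Fin 0)).symm ?_ M
    intro M _ _ _
    exact ⟨1, (finEquiv _).of_equiv (Module.finBasis K M).equivFun.symm⟩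
  | succ r ih =>
    exact of_ringEquiv (MvPolynomial.finSuccEquiv K r).symm.toRingEquiv
      (fun M _ _ _ => polynomial (fun M _ _ _ => ih M) M) M

end HasFiniteFreeResolution

end

section

open Filter Polynomial

/-- The ideal of families which vanish eventually. -/
def eventuallyZero (U : Ultrafilter ℕ) (B : ℕ → Type u) [∀ i, CommRing (B i)] :
    Ideal (∀ i, B i) where
  carrier := {f | ∀ᶠ i in U, f i = 0}
  add_mem' := by
    intro f g hf hg
    filter_upwards [hf, hg] with i h1 h2
    rw [Pi.add_apply, h1, h2, add_zero]
  zero_mem' := Eventually.of_forall fun _ => rfl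
  smul_mem' := by
    intro c f hf
    filter_upwards [hf] with i h
    rw [Pi.smul_apply', h, smul_zero]

/-- The ultraproduct of a sequence of commutative rings. -/
abbrev UltraProd (U : Ultrafilter ℕ) (B : ℕ → Type u) [∀ i, CommRing (B i)] : Type u :=
  (∀ i, B i) ⧸ eventuallyZero U B

namespace UltraProd

variable {B' : ℕ → Type u} [∀ i, CommRing (B' i)]
variable {U : Ultrafilter ℕ} {B : ℕ → Type u} [∀ i, CommRing (B i)]

/-- The class of a family in the ultraproduct. -/
abbrev mk (U : Ultrafilter ℕ) : (∀ i, B i) →+* UltraProd U B :=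
  Ideal.Quotient.mk (eventuallyZero U B)

lemma mk_surjective : Function.Surjective (mk (B := B) U) := Ideal.Quotient.mk_surjective

lemma mk_eq_zero {f : ∀ i, B i} : mk U f = 0 ↔ ∀ᶠ i in U, f i = 0 :=
  Ideal.Quotient.eq_zero_iff_mem

lemma mk_eq_mk {f g : ∀ i, B i} : mk U f = mk U g ↔ ∀ᶠ i in U, f i = g i := by
  rw [← sub_eq_zero, ← map_sub, mk_eq_zero]
  exact eventually_congr (Eventually.of_forall fun i => sub_eq_zero)

/-- The map of ultraproducts induced by a family of ring homomorphisms. -/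
def map (U : Ultrafilter ℕ) (φ : ∀ i, B i →+* B' i) : UltraProd U B →+* UltraProd U B' :=
  Ideal.quotientMap _ (RingHom.pi fun i => (φ i).comp (Pi.evalRingHom B i)) (by
    intro f hf
    change ∀ᶠ i in U, φ i (f i) = 0
    filter_upwards [show ∀ᶠ i in U, f i = 0 from hf] with i h
    rw [h, map_zero])

@[simp] lemma map_mk (φ : ∀ i, B i →+* B' i) (f : ∀ i, B i) :
    map U φ (mk U f) = mk U fun i => φ i (f i) := rfl

lemma map_injective {φ : ∀ i, B i →+* B' i} (h : ∀ i, Function.Injective (φ i)) :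
    Function.Injective (map U φ) := by
  rw [injective_iff_map_eq_zero]
  intro x hx
  obtain ⟨f, rfl⟩ := mk_surjective x
  rw [map_mk, mk_eq_zero] at hx
  rw [mk_eq_zero]
  filter_upwards [hx] with i hi
  exact (map_eq_zero_iff _ (h i)).1 hi

lemma map_bijective {φ : ∀ i, B i →+* B' i} (h : ∀ i, Function.Bijective (φ i)) :
    Function.Bijective (map U φ) := by
  refine ⟨map_injective fun i => (h i).1, fun x => ?_⟩
  obtain ⟨f, rfl⟩ := mk_surjective x
  choose g hg using fun i => (h i).2 (f i)
  exact ⟨mk U g, by rw [map_mk]; simp only [hg]⟩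

section Field

variable {k : ℕ → Type u} [∀ i, Field (k i)]

instance : (eventuallyZero U k).IsMaximal := by
  refine Ideal.Quotient.maximal_of_isField _ ⟨⟨0, 1, ?_⟩, mul_comm, fun {a} ha => ?_⟩
  · intro h
    have h2 : mk U (0 : ∀ i, k i) = mk U 1 := h
    rw [mk_eq_mk] at h2
    obtain ⟨i, hi⟩ := h2.exists
    exact zero_ne_one hi
  · obtain ⟨f, rfl⟩ := mk_surjective a
    refine ⟨mk U fun i => (f i)⁻¹, ?_⟩
    have : ∀ᶠ i in U, f i ≠ 0 := by
      rw [Ultrafilter.eventually_not, ← mk_eq_zero]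
      exact ha
    rw [← map_mul, ← map_one (mk U), mk_eq_mk]
    filter_upwards [this] with i hi
    exact mul_inv_cancel₀ hi

noncomputable instance : Field (UltraProd U k) := Ideal.Quotient.field _

end Field

section Polynomial

/-- The natural map from polynomials over an ultraproduct to an ultraproduct of polynomials. -/
noncomputable def ofPolynomial (U : Ultrafilter ℕ) (B : ℕ → Type u) [∀ i, CommRing (B i)] :
    (UltraProd U B)[X] →+* UltraProd U fun i => (B i)[X] :=
  eval₂RingHom (map U fun _ => C) (mk U fun _ => X)

lemma ofPolynomial_sum (n : ℕ) (b : ℕ → ∀ i, B i) :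
    ofPolynomial U B (∑ k ∈ Finset.range n, C (mk U (b k)) * X ^ k) =
      mk U fun i => ∑ k ∈ Finset.range n, C (b k i) * X ^ k := by
  rw [map_sum]
  have : (fun i => ∑ k ∈ Finset.range n, C (b k i) * X ^ k : ∀ i, (B i)[X]) =
      ∑ k ∈ Finset.range n, (fun i => C (b k i)) * (fun _ => X) ^ k := by
    ext1 i
    rw [Finset.sum_apply]
    rfl
  rw [this, map_sum]
  refine Finset.sum_congr rfl fun k _ => ?_
  rw [ofPolynomial, coe_eval₂RingHom, eval₂_mul, eval₂_C, eval₂_pow, eval₂_X, map_mul, map_pow]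
  rfl

lemma exists_eq_sum (p : (UltraProd U B)[X]) (n : ℕ) (hn : p.natDegree < n) :
    ∃ b : ℕ → ∀ i, B i, (∀ k, p.coeff k = mk U (b k)) ∧
      p = ∑ k ∈ Finset.range n, C (mk U (b k)) * X ^ k := by
  choose b hb using fun k => mk_surjective (p.coeff k)
  refine ⟨b, fun k => (hb k).symm, ?_⟩
  simp only [hb]
  exact p.as_sum_range_C_mul_X_pow' hn

lemma ofPolynomial_injective : Function.Injective (ofPolynomial U B) := by
  rw [injective_iff_map_eq_zero]
  intro p hp
  obtain ⟨b, hb, hp'⟩ := exists_eq_sum p _ (Nat.lt_succ_self _)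
  rw [hp', ofPolynomial_sum, mk_eq_zero] at hp
  rw [hp']
  refine Finset.sum_eq_zero fun k hk => ?_
  suffices mk U (b k) = 0 by rw [this, C_0, zero_mul]
  rw [mk_eq_zero]
  filter_upwards [hp] with i hi
  have := congrArg (fun q => q.coeff k) hi
  simpa [finsetSum_coeff, coeff_C_mul, coeff_X_pow, Finset.mem_range.1 hk] using this

lemma mk_mem_range_ofPolynomial {c : ∀ i, (B i)[X]} {n : ℕ}
    (h : ∀ᶠ i in U, (c i).natDegree < n) : mk U c ∈ (ofPolynomial U B).range := by
  refine ⟨∑ k ∈ Finset.range n, C (mk U fun i => (c i).coeff k) * X ^ k, ?_⟩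
  rw [ofPolynomial_sum, mk_eq_mk]
  filter_upwards [h] with i hi
  exact ((c i).as_sum_range_C_mul_X_pow' hi).symm

lemma exists_natDegree_lt {c : ∀ i, (B i)[X]} (h : mk U c ∈ (ofPolynomial U B).range) :
    ∃ n, ∀ᶠ i in U, (c i).natDegree < n := by
  obtain ⟨p, hp⟩ := h
  obtain ⟨b, hb, hp'⟩ := exists_eq_sum p _ (Nat.lt_succ_self _)
  rw [hp', ofPolynomial_sum, mk_eq_mk] at hp
  refine ⟨p.natDegree + 1, ?_⟩
  filter_upwards [hp] with i hi
  rw [← hi, Nat.lt_succ_iff]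
  refine natDegree_sum_le_of_forall_le _ _ fun k hk => (natDegree_C_mul_X_pow_le _ _).trans ?_
  exact Nat.lt_succ_iff.1 (Finset.mem_range.1 hk)

lemma exists_monic {p : (UltraProd U B)[X]} (hp : p.Monic) :
    ∃ q : ∀ i, (B i)[X], (∀ i, (q i).Monic) ∧ (∀ i, (q i).natDegree ≤ p.natDegree) ∧
      ofPolynomial U B p = mk U q := by
  choose b hb using fun k => mk_surjective (p.coeff k)
  set n := p.natDegree
  have hdeg : ∀ i, (∑ k ∈ Finset.range n, C (b k i) * X ^ k : (B i)[X]).degree < n := by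
    intro i
    rw [degree_lt_iff_coeff_zero]
    intro m hm
    rw [finsetSum_coeff]
    refine Finset.sum_eq_zero fun k hk => ?_
    rw [coeff_C_mul_X_pow, if_neg]
    have := Finset.mem_range.1 hk
    omega
  refine ⟨fun i => X ^ n + ∑ k ∈ Finset.range n, C (b k i) * X ^ k,
    fun i => monic_X_pow_add (hdeg i), fun i => ?_, ?_⟩
  · refine natDegree_add_le_of_degree_le (natDegree_X_pow_le n) ?_
    exact natDegree_le_of_degree_le (hdeg i).le
  · conv_lhs => rw [hp.as_sum]
    have : (fun i => X ^ n + ∑ k ∈ Finset.range n, C (b k i) * X ^ k : ∀ i, (B i)[X]) =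
      (fun _ => X) ^ n + (fun i => ∑ k ∈ Finset.range n, C (b k i) * X ^ k) := rfl
    rw [this, map_add, map_add, map_pow, ← ofPolynomial_sum]
    simp only [hb]
    rw [map_pow]
    congr 2
    simp [ofPolynomial]

lemma exists_eq_mul_add {p : (UltraProd U B)[X]} (hp : p.Monic) (c : UltraProd U fun i => (B i)[X]) :
    ∃ q r, c = ofPolynomial U B p * q + ofPolynomial U B r := by
  obtain ⟨P, hP, hdeg, hpP⟩ := exists_monic hp
  obtain ⟨c, rfl⟩ := mk_surjective c
  obtain ⟨r, hr⟩ := mk_mem_range_ofPolynomial (U := U) (c := fun i => c i %ₘ P i)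
    (n := p.natDegree + 1) (Eventually.of_forall fun i =>
      Nat.lt_succ_iff.2 ((natDegree_modByMonic_le _ (hP i)).trans (hdeg i)))
  refine ⟨mk U fun i => c i /ₘ P i, r, ?_⟩
  rw [hpP, hr, ← map_mul, ← map_add, mk_eq_mk]
  refine Eventually.of_forall fun i => ?_
  rw [Pi.add_apply, Pi.mul_apply, add_comm, modByMonic_add_div]

lemma mem_range_of_monic_mul {p : (UltraProd U B)[X]} (hp : p.Monic)
    {c : UltraProd U fun i => (B i)[X]} (h : ofPolynomial U B p * c ∈ (ofPolynomial U B).range) :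
    c ∈ (ofPolynomial U B).range := by
  obtain ⟨P, hP, hdeg, hpP⟩ := exists_monic hp
  obtain ⟨c, rfl⟩ := mk_surjective c
  rw [hpP, ← map_mul] at h
  obtain ⟨n, hn⟩ := exists_natDegree_lt h
  refine mk_mem_range_ofPolynomial (n := n) ?_
  filter_upwards [hn] with i hi
  by_cases h0 : c i = 0
  · rw [h0, natDegree_zero]
    omega
  rw [Pi.mul_apply, (hP i).natDegree_mul' h0] at hi
  omega

end Polynomial

end UltraProd

end

section

open Filter Polynomial

section Flat

variable {R C : Type*} [CommRing R] [CommRing C] {φ : R →+* C}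

lemma RingHom.Flat.mem_span (h : φ.Flat) {ι : Type*} [Fintype ι] {f : ι → R} {x : ι → C}
    (hx : ∑ i, φ (f i) * x i = 0) :
    x ∈ Submodule.span C ((fun a i => φ (a i)) '' {a : ι → R | ∑ i, f i * a i = 0}) := by
  algebraize [φ]
  obtain ⟨k, a, y, hy, ha⟩ := Module.Flat.isTrivialRelation_of_sum_smul_eq_zero (R := R) (M := C)
    (f := f) (x := x) hx
  have : x = ∑ j, y j • (fun i => φ (a i j)) := by
    ext i
    rw [hy, Finset.sum_apply]
    exact Finset.sum_congr rfl fun j _ => mul_comm _ _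
  rw [this]
  exact Submodule.sum_mem _ fun j _ => Submodule.smul_mem _ _
    (Submodule.subset_span ⟨fun i => a i j, ha j, rfl⟩)

lemma RingHom.flat_of_mem_span
    (h : ∀ (l : ℕ) (f : Fin l → R) (x : Fin l → C), ∑ i, φ (f i) * x i = 0 →
      x ∈ Submodule.span C ((fun a i => φ (a i)) '' {a : Fin l → R | ∑ i, f i * a i = 0})) :
    φ.Flat := by
  algebraize [φ]
  refine Module.Flat.of_forall_isTrivialRelation fun {l f x} hx => ?_
  obtain ⟨k, y, g, hg⟩ := Submodule.mem_span_set'.1 (h l f x hx)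
  choose a ha hag using fun j => (g j).2
  refine ⟨k, fun i j => a j i, y, fun i => ?_, ha⟩
  rw [← hg, Finset.sum_apply]
  refine Finset.sum_congr rfl fun j _ => ?_
  rw [Pi.smul_apply, ← hag, smul_eq_mul, mul_comm]
  rfl

lemma RingHom.Flat.mapRingHom {R C : Type u} [CommRing R] [CommRing C] {φ : R →+* C}
    (h : φ.Flat) : (Polynomial.mapRingHom φ).Flat := by
  algebraize [φ]
  let _ : Algebra R[X] C[X] := Polynomial.algebra R C
  have h1 : Algebra.IsPushout R R[X] C C[X] := inferInstance
  have h2 : Module.Flat R[X] C[X] := Module.Flat.isBaseChange R R[X] C C[X] h1.out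
  exact h2

end Flat

namespace UltraProd

variable {U : Ultrafilter ℕ} {B : ℕ → Type u} [∀ i, CommRing (B i)]

lemma mem_span_of_monic {R : Type u} [CommRing R] {φ : R →+* UltraProd U B} (hφ : φ.Flat)
    {ι : Type*} [Fintype ι] [DecidableEq ι] {f : ι → R[X]} {j : ι} (hj : (f j).Monic)
    {x : ι → UltraProd U fun i => (B i)[X]}
    (hx : ∑ i, (ofPolynomial U B).comp (mapRingHom φ) (f i) * x i = 0) :
    x ∈ Submodule.span (UltraProd U fun i => (B i)[X])
      ((fun a i => (ofPolynomial U B).comp (mapRingHom φ) (a i)) ''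
        {a : ι → R[X] | ∑ i, f i * a i = 0}) := by
  set Ψ := (ofPolynomial U B).comp (mapRingHom φ) with hΨ
  set T := Submodule.span (UltraProd U fun i => (B i)[X])
    ((fun a i => Ψ (a i)) '' {a : ι → R[X] | ∑ i, f i * a i = 0})
  choose q r hqr using fun i => exists_eq_mul_add (hj.map φ) (x i)
  have hkos : ∀ i, i ≠ j → (Pi.single i (Ψ (f j)) - Pi.single j (Ψ (f i))) ∈ T := by
    intro i hi
    refine Submodule.subset_span ⟨Pi.single i (f j) - Pi.single j (f i), ?_, ?_⟩
    · simp only [Set.mem_ofPred_eq, Pi.sub_apply, mul_sub, Finset.sum_sub_distrib]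
      simp [Pi.single_apply, mul_comm]
    · ext k
      simp only [Pi.sub_apply, map_sub, Pi.single_apply, apply_ite Ψ, map_zero]
  set z : ι → UltraProd U fun i => (B i)[X] :=
    ∑ i ∈ Finset.univ.erase j, q i • (Pi.single i (Ψ (f j)) - Pi.single j (Ψ (f i))) with hz
  have hzT : z ∈ T := Submodule.sum_mem _ fun i hi =>
    Submodule.smul_mem _ _ (hkos i (Finset.ne_of_mem_erase hi))
  have hz0 : ∑ i, Ψ (f i) * z i = 0 := by
    have hlin : ∀ i, ∑ k, Ψ (f k) * (Pi.single i (Ψ (f j)) - Pi.single j (Ψ (f i)) :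
        ι → UltraProd U fun i => (B i)[X]) k = 0 := by
      intro i
      simp only [Pi.sub_apply, mul_sub, Finset.sum_sub_distrib]
      simp [Pi.single_apply, mul_comm]
    simp only [hz, Finset.sum_apply, Pi.smul_apply, smul_eq_mul, Finset.mul_sum]
    rw [Finset.sum_comm]
    refine Finset.sum_eq_zero fun i _ => ?_
    rw [← mul_zero (q i), ← hlin i, Finset.mul_sum]
    exact Finset.sum_congr rfl fun k _ => mul_left_comm _ _ _
  have hw0 : ∑ i, Ψ (f i) * (x - z) i = 0 := by
    simp only [Pi.sub_apply, mul_sub, Finset.sum_sub_distrib, hx, hz0, sub_zero]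
  have hwi : ∀ i, i ≠ j → (x - z) i = ofPolynomial U B (r i) := by
    intro i hi
    have : z i = Ψ (f j) * q i := by
      rw [hz, Finset.sum_apply, Finset.sum_eq_single i]
      · simp [hi, mul_comm]
      · intro k _ hk
        simp [hk.symm, hi]
      · intro h
        exact absurd (Finset.mem_erase.2 ⟨hi, Finset.mem_univ i⟩) h
    rw [Pi.sub_apply, this, hqr i]
    exact add_sub_cancel_left _ _
  have hwj : (x - z) j ∈ (ofPolynomial U B).range := by
    refine mem_range_of_monic_mul (hj.map φ) ?_
    have : ofPolynomial U B ((f j).map φ) * (x - z) j =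
        -∑ i ∈ Finset.univ.erase j, Ψ (f i) * (x - z) i := by
      rw [eq_neg_iff_add_eq_zero, add_comm, ← hw0]
      exact Finset.sum_erase_add _ _ (Finset.mem_univ j)
    rw [this]
    refine neg_mem (sum_mem fun i hi => ?_)
    rw [hwi i (Finset.ne_of_mem_erase hi)]
    exact mul_mem ⟨(f i).map φ, rfl⟩ ⟨r i, rfl⟩
  have hw : ∀ i, ∃ w, ofPolynomial U B w = (x - z) i := by
    intro i
    by_cases hi : i = j
    · exact hi ▸ hwj
    · exact ⟨r i, (hwi i hi).symm⟩
  choose w hw using hw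
  have hrel : ∑ i, mapRingHom φ (f i) * w i = 0 := by
    apply ofPolynomial_injective
    rw [map_sum, map_zero, ← hw0]
    refine Finset.sum_congr rfl fun i _ => ?_
    rw [map_mul, hw]
    rfl
  have hmem := hφ.mapRingHom.mem_span hrel
  have hxz : x - z ∈ T := by
    have : x - z = fun i => ofPolynomial U B (w i) := funext fun i => (hw i).symm
    rw [this]
    clear_value z
    clear this hw hrel hwj hwi hw0 hz0 hzT hz hkos hqr
    induction hmem using Submodule.span_induction with
    | mem v hv =>
      obtain ⟨a, ha, rfl⟩ := hv
      exact Submodule.subset_span ⟨a, ha, rfl⟩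
    | zero =>
      convert T.zero_mem
      simp
    | add v v' _ _ h h' => simpa using! T.add_mem h h'
    | smul c v _ h => simpa using! T.smul_mem (ofPolynomial U B c) h
  simpa using T.add_mem hxz hzT

end UltraProd

end

section

open Filter Polynomial

namespace MvPolynomial

variable {k : Type u} [Field k] {r : ℕ}

/-- The change of coordinates `X (i+1) ↦ X (i+1) + a i * X 0`. -/
noncomputable def shear {k : Type u} [CommRing k] {r : ℕ} (a : Fin r → k) :
    MvPolynomial (Fin (r + 1)) k →ₐ[k] MvPolynomial (Fin (r + 1)) k :=
  aeval (Fin.cons (X 0) fun i => X i.succ + C (a i) * X 0)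

lemma shear_neg_shear {k : Type u} [CommRing k] {r : ℕ} (a : Fin r → k)
    (p : MvPolynomial (Fin (r + 1)) k) : shear (-a) (shear a p) = p := by
  have : (shear (-a)).comp (shear a) = AlgHom.id k _ := by
    refine algHom_ext fun j => ?_
    refine Fin.cases ?_ (fun i => ?_) j <;> simp [shear, algHom_C]
  exact DFunLike.congr_fun this p

lemma natDegree_prod_pow_le_and_coeff {R : Type*} [CommRing R] {ι : Type*} (L : ι → R[X]) (b : ι → R)
    (hL : ∀ j, (L j).natDegree ≤ 1) (hb : ∀ j, (L j).coeff 1 = b j) (v : ι → ℕ) (s : Finset ι) :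
    (∏ j ∈ s, L j ^ v j).natDegree ≤ ∑ j ∈ s, v j ∧
      (∏ j ∈ s, L j ^ v j).coeff (∑ j ∈ s, v j) = ∏ j ∈ s, b j ^ v j := by
  classical
  induction s using Finset.induction_on with
  | empty => simp
  | insert j s hj ih =>
    have h1 : (L j ^ v j).natDegree ≤ v j := by
      simpa using natDegree_pow_le_of_le (v j) (hL j)
    rw [Finset.prod_insert hj, Finset.sum_insert hj, Finset.prod_insert hj]
    refine ⟨natDegree_mul_le_of_le h1 ih.1, ?_⟩
    rw [coeff_mul_add_eq_of_natDegree_le h1 ih.1, ih.2]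
    congr 1
    have := coeff_pow_of_natDegree_le (m := v j) (hL j)
    rwa [mul_one, hb] at this

lemma coeff_finSuccEquiv_shear (a : Fin r → k) (f : MvPolynomial (Fin (r + 1)) k) :
    (finSuccEquiv k r (shear a f)).natDegree ≤ f.totalDegree ∧
      (finSuccEquiv k r (shear a f)).coeff f.totalDegree =
        C (eval (Fin.cons 1 a) (homogeneousComponent f.totalDegree f)) := by
  set b : Fin (r + 1) → k := Fin.cons 1 a
  set L : Fin (r + 1) → (MvPolynomial (Fin r) k)[X] := fun j => finSuccEquiv k r (shear a (X j))
  have hL : ∀ j, (L j).natDegree ≤ 1 ∧ (L j).coeff 1 = C (b j) := by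
    intro j
    refine Fin.cases ?_ (fun i => ?_) j
    · simp [L, b, shear, finSuccEquiv_X_zero]
    · have : L i.succ = Polynomial.C (X i) + Polynomial.C (C (a i)) * Polynomial.X := by
        simp [L, shear, finSuccEquiv_apply]
      rw [this]
      refine ⟨natDegree_add_le_of_degree_le (by simp) ((natDegree_C_mul_le _ _).trans natDegree_X_le), ?_⟩
      simp [b, Polynomial.coeff_C]
  have hmon : ∀ v : Fin (r + 1) →₀ ℕ, ∀ c : k,
      finSuccEquiv k r (shear a (monomial v c)) = Polynomial.C (C c) * ∏ j, L j ^ v j := by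
    intro v c
    rw [monomial_eq, Finsupp.prod_fintype _ _ fun _ => pow_zero _]
    simp only [map_mul, map_prod, map_pow, algHom_C, L]
    simp [finSuccEquiv_apply, algebraMap_eq]
  have hv : ∀ v : Fin (r + 1) →₀ ℕ, v.degree = ∑ j, v j := fun v =>
    Finsupp.degree_eq_sum v
  have hterm : ∀ v : Fin (r + 1) →₀ ℕ, ∀ c : k,
      (finSuccEquiv k r (shear a (monomial v c))).natDegree ≤ v.degree ∧
      (finSuccEquiv k r (shear a (monomial v c))).coeff v.degree = C (c * ∏ j, b j ^ v j) := by
    intro v c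
    have := natDegree_prod_pow_le_and_coeff L (fun j => C (b j)) (fun j => (hL j).1)
      (fun j => (hL j).2) v Finset.univ
    rw [hmon, hv]
    refine ⟨(natDegree_C_mul_le _ _).trans this.1, ?_⟩
    rw [Polynomial.coeff_C_mul, this.2]
    simp
  have hdeg : ∀ v ∈ f.support, v.degree ≤ f.totalDegree := fun v hv => le_totalDegree hv
  have hsum : finSuccEquiv k r (shear a f) =
      ∑ v ∈ f.support, finSuccEquiv k r (shear a (monomial v (f.coeff v))) := by
    conv_lhs => rw [f.as_sum]
    simp only [map_sum]
  rw [hsum]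
  constructor
  · exact natDegree_sum_le_of_forall_le _ _ fun v hv => (hterm v _).1.trans (hdeg v hv)
  · rw [finsetSum_coeff, homogeneousComponent_apply, map_sum, map_sum, Finset.sum_filter]
    refine Finset.sum_congr rfl fun v hvs => ?_
    split_ifs with h
    · rw [← h, (hterm v _).2, eval_monomial, Finsupp.prod_fintype _ _ fun _ => pow_zero _]
    · exact coeff_eq_zero_of_natDegree_lt
        ((hterm v _).1.trans_lt (lt_of_le_of_ne (hdeg v hvs) h))

lemma exists_eval_cons_ne_zero [Infinite k] {p : MvPolynomial (Fin (r + 1)) k} {D : ℕ}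
    (hp : p.IsHomogeneous D) (h0 : p ≠ 0) : ∃ a : Fin r → k, eval (Fin.cons 1 a) p ≠ 0 := by
  obtain ⟨b, hb⟩ : ∃ b, eval b (p * X 0) ≠ 0 := by
    by_contra! h
    exact mul_ne_zero h0 (X_ne_zero 0) (MvPolynomial.funext fun b => by rw [h b, map_zero])
  rw [map_mul, eval_X, mul_ne_zero_iff] at hb
  refine ⟨fun i => (b 0)⁻¹ * b i.succ, fun h => hb.1 ?_⟩
  have hb' : b = fun j => b 0 * (Fin.cons 1 (fun i => (b 0)⁻¹ * b i.succ) : Fin (r + 1) → k) j := by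
    funext j
    refine Fin.cases (by simp) (fun i => ?_) j
    simp [hb.2]
  rw [hb', eval_eq]
  rw [eval_eq] at h
  have : ∀ v ∈ p.support, ∏ i ∈ v.support,
      (b 0 * (Fin.cons 1 (fun i => (b 0)⁻¹ * b i.succ) : Fin (r + 1) → k) i) ^ v i =
      b 0 ^ D * ∏ i ∈ v.support,
        ((Fin.cons 1 (fun i => (b 0)⁻¹ * b i.succ) : Fin (r + 1) → k) i) ^ v i := by
    intro v hv
    simp only [mul_pow, Finset.prod_mul_distrib]
    rw [Finset.prod_pow_eq_pow_sum, hp.degree_eq_sum_deg_support hv]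
  rw [Finset.sum_congr rfl fun v hv => by rw [this v hv, mul_left_comm], ← Finset.mul_sum, h,
    mul_zero]

lemma exists_monic_shear [Infinite k] {f : MvPolynomial (Fin (r + 1)) k} (hf : f ≠ 0) :
    ∃ (a : Fin r → k) (c : k), c ≠ 0 ∧ (finSuccEquiv k r (shear a (C c * f))).Monic := by
  have htop : homogeneousComponent f.totalDegree f ≠ 0 := by
    intro h
    obtain ⟨v, hv, hd⟩ := Finset.exists_mem_eq_sup _ (support_nonempty.2 hf) fun v =>
      (v.sum fun _ e => e)
    have := congrArg (coeff v) h
    rw [coeff_homogeneousComponent, if_pos (show v.degree = f.totalDegree from hd.symm), coeff_zero] at this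
    exact mem_support_iff.1 hv this
  obtain ⟨a, ha⟩ := exists_eval_cons_ne_zero (homogeneousComponent_isHomogeneous _ f) htop
  refine ⟨a, _, inv_ne_zero ha, ?_⟩
  obtain ⟨h1, h2⟩ := coeff_finSuccEquiv_shear a f
  have hC : finSuccEquiv k r (shear a (C (eval (Fin.cons 1 a) (homogeneousComponent
      f.totalDegree f))⁻¹ * f)) = Polynomial.C (C (eval (Fin.cons 1 a) (homogeneousComponent
      f.totalDegree f))⁻¹) * finSuccEquiv k r (shear a f) := by
    rw [map_mul, map_mul, algHom_C]
    simp [finSuccEquiv_apply, algebraMap_eq]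
  rw [hC]
  refine monic_of_natDegree_le_of_coeff_eq_one f.totalDegree ((natDegree_C_mul_le _ _).trans h1) ?_
  rw [Polynomial.coeff_C_mul, h2, ← C_mul, inv_mul_cancel₀ ha, C_1]

end MvPolynomial

end

section

open Filter

namespace UltraProd

variable {U : Ultrafilter ℕ} {k : ℕ → Type u} [∀ i, Field (k i)]

instance [∀ i, Infinite (k i)] : Infinite (UltraProd U k) := by
  refine Infinite.of_injective (fun n => mk U fun i => Infinite.natEmbedding (k i) n) ?_
  intro m n h
  obtain ⟨i, hi⟩ := (mk_eq_mk.1 h).exists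
  exact (Infinite.natEmbedding (k i)).injective hi

/-- The natural map from polynomials over an ultraproduct of fields to the ultraproduct of the
polynomial rings. -/
noncomputable def ofMvPolynomial (U : Ultrafilter ℕ) (k : ℕ → Type u) [∀ i, Field (k i)]
    (σ : Type) : MvPolynomial σ (UltraProd U k) →+* UltraProd U fun i => MvPolynomial σ (k i) :=
  MvPolynomial.eval₂Hom (map U fun _ => MvPolynomial.C) fun j => mk U fun _ => MvPolynomial.X j

lemma ofMvPolynomial_C (σ : Type) (c : ∀ i, k i) : ofMvPolynomial U k σ (MvPolynomial.C (mk U c)) =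
    mk U fun i => MvPolynomial.C (c i) := by
  rw [ofMvPolynomial, MvPolynomial.eval₂Hom_C, map_mk]

lemma ofMvPolynomial_X (σ : Type) (j : σ) :
    ofMvPolynomial U k σ (MvPolynomial.X j) = mk U fun _ => MvPolynomial.X j := by
  rw [ofMvPolynomial, MvPolynomial.eval₂Hom_X']

lemma map_shear_ofMvPolynomial {r : ℕ} (a : Fin r → ∀ i, k i)
    (p : MvPolynomial (Fin (r + 1)) (UltraProd U k)) :
    map U (fun i => (MvPolynomial.shear fun j => a j i).toRingHom) (ofMvPolynomial U k _ p) =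
      ofMvPolynomial U k _ (MvPolynomial.shear (fun j => mk U (a j)) p) := by
  change ((map U _).comp (ofMvPolynomial U k _)) p =
    ((ofMvPolynomial U k _).comp (MvPolynomial.shear fun j => mk U (a j)).toRingHom) p
  congr 1
  refine MvPolynomial.ringHom_ext (fun c => ?_) fun j => ?_
  · obtain ⟨c, rfl⟩ := mk_surjective c
    simp only [RingHom.comp_apply, AlgHom.toRingHom_eq_coe, RingHom.coe_coe,
      MvPolynomial.algHom_C, MvPolynomial.algebraMap_eq, ofMvPolynomial_C, map_mk]
  · simp only [RingHom.comp_apply, AlgHom.toRingHom_eq_coe, RingHom.coe_coe, ofMvPolynomial_X,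
      map_mk, MvPolynomial.shear, MvPolynomial.aeval_X]
    refine Fin.cases ?_ (fun i => ?_) j
    · simp [ofMvPolynomial_X]
    · simp only [Fin.cons_succ, map_add, map_mul, ofMvPolynomial_X, ofMvPolynomial_C]
      rfl

lemma map_finSuccEquiv_ofMvPolynomial {r : ℕ} (p : MvPolynomial (Fin (r + 1)) (UltraProd U k)) :
    map U (fun i => (MvPolynomial.finSuccEquiv (k i) r).toRingEquiv.toRingHom)
        (ofMvPolynomial U k _ p) =
      (ofPolynomial U fun i => MvPolynomial (Fin r) (k i)).comp
        (Polynomial.mapRingHom (ofMvPolynomial U k _)) (MvPolynomial.finSuccEquiv _ r p) := by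
  change ((map U _).comp (ofMvPolynomial U k _)) p =
    (((ofPolynomial U fun i => MvPolynomial (Fin r) (k i)).comp
        (Polynomial.mapRingHom (ofMvPolynomial U k _))).comp
          (MvPolynomial.finSuccEquiv (UltraProd U k) r).toRingEquiv.toRingHom) p
  congr 1
  refine MvPolynomial.ringHom_ext (fun c => ?_) fun j => ?_
  · obtain ⟨c, rfl⟩ := mk_surjective c
    simp [ofMvPolynomial_C, ofPolynomial, MvPolynomial.finSuccEquiv_apply]
  · refine Fin.cases ?_ (fun i => ?_) j
    · simp [ofMvPolynomial_X, ofPolynomial, MvPolynomial.finSuccEquiv_X_zero]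
    · simp [ofMvPolynomial_X, ofPolynomial, MvPolynomial.finSuccEquiv_X_succ]

/-- A linear image of the span of the image of a syzygy module. -/
lemma mem_span_of_ringEquiv {R R' C C' : Type*} [CommRing R] [CommRing R'] [CommRing C]
    [CommRing C'] {φ : R →+* C} {φ' : R' →+* C'} (σ : R →+* R') (σ' : R' →+* R) (τ : C →+* C')
    (τ' : C' →+* C) (hσ : ∀ x, σ' (σ x) = x) (hτ : ∀ x, τ' (τ x) = x)
    (hτσ' : ∀ x, τ' (φ' x) = φ (σ' x))
    {ι : Type*} [Fintype ι] {f : ι → R} {x : ι → C} {c : R} (hc : ∀ y, c * y = 0 → y = 0)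
    (hx : (fun i => τ (x i)) ∈ Submodule.span C'
      ((fun a i => φ' (a i)) '' {a : ι → R' | ∑ i, σ (c * f i) * a i = 0})) :
    x ∈ Submodule.span C ((fun a i => φ (a i)) '' {a : ι → R | ∑ i, f i * a i = 0}) := by
  have key : ∀ z ∈ Submodule.span C'
      ((fun a i => φ' (a i)) '' {a : ι → R' | ∑ i, σ (c * f i) * a i = 0}),
      (fun i => τ' (z i)) ∈ Submodule.span C
        ((fun a i => φ (a i)) '' {a : ι → R | ∑ i, f i * a i = 0}) := by
    intro z hz
    induction hz using Submodule.span_induction with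
    | mem v hv =>
      obtain ⟨a, ha, rfl⟩ := hv
      refine Submodule.subset_span ⟨fun i => σ' (a i), hc _ ?_, ?_⟩
      · have := congrArg σ' (show ∑ i, σ (c * f i) * a i = 0 from ha)
        simp only [map_sum, map_mul, hσ, map_zero] at this
        rw [← this, Finset.mul_sum]
        simp only [mul_assoc]
      · simp only [hτσ']
    | zero =>
      convert Submodule.zero_mem _
      simp
    | add v v' _ _ h h' => simpa using! Submodule.add_mem _ h h'
    | smul c v _ h => simpa using! Submodule.smul_mem _ (τ' c) h
  simpa only [hτ] using key _ hx

/-- Polynomial rings over an ultraproduct of infinite fields sit flatly in the ultraproduct of the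
polynomial rings. -/
theorem flat_ofMvPolynomial [∀ i, Infinite (k i)] (r : ℕ) :
    (ofMvPolynomial U k (Fin r)).Flat := by
  induction r with
  | zero =>
    apply RingHom.Flat.of_bijective
    have h1 : Function.Bijective (map U fun i => (MvPolynomial.C : k i →+* MvPolynomial (Fin 0) (k i))) :=
      map_bijective fun i => (MvPolynomial.isEmptyRingEquiv (k i) (Fin 0)).symm.bijective
    have h2 : Function.Bijective
        (MvPolynomial.C : UltraProd U k →+* MvPolynomial (Fin 0) (UltraProd U k)) :=
      (MvPolynomial.isEmptyRingEquiv (UltraProd U k) (Fin 0)).symm.bijective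
    rw [← Function.Bijective.of_comp_iff _ h2]
    convert h1
    ext c
    obtain ⟨c, rfl⟩ := mk_surjective c
    rw [Function.comp_apply, ofMvPolynomial_C, map_mk]
  | succ r ih =>
    refine RingHom.flat_of_mem_span fun l f x hx => ?_
    classical
    by_cases hf : ∀ j, f j = 0
    · have : x = ∑ j, x j • (fun i => ofMvPolynomial U k (Fin (r + 1))
          ((Pi.single j 1 : Fin l → MvPolynomial (Fin (r + 1)) (UltraProd U k)) i)) := by
        ext i
        simp [Finset.sum_apply, Pi.single_apply, apply_ite]
      rw [this]
      refine Submodule.sum_mem _ fun j _ => Submodule.smul_mem _ _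
        (Submodule.subset_span ⟨Pi.single j 1, ?_, rfl⟩)
      simp [hf]
    push Not at hf
    obtain ⟨j, hj⟩ := hf
    obtain ⟨a, c, hc, hmonic⟩ := MvPolynomial.exists_monic_shear hj
    choose a' ha' using fun j => mk_surjective (U := U) (a j)
    obtain rfl : a = fun j => mk U (a' j) := funext fun j => (ha' j).symm
    let σ : MvPolynomial (Fin (r + 1)) (UltraProd U k) →+*
        Polynomial (MvPolynomial (Fin r) (UltraProd U k)) := (MvPolynomial.finSuccEquiv (UltraProd U k) r).toRingEquiv.toRingHom.comp
      (MvPolynomial.shear fun j => mk U (a' j)).toRingHom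
    let σ' : Polynomial (MvPolynomial (Fin r) (UltraProd U k)) →+*
        MvPolynomial (Fin (r + 1)) (UltraProd U k) := (MvPolynomial.shear (-fun j => mk U (a' j))).toRingHom.comp
      (MvPolynomial.finSuccEquiv (UltraProd U k) r).symm.toRingEquiv.toRingHom
    let τ := (map U fun i => (MvPolynomial.finSuccEquiv (k i) r).toRingEquiv.toRingHom).comp
      (map U fun i => (MvPolynomial.shear fun j => a' j i).toRingHom)
    let τ' := (map U fun i => (MvPolynomial.shear fun j => (-a' j) i).toRingHom).comp
      (map U fun i => (MvPolynomial.finSuccEquiv (k i) r).symm.toRingEquiv.toRingHom)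
    have hτσ : ∀ x, τ (ofMvPolynomial U k _ x) =
        (ofPolynomial U fun i => MvPolynomial (Fin r) (k i)).comp
          (Polynomial.mapRingHom (ofMvPolynomial U k _)) (σ x) := by
      intro x
      simp only [τ, σ, RingHom.comp_apply]
      rw [map_shear_ofMvPolynomial, map_finSuccEquiv_ofMvPolynomial]
      rfl
    have hσ : ∀ x, σ' (σ x) = x := by
      intro x
      change MvPolynomial.shear _ ((MvPolynomial.finSuccEquiv (UltraProd U k) r).symm
        (MvPolynomial.finSuccEquiv (UltraProd U k) r _)) = x
      rw [AlgEquiv.symm_apply_apply]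
      exact MvPolynomial.shear_neg_shear _ _
    have hσσ : ∀ x, σ (σ' x) = x := by
      intro x
      have := MvPolynomial.shear_neg_shear (-fun j => mk U (a' j))
        ((MvPolynomial.finSuccEquiv (UltraProd U k) r).symm x)
      rw [neg_neg] at this
      change MvPolynomial.finSuccEquiv (UltraProd U k) r (MvPolynomial.shear _
        (MvPolynomial.shear _ ((MvPolynomial.finSuccEquiv (UltraProd U k) r).symm x))) = x
      rw [this, AlgEquiv.apply_symm_apply]
    have hτ : ∀ x, τ' (τ x) = x := by
      intro x
      obtain ⟨x, rfl⟩ := mk_surjective x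
      simp only [τ, τ', RingHom.comp_apply, map_mk]
      congr 1
      funext i
      change MvPolynomial.shear _ ((MvPolynomial.finSuccEquiv (k i) r).symm
        (MvPolynomial.finSuccEquiv (k i) r _)) = x i
      rw [AlgEquiv.symm_apply_apply]
      exact MvPolynomial.shear_neg_shear (fun j => a' j i) (x i)
    refine mem_span_of_ringEquiv (R := MvPolynomial (Fin (r + 1)) (UltraProd U k))
      (R' := Polynomial (MvPolynomial (Fin r) (UltraProd U k)))
      (C := UltraProd U fun i => MvPolynomial (Fin (r + 1)) (k i))
      (C' := UltraProd U fun i => Polynomial (MvPolynomial (Fin r) (k i)))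
      (φ := ofMvPolynomial U k (Fin (r + 1))) σ σ' τ τ' hσ hτ (φ' := (ofPolynomial U fun i =>
      MvPolynomial (Fin r) (k i)).comp (Polynomial.mapRingHom (ofMvPolynomial U k _)))
      (fun x => ?_) (c := MvPolynomial.C c) (fun y hy => ?_) ?_
    · conv_lhs => rw [← hσσ x, ← hτσ, hτ]
    · exact (mul_eq_zero.1 hy).resolve_left
        fun h => hc (MvPolynomial.C_eq_zero.1 h)
    · refine mem_span_of_monic ih (j := j) hmonic ?_
      have h1 : ∀ i, (ofPolynomial U fun i => MvPolynomial (Fin r) (k i)).comp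
          (Polynomial.mapRingHom (ofMvPolynomial U k (Fin r))) (σ (MvPolynomial.C c * f i)) *
            τ (x i) = τ (ofMvPolynomial U k _ (MvPolynomial.C c)) *
              τ (ofMvPolynomial U k _ (f i) * x i) := by
        intro i
        rw [← hτσ, map_mul, map_mul, map_mul, mul_assoc]
      rw [Finset.sum_congr rfl fun i _ => h1 i, ← Finset.mul_sum, ← map_sum, hx, map_zero]
      exact mul_zero _

end UltraProd

end

section

open MvPolynomial

namespace MvPolynomial

variable {K : Type u} [Field K] {σ : Type} {A : Type u} [CommRing A] [Algebra K A]
  {Λ : Type} [Fintype Λ]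

/-- The combination of the family `b` with coefficients `p` evaluated at `θ`. -/
noncomputable def comb (θ : σ → A) (b : Λ → A) (p : Λ → MvPolynomial σ K) : A :=
  ∑ l, aeval θ (p l) * b l

lemma comb_add (θ : σ → A) (b : Λ → A) (p q : Λ → MvPolynomial σ K) :
    comb θ b (p + q) = comb θ b p + comb θ b q := by
  simp [comb, add_mul, Finset.sum_add_distrib]

lemma comb_sub (θ : σ → A) (b : Λ → A) (p q : Λ → MvPolynomial σ K) :
    comb θ b (p - q) = comb θ b p - comb θ b q := by
  simp [comb, sub_mul, Finset.sum_sub_distrib]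

lemma comb_zero (θ : σ → A) (b : Λ → A) : comb θ b (0 : Λ → MvPolynomial σ K) = 0 := by
  simp [comb]

lemma comb_mul (θ : σ → A) (b : Λ → A) (q : MvPolynomial σ K) (p : Λ → MvPolynomial σ K) :
    comb θ b (fun l => q * p l) = aeval θ q * comb θ b p := by
  simp [comb, Finset.mul_sum, mul_assoc]

lemma comb_mem {θ : σ → A} {b : Λ → A} {p : Λ → MvPolynomial σ K} {s : Set σ}
    (hp : ∀ l, p l ∈ Ideal.span (X '' s)) : comb θ b p ∈ Ideal.span (θ '' s) := by
  refine Ideal.sum_mem _ fun l _ => Ideal.mul_mem_right _ _ ?_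
  have := Ideal.mem_map_of_mem (aeval (R := K) θ) (hp l)
  rw [Ideal.map_span, ← Set.image_comp] at this
  simpa only [Function.comp_def, aeval_X] using! this

/-- The family `b` is a basis over the polynomial ring acting through `θ`. -/
def IsFreeOver (K : Type u) [Field K] {A : Type u} [CommRing A] [Algebra K A] (θ : σ → A)
    (b : Λ → A) : Prop :=
  Function.Bijective (comb (K := K) θ b)

namespace IsFreeOver

variable {θ : σ → A} {b : Λ → A}

lemma mem_span_iff (h : IsFreeOver K θ b) {s : Set σ} {p : Λ → MvPolynomial σ K} :
    comb θ b p ∈ Ideal.span (θ '' s) ↔ ∀ l, p l ∈ Ideal.span (X '' s) := by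
  refine ⟨fun hp => ?_, comb_mem⟩
  have key : ∀ x ∈ Ideal.span (θ '' s), ∀ a : A,
      ∃ q : Λ → MvPolynomial σ K, (∀ l, q l ∈ Ideal.span (X '' s)) ∧ comb θ b q = a * x := by
    intro x hx
    induction hx using Submodule.span_induction with
    | mem x hx =>
      obtain ⟨j, hj, rfl⟩ := hx
      intro a
      obtain ⟨q, rfl⟩ := h.2 a
      refine ⟨fun l => X j * q l, fun l => Ideal.mul_mem_right _ _
        (Ideal.subset_span ⟨j, hj, rfl⟩), ?_⟩
      rw [comb_mul, aeval_X, mul_comm]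
    | zero => exact fun a => ⟨0, fun l => Ideal.zero_mem _, by rw [comb_zero, mul_zero]⟩
    | add x y _ _ hx hy =>
      intro a
      obtain ⟨q, hq, hq'⟩ := hx a
      obtain ⟨r, hr, hr'⟩ := hy a
      exact ⟨q + r, fun l => Ideal.add_mem _ (hq l) (hr l), by rw [comb_add, hq', hr', mul_add]⟩
    | smul c x _ hx =>
      intro a
      obtain ⟨q, hq, hq'⟩ := hx (a * c)
      exact ⟨q, hq, by rw [hq', smul_eq_mul, mul_assoc]⟩
  obtain ⟨q, hq, hq'⟩ := key _ hp 1
  rw [one_mul] at hq'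
  exact h.1 hq' ▸ hq

lemma mem_span_of_mul_mem (h : IsFreeOver K θ b) {s : Set σ} {j : σ} (hj : j ∉ s) {g : A}
    (hg : θ j * g ∈ Ideal.span (θ '' s)) : g ∈ Ideal.span (θ '' s) := by
  obtain ⟨p, rfl⟩ := h.2 g
  rw [show θ j * comb θ b p = comb θ b fun l => X j * p l by rw [comb_mul, aeval_X],
    h.mem_span_iff] at hg
  rw [h.mem_span_iff]
  exact fun l => (algebraicIndependent_X σ K).mem_span_of_mul_mem (adjoin_range_X) hj (hg l)

lemma comp (h : IsFreeOver K θ b) (τ : MvPolynomial σ K ≃ₐ[K] MvPolynomial σ K) :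
    IsFreeOver K (fun j => aeval θ (τ (X j))) b := by
  have : comb (K := K) (fun j => aeval θ (τ (X j))) b = comb θ b ∘ fun p l => τ (p l) := by
    funext p
    have : (aeval fun j => aeval θ (τ (X j)) : MvPolynomial σ K →ₐ[K] A) =
        (aeval θ).comp τ.toAlgHom := by
      ext j
      simp
    simp [comb, this]
  rw [IsFreeOver, this]
  exact Function.Bijective.comp h ((Equiv.piCongrRight fun _ => τ.toEquiv).bijective)

end IsFreeOver

/-- The elements `θ j` for `j ∈ s` form a regular sequence in some order. -/
inductive IsRegularOn (θ : σ → A) [DecidableEq σ] : Finset σ → Prop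
  | empty : IsRegularOn θ ∅
  | insert {j : σ} {s : Finset σ} (hj : j ∉ s) (hs : IsRegularOn θ s)
      (h : ∀ g, θ j * g ∈ Ideal.span (θ '' s) → g ∈ Ideal.span (θ '' s)) :
      IsRegularOn θ (insert j s)

lemma IsRegularOn.congr [DecidableEq σ] {θ θ' : σ → A} {s : Finset σ} (hs : IsRegularOn θ s)
    (h : ∀ j ∈ s, θ j = θ' j) : IsRegularOn θ' s := by
  induction hs with
  | empty => exact .empty
  | @insert j s hj hs H ih =>
    refine .insert hj (ih fun i hi => h i (Finset.mem_insert_of_mem hi)) ?_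
    rwa [← h j (Finset.mem_insert_self _ _), ← Set.image_congr (f := θ)
      fun i hi => h i (Finset.mem_insert_of_mem hi)]

lemma IsFreeOver.isRegularOn [DecidableEq σ] {θ : σ → A} {b : Λ → A} (h : IsFreeOver K θ b)
    (s : Finset σ) : IsRegularOn θ s := by
  induction s using Finset.induction_on with
  | empty => exact .empty
  | insert j s hj ih => exact .insert hj ih fun g => h.mem_span_of_mul_mem (by simpa using hj)

lemma exists_eq_add_X_mul {j : σ} {s : Set σ} {p : MvPolynomial σ K}
    (hp : p ∈ Ideal.span (X '' (insert j s))) : ∃ q r : MvPolynomial σ K,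
      q ∈ Ideal.span (X '' s) ∧ p = q + X j * r ∧
        ∀ m, coeff m r ≠ 0 → ∃ m', coeff m' p ≠ 0 ∧ m'.degree = m.degree + 1 := by
  classical
  refine ⟨p.modMonomial (Finsupp.single j 1), p.divMonomial (Finsupp.single j 1), ?_,
    (modMonomial_add_divMonomial_single p j).symm, fun m hm => ?_⟩
  · rw [mem_ideal_span_X_image] at hp ⊢
    intro m hm
    rw [mem_support_iff] at hm
    by_cases hj : Finsupp.single j 1 ≤ m
    · exact absurd (coeff_modMonomial_of_le _ hj) hm
    rw [coeff_modMonomial_of_not_le _ hj] at hm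
    obtain ⟨i, hi, hmi⟩ := hp m (mem_support_iff.2 hm)
    rcases Set.mem_insert_iff.1 hi with rfl | hi
    · exact absurd (Finsupp.single_le_iff.2 (Nat.one_le_iff_ne_zero.2 hmi)) hj
    · exact ⟨i, hi, hmi⟩
  · rw [coeff_divMonomial] at hm
    exact ⟨_, hm, by rw [map_add, Finsupp.degree_single, add_comm]⟩

/-- A family which is independent modulo a regular sequence is independent over the polynomial
ring acting through that sequence. -/
theorem injective_comb_of_isRegularOn [Fintype σ] [DecidableEq σ] {θ : σ → A} {b : Λ → A}
    (hθ : IsRegularOn θ Finset.univ)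
    (hb : ∀ c : Λ → K, ∑ l, algebraMap K A (c l) * b l ∈ Ideal.span (Set.range θ) → c = 0) :
    Function.Injective (comb (K := K) θ b) := by
  have key : ∀ s : Finset σ, IsRegularOn θ s →
      (∀ p : Λ → MvPolynomial σ K, comb θ b p ∈ Ideal.span (θ '' s) →
        ∀ l, p l ∈ Ideal.span (X '' (s : Set σ))) →
      ∀ p : Λ → MvPolynomial σ K, comb θ b p = 0 → p = 0 := by
    intro s hs
    induction hs with
    | empty =>
      intro h p hp
      funext l
      simpa using h p (by simp [hp]) l
    | @insert j s hj hs hreg ih =>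
      intro h
      refine ih ?_
      have hdeg : ∀ (n : ℕ) (p : Λ → MvPolynomial σ K),
          (∀ l m, coeff m (p l) ≠ 0 → m.degree < n) → comb θ b p ∈ Ideal.span (θ '' s) →
          ∀ l, p l ∈ Ideal.span (X '' (s : Set σ)) := by
        intro n
        induction n with
        | zero =>
          intro p hp _ l
          rw [show p l = 0 from MvPolynomial.ext _ _ fun m => by_contra fun hm =>
            absurd (hp l m hm) (Nat.not_lt_zero _)]
          exact Ideal.zero_mem _
        | succ n ihn =>
          intro p hp hps
          have hps' := h p (Ideal.span_mono (Set.image_mono (by simp)) hps)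
          rw [Finset.coe_insert] at hps'
          choose q r hq hpq hr using fun l => exists_eq_add_X_mul (hps' l)
          have hp' : p = q + fun l => X j * r l := _root_.funext hpq
          have h1 : comb θ b r ∈ Ideal.span (θ '' s) := by
            apply hreg
            rw [hp', comb_add, comb_mul, aeval_X] at hps
            exact (Ideal.add_mem_iff_right _ (comb_mem hq)).1 hps
          have := ihn r (fun l m hm => by
            obtain ⟨m', hm', hd⟩ := hr l m hm
            have := hp l m' hm'
            omega) h1
          intro l
          rw [hpq l]
          exact Ideal.add_mem _ (hq l) (Ideal.mul_mem_left _ _ (this l))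
      intro p
      refine hdeg (Finset.univ.sup (fun l => (p l).totalDegree) + 1) p fun l m hm =>
        Nat.lt_succ_of_le (le_trans ?_ (Finset.le_sup (f := fun l => (p l).totalDegree)
          (Finset.mem_univ l)))
      exact le_totalDegree (mem_support_iff.2 hm)
  refine (injective_iff_map_eq_zero (⟨⟨comb θ b, comb_zero θ b⟩, comb_add θ b⟩ :
    (Λ → MvPolynomial σ K) →+ A)).2 (key _ hθ fun p hp l => ?_)
  rw [Finset.coe_univ, Set.image_univ] at hp
  have h1 : ∀ q : MvPolynomial σ K, q - C (constantCoeff q) ∈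
      Ideal.span (X '' (Set.univ : Set σ)) := by
    intro q
    rw [mem_ideal_span_X_image]
    intro m hm
    rw [mem_support_iff, coeff_sub, coeff_C] at hm
    have : m ≠ 0 := by
      rintro rfl
      simp [constantCoeff_eq] at hm
    obtain ⟨i, hi⟩ := Finsupp.ne_iff.1 this
    exact ⟨i, trivial, hi⟩
  have h2 : (fun l => constantCoeff (p l)) = 0 := by
    apply hb
    have h3 := comb_mem (θ := θ) (b := b) fun l => h1 (p l)
    rw [Set.image_univ] at h3
    have h4 : comb θ b p - comb θ b (fun l => p l - C (constantCoeff (p l))) =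
        ∑ l, algebraMap K A (constantCoeff (p l)) * b l := by
      rw [← comb_sub]
      simp [comb]
    rw [← h4]
    exact Ideal.sub_mem _ hp h3
  have h5 := h1 (p l)
  rw [show constantCoeff (p l) = 0 from congrFun h2 l, C_0, sub_zero] at h5
  rwa [Finset.coe_univ]

end MvPolynomial

end

section

open MvPolynomial

namespace MvPolynomial

section Components

variable {R : Type*} [CommRing R] {ρ : Type*}

lemma homogeneousComponent_mul_of_isHomogeneous {d : ℕ} {b : MvPolynomial ρ R}
    (hb : b.IsHomogeneous d) (n : ℕ) (a : MvPolynomial ρ R) :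
    homogeneousComponent n (a * b) = if d ≤ n then homogeneousComponent (n - d) a * b else 0 := by
  classical
  conv_lhs => rw [← sum_homogeneousComponent a, Finset.sum_mul, map_sum]
  have h1 : ∀ e, homogeneousComponent n (homogeneousComponent e a * b) =
      if e + d = n then homogeneousComponent e a * b else 0 := fun e => by
    rw [homogeneousComponent_of_mem ((homogeneousComponent_isHomogeneous e a).mul hb)]
    simp only [eq_comm]
  simp only [h1]
  split_ifs with hd
  · by_cases hn : n - d ∈ Finset.range (a.totalDegree + 1)
    · rw [Finset.sum_eq_single_of_mem _ hn fun e _ he => if_neg (by omega), if_pos (by omega)]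
    · rw [Finset.sum_eq_zero, homogeneousComponent_eq_zero, zero_mul]
      · rw [Finset.mem_range] at hn; omega
      · intro e he
        rw [if_neg]
        rintro rfl
        exact hn (by simpa using! he)
  · exact Finset.sum_eq_zero fun e _ => if_neg (by omega)

lemma homogeneousComponent_mul (n : ℕ) (a b : MvPolynomial ρ R) :
    homogeneousComponent n (a * b) = ∑ x ∈ Finset.HasAntidiagonal.antidiagonal n,
      homogeneousComponent x.1 a * homogeneousComponent x.2 b := by
  classical
  have h1 : b = ∑ j ∈ Finset.range (max n b.totalDegree + 1), homogeneousComponent j b := by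
    conv_lhs => rw [← sum_homogeneousComponent b]
    refine Finset.sum_subset (Finset.range_subset_range.2 (by omega)) fun j _ hj => ?_
    exact homogeneousComponent_eq_zero _ _ (by simpa using! hj)
  conv_lhs => rw [h1, Finset.mul_sum, map_sum]
  simp only [homogeneousComponent_mul_of_isHomogeneous (homogeneousComponent_isHomogeneous _ b)]
  rw [← Finset.sum_filter, Finset.Nat.sum_antidiagonal_eq_sum_range_succ_mk,
    ← Finset.sum_range_reflect]
  refine Finset.sum_congr ?_ fun j hj => ?_
  · ext j
    simp only [Finset.mem_filter, Finset.mem_range]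
    omega
  · rw [Finset.mem_range] at hj
    rw [show n - (n + 1 - 1 - j) = j by omega, show n + 1 - 1 - j = n - j by omega]

end Components

variable {K : Type u} [Field K] {σ : Type} {ρ : Type} {Λ : Type} [Fintype Λ]

/-- Homogeneous elements spanning modulo homogeneous parameters generate over them. -/
theorem surjective_comb [Fintype σ] {θ : σ → MvPolynomial ρ K} {b : Λ → MvPolynomial ρ K}
    (hθ : ∀ j, ∃ d, 1 ≤ d ∧ (θ j).IsHomogeneous d) (hb : ∀ l, ∃ d, (b l).IsHomogeneous d)
    (hspan : ∀ a : MvPolynomial ρ K, ∃ c : Λ → K,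
      a - ∑ l, C (c l) * b l ∈ Ideal.span (Set.range θ)) :
    Function.Surjective (comb (K := K) θ b) := by
  classical
  choose d hd1 hd using hθ
  choose e he using hb
  let f : (Λ → MvPolynomial σ K) →+ MvPolynomial ρ K :=
    ⟨⟨comb θ b, comb_zero θ b⟩, comb_add θ b⟩
  have hf : ∀ p, f p = comb θ b p := fun _ => rfl
  have hrange : ∀ n (a : MvPolynomial ρ K), homogeneousComponent n a ∈ f.range := by
    intro n
    induction n using Nat.strong_induction_on with
    | _ n ih =>
      intro a
      obtain ⟨c, hc⟩ := hspan a
      obtain ⟨g, hg⟩ := Ideal.mem_span_range_iff_exists_fun.1 hc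
      rw [← sub_add_cancel a (∑ l, C (c l) * b l), ← hg, map_add, map_sum, map_sum]
      refine add_mem (sum_mem fun j _ => ?_) (sum_mem fun l _ => ?_)
      · rw [homogeneousComponent_mul_of_isHomogeneous (hd j)]
        split_ifs with hj
        · obtain ⟨p, hp⟩ := ih (n - d j) (by have := hd1 j; omega) (g j)
          exact ⟨fun l => X j * p l, by rw [hf, comb_mul, aeval_X, ← hf, hp, mul_comm]⟩
        · exact zero_mem _
      · rw [homogeneousComponent_of_mem ((isHomogeneous_C _ _).mul (he l))]
        split_ifs
        · refine ⟨Pi.single l (C (c l)), ?_⟩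
          rw [hf, comb, Finset.sum_eq_single l]
          · simp [algebraMap_eq]
          · intro i _ hi
            simp [Pi.single_eq_of_ne hi]
          · simp
        · exact zero_mem _
  intro a
  rw [← sum_homogeneousComponent a]
  have : ∑ n ∈ Finset.range (a.totalDegree + 1), homogeneousComponent n a ∈ f.range :=
    sum_mem fun n _ => hrange n a
  exact this

end MvPolynomial

end

section

open MvPolynomial

namespace MvPolynomial

variable {K : Type u} [Field K] {σ : Type} {A : Type u} [CommRing A] [Algebra K A]
  {Λ : Type} [Fintype Λ]

/-- The Cayley–Hamilton theorem for an element of an algebra which is finite free over a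
polynomial ring. -/
lemma IsFreeOver.exists_sum_eq_zero {θ : σ → A} {b : Λ → A} (hb : IsFreeOver K θ b) (h : A) :
    ∃ c : ℕ → MvPolynomial σ K, c (Fintype.card Λ) = 1 ∧
      ∑ j ∈ Finset.range (Fintype.card Λ + 1), aeval θ (c j) * h ^ j = 0 := by
  classical
  let E := Equiv.ofBijective _ hb
  have hE : ∀ a, comb θ b (E.symm a) = a := E.apply_symm_apply
  have hsmul : ∀ (q : MvPolynomial σ K) p, comb θ b (q • p) = aeval θ q * comb θ b p :=
    fun q p => comb_mul θ b q p
  let f : Module.End (MvPolynomial σ K) (Λ → MvPolynomial σ K) :=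
    { toFun := fun p => E.symm (h * comb θ b p)
      map_add' := fun p q => hb.1 (by rw [hE, comb_add, comb_add, hE, hE, mul_add])
      map_smul' := fun q p => hb.1 (by
        rw [hE, RingHom.id_apply, hsmul, hsmul, hE, mul_left_comm]) }
  have hf : ∀ p, comb θ b (f p) = h * comb θ b p := fun p => hE _
  have hpow : ∀ (j : ℕ) p, comb θ b ((f ^ j) p) = h ^ j * comb θ b p := by
    intro j
    induction j with
    | zero => simp
    | succ j ih => intro p; rw [pow_succ', Module.End.mul_apply, hf, ih, pow_succ', mul_assoc]
  have hdeg : f.charpoly.natDegree = Fintype.card Λ := by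
    rw [LinearMap.charpoly_natDegree, Module.finrank_fintype_fun_eq_card]
  refine ⟨f.charpoly.coeff, ?_, ?_⟩
  · rw [← hdeg]
    exact f.charpoly_monic
  · have h1 := congrArg (fun g => comb θ b (g (E.symm 1))) f.aeval_self_charpoly
    simp only [Polynomial.aeval_eq_sum_range, hdeg, LinearMap.sum_apply, LinearMap.smul_apply,
      LinearMap.zero_apply, comb_zero] at h1
    let F : (Λ → MvPolynomial σ K) →+ A := ⟨⟨comb θ b, comb_zero θ b⟩, comb_add θ b⟩
    have h2 := map_sum F (fun j => f.charpoly.coeff j • (f ^ j) (E.symm 1))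
      (Finset.range (Fintype.card Λ + 1))
    rw [show F (∑ j ∈ Finset.range (Fintype.card Λ + 1), f.charpoly.coeff j • (f ^ j) (E.symm 1))
      = 0 from h1] at h2
    rw [h2]
    refine Finset.sum_congr rfl fun j _ => ?_
    change _ = comb θ b _
    rw [hsmul, hpow, hE, mul_one]

lemma aeval_sub_aeval_mem {θ θ' : σ → A} {I : Ideal A} (h : ∀ j, θ j - θ' j ∈ I)
    (p : MvPolynomial σ K) : aeval θ p - aeval θ' p ∈ I := by
  have : (Ideal.Quotient.mkₐ K I).comp (aeval θ) = (Ideal.Quotient.mkₐ K I).comp (aeval θ') := by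
    ext j
    simpa using Ideal.Quotient.eq.2 (h j)
  exact Ideal.Quotient.eq.1 (DFunLike.congr_fun this p)

end MvPolynomial

end

section

open MvPolynomial

namespace MvPolynomial

variable {K : Type u} [Field K] {σ ρ : Type}

lemma homogeneousComponent_mem_span {T : Set (MvPolynomial ρ K)}
    (hT : ∀ x ∈ T, ∃ d, x.IsHomogeneous d) {p : MvPolynomial ρ K} (hp : p ∈ Ideal.span T) (n : ℕ) :
    homogeneousComponent n p ∈ Ideal.span T := by
  let _ := gradedAlgebra (σ := ρ) (R := K)
  exact homogeneousComponent_mem_of_mem (Ideal.homogeneous_span _ _ fun x hx =>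
    (hT x hx).imp fun d hd => (mem_homogeneousSubmodule d x).2 hd) hp n

lemma isHomogeneous_aeval_of_one {θ : σ → MvPolynomial ρ K} (hθ : ∀ j, (θ j).IsHomogeneous 1)
    {n : ℕ} {p : MvPolynomial σ K} (hp : p.IsHomogeneous n) : (aeval θ p).IsHomogeneous n := by
  simpa only [one_mul] using hp.aeval θ hθ

lemma homogeneousComponent_aeval {θ : σ → MvPolynomial ρ K} (hθ : ∀ j, (θ j).IsHomogeneous 1)
    (n : ℕ) (p : MvPolynomial σ K) :
    homogeneousComponent n (aeval θ p) = aeval θ (homogeneousComponent n p) := by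
  classical
  have h1 : ∀ e, homogeneousComponent n (aeval θ (homogeneousComponent e p)) =
      if n = e then aeval θ (homogeneousComponent e p) else 0 := fun e => by
    exact homogeneousComponent_of_mem
      (isHomogeneous_aeval_of_one hθ (homogeneousComponent_isHomogeneous e p))
  conv_lhs => rw [← sum_homogeneousComponent p, map_sum, map_sum]
  simp only [h1]
  rw [Finset.sum_ite_eq, ite_eq_left_iff, Finset.mem_range]
  intro h
  rw [homogeneousComponent_eq_zero _ _ (by omega), map_zero]

lemma sum_range_succ_mul_pow {B : Type*} [CommRing B] (f : ℕ → B) (h : B) (i n : ℕ) :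
    ∑ j ∈ Finset.range (n + 1), f (j + i) * h ^ j =
      f i + h * ∑ j ∈ Finset.range n, f (j + (i + 1)) * h ^ j := by
  rw [Finset.sum_range_succ', Finset.mul_sum, add_comm]
  simp only [zero_add, pow_zero, mul_one]
  congr 1
  refine Finset.sum_congr rfl fun j _ => ?_
  rw [show j + 1 + i = j + (i + 1) by ring, pow_succ]
  ring

variable {Λ : Type} [Fintype Λ]

/-- If multiplication by `h` is injective in bounded degrees modulo some of the parameters, a power
form in the remaining linear parameters is divisible by `h`. -/
lemma IsFreeOver.exists_isHomogeneous_mem {θ : σ → MvPolynomial ρ K} {b : Λ → MvPolynomial ρ K}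
    (hb : IsFreeOver K θ b) {F : Set σ} (hF : ∀ j ∈ F, ∃ d, 1 ≤ d ∧ (θ j).IsHomogeneous d)
    (hlin : ∀ j ∉ F, (θ j).IsHomogeneous 1) {h : MvPolynomial ρ K} {D : ℕ} (hD : 1 ≤ D)
    (hh : h.IsHomogeneous D)
    (htest : ∀ g : MvPolynomial ρ K, g.totalDegree ≤ Fintype.card Λ * D →
      h * g ∈ Ideal.span (θ '' F) → g ∈ Ideal.span (θ '' F)) :
    ∃ (t : ℕ) (ν : MvPolynomial σ K) (h' : MvPolynomial ρ K), 1 ≤ t ∧ t ≤ Fintype.card Λ * D ∧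
      ν.IsHomogeneous t ∧ ν ≠ 0 ∧
      (∀ a a' : σ → K, (∀ j ∉ F, a j = a' j) → eval a ν = eval a' ν) ∧
      aeval θ ν + h * h' ∈ Ideal.span (θ '' F) := by
  classical
  set e := Fintype.card Λ with he
  set I := Ideal.span (θ '' F) with hI
  obtain ⟨c, hc1, hc⟩ := hb.exists_sum_eq_zero h
  let π : MvPolynomial σ K →ₐ[K] MvPolynomial σ K := aeval fun j => if j ∈ F then 0 else X j
  let θ' : σ → MvPolynomial ρ K := fun j => if j ∈ F then 0 else θ j
  have hπ : ∀ p, aeval θ (π p) = aeval θ' p := by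
    have : (aeval θ).comp π = (aeval θ' : MvPolynomial σ K →ₐ[K] MvPolynomial ρ K) := by
      ext j
      by_cases hj : j ∈ F <;> simp [π, θ', hj]
    exact DFunLike.congr_fun this
  have hθ' : ∀ j, (θ' j).IsHomogeneous 1 := by
    intro j
    by_cases hj : j ∈ F
    · simpa [θ', hj] using isHomogeneous_zero ρ K 1
    · simpa [θ', hj] using hlin j hj
  have hπhom : ∀ {p : MvPolynomial σ K} {n}, p.IsHomogeneous n → (π p).IsHomogeneous n := by
    intro p n hp
    refine isHomogeneous_aeval_of_one (fun j => ?_) hp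
    split_ifs
    · exact isHomogeneous_zero _ _ _
    · exact isHomogeneous_X _ _
  have hmem : ∀ p : MvPolynomial σ K, aeval θ p - aeval θ' p ∈ I := by
    refine aeval_sub_aeval_mem fun j => ?_
    by_cases hj : j ∈ F
    · simpa [θ', hj] using Ideal.subset_span (Set.mem_image_of_mem θ hj)
    · simp [θ', hj]
  let ν : ℕ → MvPolynomial σ K := fun j => π (homogeneousComponent ((e - j) * D) (c j))
  have hνhom : ∀ j, (ν j).IsHomogeneous ((e - j) * D) := fun j =>
    hπhom (homogeneousComponent_isHomogeneous _ _)
  have hνe : ν e = 1 := by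
    simp only [ν, he, hc1, Nat.sub_self, zero_mul, homogeneousComponent_zero, coeff_zero_one,
      map_one]
  have hsum : ∑ j ∈ Finset.range (e + 1), aeval θ (ν j) * h ^ j ∈ I := by
    have h1 : ∑ j ∈ Finset.range (e + 1), aeval θ' (c j) * h ^ j ∈ I := by
      have : ∑ j ∈ Finset.range (e + 1), (aeval θ (c j) - aeval θ' (c j)) * h ^ j ∈ I :=
        Ideal.sum_mem _ fun j _ => Ideal.mul_mem_right _ _ (hmem _)
      simp only [sub_mul, Finset.sum_sub_distrib] at this
      rw [hc, zero_sub] at this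
      exact neg_mem_iff.1 this
    have h2 := homogeneousComponent_mem_span (by
      rintro _ ⟨j, hj, rfl⟩
      exact (hF j hj).imp fun d hd => hd.2) h1 (e * D)
    rw [map_sum] at h2
    convert h2 using 1
    refine Finset.sum_congr rfl fun j hj => ?_
    have hj : j ≤ e := by simpa [Nat.lt_succ_iff] using hj
    rw [homogeneousComponent_mul_of_isHomogeneous (hh.pow j), if_pos (by nlinarith),
      homogeneousComponent_aeval hθ', hπ, Nat.sub_mul, mul_comm D j]
  have hνaeval : ∀ j, (aeval θ (ν j)).IsHomogeneous ((e - j) * D) := by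
    intro j
    rw [hπ]
    exact isHomogeneous_aeval_of_one hθ' (homogeneousComponent_isHomogeneous _ (c j))
  have hinv : ∀ k (a a' : σ → K), (∀ j ∉ F, a j = a' j) → eval a (ν k) = eval a' (ν k) := by
    intro k a a' ha
    have : (aeval a : MvPolynomial σ K →ₐ[K] K).comp π =
        (aeval a' : MvPolynomial σ K →ₐ[K] K).comp π := by
      ext j
      by_cases hj : j ∈ F
      · simp [π, hj]
      · simp [π, hj, ha j hj]
    exact congrArg (fun f : MvPolynomial σ K →ₐ[K] K => f (homogeneousComponent ((e - k) * D) (c k))) this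
  clear_value ν
  have hex : ∃ k, ν k ≠ 0 := ⟨e, by rw [hνe]; exact one_ne_zero⟩
  obtain ⟨k, hk0, hkmin⟩ : ∃ k, ν k ≠ 0 ∧ ∀ i < k, ν i = 0 :=
    ⟨Nat.find hex, Nat.find_spec hex, fun i hi => not_not.1 (Nat.find_min hex hi)⟩
  have hke : k ≤ e := by
    by_contra hk
    have := hkmin e (by omega)
    rw [hνe] at this
    exact one_ne_zero this
  obtain ⟨G, hG0⟩ : ∃ G : ℕ → MvPolynomial ρ K, ∀ i, G i =
      ∑ j ∈ Finset.range (e + 1 - i), aeval θ (ν (j + i)) * h ^ j := ⟨_, fun _ => rfl⟩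
  have hGsucc : ∀ i ≤ e, G i = aeval θ (ν i) + h * G (i + 1) := by
    intro i hi
    rw [hG0 i, hG0 (i + 1), show e + 1 - i = (e + 1 - (i + 1)) + 1 by omega]
    exact sum_range_succ_mul_pow (fun j => aeval θ (ν j)) h i _
  have hGdeg : ∀ i, (G i).totalDegree ≤ e * D := by
    intro i
    rw [hG0]
    refine totalDegree_finsetSum_le fun j hj => ?_
    have h1 := ((hνaeval (j + i)).mul (hh.pow j)).totalDegree_le
    rw [Finset.mem_range] at hj
    refine h1.trans ?_
    calc (e - (j + i)) * D + D * j = (e - (j + i) + j) * D := by ring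
      _ ≤ e * D := Nat.mul_le_mul_right _ (by omega)
  have hG : ∀ i ≤ k, G i ∈ I := by
    intro i
    induction i with
    | zero => intro _; simpa [hG0] using hsum
    | succ i ih =>
      intro hi
      have h1 := ih (by omega)
      rw [hGsucc i (by omega), hkmin i (by omega), map_zero,
        zero_add] at h1
      exact htest _ (hGdeg _) h1
  have hGk := hG k le_rfl
  rw [hGsucc k hke] at hGk
  refine ⟨(e - k) * D, ν k, G (k + 1), ?_, Nat.mul_le_mul_right _ (Nat.sub_le _ _), hνhom k,
    hk0, hinv k, hGk⟩
  rcases hke.eq_or_lt with hk | hk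
  · exfalso
    rw [hk, hνe, map_one, show G (e + 1) = 0 by simp [hG0], mul_zero, add_zero] at hGk
    have : I ≤ RingHom.ker (constantCoeff : MvPolynomial ρ K →+* K) := by
      rw [hI, Ideal.span_le]
      rintro _ ⟨j, hj, rfl⟩
      obtain ⟨d, hd1, hd⟩ := hF j hj
      rw [SetLike.mem_coe, RingHom.mem_ker, constantCoeff_eq]
      refine hd.coeff_eq_zero ?_
      rw [map_zero]; omega
    simpa using this hGk
  · exact Nat.mul_pos (by omega) hD

end MvPolynomial

end

section

open MvPolynomial

namespace MvPolynomial

variable {K : Type u} [Field K] {σ ρ : Type}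

lemma aeval_mul_left_of_isHomogeneous [Fintype σ] {B : Type*} [CommRing B] [Algebra K B]
    {p : MvPolynomial σ K} {t : ℕ} (hp : p.IsHomogeneous t) (r : B) (g : σ → B) :
    aeval (fun j => r * g j) p = r ^ t * aeval g p := by
  rw [aeval_def, aeval_def, eval₂_eq', eval₂_eq', Finset.mul_sum]
  refine Finset.sum_congr rfl fun m hm => ?_
  have : ∑ i, m i = t := by
    rw [← hp (mem_support_iff.1 hm)]
    simp [Finsupp.weight_apply, Finsupp.sum_fintype]
  rw [← this, ← Finset.prod_pow_eq_pow_sum, mul_left_comm, ← Finset.prod_mul_distrib]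
  simp only [mul_pow]

/-- The automorphism subtracting multiples of one variable from the others. -/
noncomputable def shearAt [DecidableEq σ] (k : σ) (γ : σ → K) (hγ : γ k = 0) :
    MvPolynomial σ K ≃ₐ[K] MvPolynomial σ K :=
  AlgEquiv.ofAlgHom (aeval fun j => X j - C (γ j) * X k) (aeval fun j => X j + C (γ j) * X k)
    (by ext j; simp [hγ]) (by ext j; simp [hγ])

lemma shearAt_X [DecidableEq σ] (k : σ) (γ : σ → K) (hγ : γ k = 0) (j : σ) :
    shearAt k γ hγ (X j) = X j - C (γ j) * X k := by
  simp [shearAt]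

variable {Λ : Type} [Fintype Λ]

lemma exists_sub_sum_mem {θ : σ → MvPolynomial ρ K} {b : Λ → MvPolynomial ρ K}
    (hb : Function.Surjective (comb (K := K) θ b)) {I : Ideal (MvPolynomial ρ K)} {k : σ} {t : ℕ}
    (hθ : ∀ j ≠ k, θ j ∈ I) (hk : θ k ^ t ∈ I) :
    (Submodule.span K (Set.range fun x : Λ × Fin t => b x.1 * θ k ^ (x.2 : ℕ))) ⊔
      I.restrictScalars K = ⊤ := by
  classical
  rw [eq_top_iff]
  intro a _
  obtain ⟨p, rfl⟩ := hb a
  refine Submodule.sum_mem _ fun l _ => ?_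
  induction p l using MvPolynomial.induction_on' with
  | add p q hp hq => rw [map_add, add_mul]; exact Submodule.add_mem _ hp hq
  | monomial m c =>
    by_cases hm : ∃ j ≠ k, m j ≠ 0
    · obtain ⟨j, hj, hmj⟩ := hm
      refine Submodule.mem_sup_right (Ideal.mul_mem_right _ I ?_)
      obtain ⟨q, hq⟩ : X j ∣ monomial m c := (X_dvd_monomial).2 (Or.inr hmj)
      rw [hq, map_mul, aeval_X]
      exact Ideal.mul_mem_right _ _ (hθ j hj)
    · push Not at hm
      have hm' : m = Finsupp.single k (m k) := by
        ext j
        by_cases hj : j = k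
        · simp [hj]
        · simp [hm j hj, Ne.symm hj]
      rw [hm', aeval_monomial, Finsupp.prod_single_index (h := fun i n => θ i ^ n) (pow_zero _)]
      by_cases ht : m k < t
      · refine Submodule.mem_sup_left ?_
        rw [mul_assoc, mul_comm _ (b l), ← Algebra.smul_def]
        exact Submodule.smul_mem _ _ (Submodule.subset_span ⟨(l, ⟨m k, ht⟩), rfl⟩)
      · refine Submodule.mem_sup_right (Ideal.mul_mem_right _ I (Ideal.mul_mem_left _ _ ?_))
        rw [← Nat.sub_add_cancel (not_lt.1 ht), pow_add]
        exact Ideal.mul_mem_left _ _ hk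

/-- A homogeneous element which is regular in bounded degrees modulo some of the parameters can be
exchanged for a linear parameter. -/
theorem IsFreeOver.exists_exchange [Infinite K] [Fintype σ] [DecidableEq σ]
    {θ : σ → MvPolynomial ρ K} {b : Λ → MvPolynomial ρ K} (hb : IsFreeOver K θ b)
    (hbh : ∀ l, ∃ d, (b l).IsHomogeneous d) {F : Set σ}
    (hF : ∀ j ∈ F, ∃ d, 1 ≤ d ∧ (θ j).IsHomogeneous d)
    (hlin : ∀ j ∉ F, (θ j).IsHomogeneous 1) {h : MvPolynomial ρ K} {D : ℕ} (hD : 1 ≤ D)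
    (hh : h.IsHomogeneous D)
    (htest : ∀ g : MvPolynomial ρ K, g.totalDegree ≤ Fintype.card Λ * D →
      h * g ∈ Ideal.span (θ '' F) → g ∈ Ideal.span (θ '' F)) :
    ∃ (k : σ) (θ' : σ → MvPolynomial ρ K) (Λ' : Type) (_ : Fintype Λ')
      (b' : Λ' → MvPolynomial ρ K), k ∉ F ∧ θ' k = h ∧ (∀ j ∈ F, θ' j = θ j) ∧
      (∀ j ∉ F, j ≠ k → (θ' j).IsHomogeneous 1) ∧ (∀ l, ∃ d, (b' l).IsHomogeneous d) ∧
      Fintype.card Λ' ≤ Fintype.card Λ * (Fintype.card Λ * D) ∧ IsFreeOver K θ' b' := by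
  obtain ⟨t, ν, h', ht1, ht, hν, hν0, hinv, hmem⟩ :=
    hb.exists_isHomogeneous_mem hF hlin hD hh htest
  obtain ⟨a, ha, haF⟩ : ∃ a : σ → K, eval a ν ≠ 0 ∧ ∀ j ∈ F, a j = 0 := by
    classical
    obtain ⟨a, ha⟩ : ∃ a : σ → K, eval a ν ≠ 0 := by
      by_contra! H
      exact hν0 (MvPolynomial.funext fun x => by rw [H x, map_zero])
    refine ⟨fun j => if j ∈ F then 0 else a j, ?_, fun j hj => if_pos hj⟩
    rwa [hinv _ a fun j hj => if_neg hj]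
  obtain ⟨k, hk⟩ : ∃ k, a k ≠ 0 := by
    by_contra! H
    apply ha
    rw [show a = fun j => 0 * a j from _root_.funext fun j => by rw [H j, mul_zero], ← coe_aeval_eq_eval,
      RingHom.coe_coe, aeval_mul_left_of_isHomogeneous hν, zero_pow (by omega), zero_mul]
  have hkF : k ∉ F := fun hkF => hk (haF k hkF)
  let γ : σ → K := fun j => if j = k then 0 else a j / a k
  have hγ : γ k = 0 := if_pos rfl
  have hb2 := hb.comp (shearAt k γ hγ)
  obtain ⟨ϑ, hϑ⟩ : ∃ ϑ : σ → MvPolynomial ρ K, ϑ = fun j => aeval θ (shearAt k γ hγ (X j)) :=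
    ⟨_, rfl⟩
  rw [← hϑ] at hb2
  have hϑ' : ∀ j, ϑ j = θ j - C (γ j) * θ k := by
    intro j
    rw [hϑ]
    simp [shearAt_X, algebraMap_eq]
  have hϑk : ϑ k = θ k := by rw [hϑ', hγ]; simp
  have hϑF : ∀ j ∈ F, ϑ j = θ j := by
    intro j hj
    rw [hϑ']
    simp [γ, haF j hj]
  set J := Ideal.span (ϑ '' {k}ᶜ) with hJ
  have hFJ : Ideal.span (θ '' F) ≤ J := by
    refine Ideal.span_le.2 ?_
    rintro _ ⟨j, hj, rfl⟩
    rw [← hϑF j hj]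
    exact Ideal.subset_span ⟨j, fun h => hkF (h ▸ hj), rfl⟩
  obtain ⟨κ, hκ, hrel⟩ : ∃ κ : K, κ ≠ 0 ∧ C κ * θ k ^ t + h * h' ∈ J := by
    have h1 : ∀ j, θ j - C (a k)⁻¹ * θ k * C (a j) ∈ J := by
      intro j
      by_cases hj : j = k
      · subst hj
        rw [show C (a j)⁻¹ * θ j * C (a j) = (C (a j)⁻¹ * C (a j)) * θ j by ring, ← C_mul,
          inv_mul_cancel₀ hk, C_1, one_mul, sub_self]
        exact J.zero_mem
      · have h2 : ϑ j ∈ J := Ideal.subset_span ⟨j, hj, rfl⟩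
        rw [hϑ'] at h2
        simp only [γ, if_neg hj, div_eq_mul_inv, C_mul] at h2
        rwa [show C (a k)⁻¹ * θ k * C (a j) = C (a j) * C (a k)⁻¹ * θ k by ring]
    have h2 := aeval_sub_aeval_mem h1 ν
    rw [aeval_mul_left_of_isHomogeneous hν] at h2
    have h3 : aeval (fun j => C (a j)) ν = (C (eval a ν) : MvPolynomial ρ K) := by
      have := aeval_algebraMap_apply (MvPolynomial ρ K) a ν
      rw [← coe_aeval_eq_eval]
      exact this
    refine ⟨(a k)⁻¹ ^ t * eval a ν, mul_ne_zero (pow_ne_zero _ (inv_ne_zero hk)) ha, ?_⟩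
    have h4 := Ideal.sub_mem _ (hFJ hmem) h2
    convert h4 using 1
    rw [h3, mul_pow, C_mul, C_pow]
    ring
  have hreg : ∀ g, h * g ∈ J → g ∈ J := by
    intro g hg
    have h1 : ∀ i, ϑ k ^ i * g ∈ J → g ∈ J := by
      intro i
      induction i with
      | zero => simp
      | succ i ih =>
        intro hi
        rw [pow_succ', mul_assoc] at hi
        exact ih (hb2.mem_span_of_mul_mem (by simp) hi)
    refine h1 t ?_
    have h2 : C κ * (ϑ k ^ t * g) ∈ J := by
      have h3 := Ideal.sub_mem _ (Ideal.mul_mem_right g _ hrel) (Ideal.mul_mem_left _ h' hg)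
      convert h3 using 1
      rw [hϑk]
      ring
    have h3 := Ideal.mul_mem_left _ (C κ⁻¹) h2
    rwa [← mul_assoc, ← C_mul, inv_mul_cancel₀ hκ, C_1, one_mul] at h3
  obtain ⟨θ', hθ'⟩ : ∃ θ' : σ → MvPolynomial ρ K, θ' = Function.update ϑ k h := ⟨_, rfl⟩
  have hθ'k : θ' k = h := by simp [hθ']
  have hθ'j : ∀ j ≠ k, θ' j = ϑ j := fun j hj => by simp [hθ', hj]
  have hθ'lin : ∀ j ∉ F, j ≠ k → (θ' j).IsHomogeneous 1 := by
    intro j hj hjk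
    rw [hθ'j j hjk, hϑ']
    refine (hlin j hj).sub ?_
    simpa using (isHomogeneous_C ρ (γ j)).mul (hlin k hkF)
  have hθ'F : ∀ j ∈ F, θ' j = θ j := fun j hj => by
    rw [hθ'j j (fun h => hkF (h ▸ hj)), hϑF j hj]
  have hθ'hom : ∀ j, ∃ d, 1 ≤ d ∧ (θ' j).IsHomogeneous d := by
    intro j
    by_cases hjk : j = k
    · exact ⟨D, hD, by rw [hjk, hθ'k]; exact hh⟩
    by_cases hj : j ∈ F
    · rw [hθ'F j hj]; exact hF j hj
    · exact ⟨1, le_rfl, hθ'lin j hj hjk⟩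
  have hregular : IsRegularOn θ' Finset.univ := by
    rw [← Finset.insert_erase (Finset.mem_univ k)]
    have himg : θ' '' ((Finset.univ.erase k : Finset σ) : Set σ) = ϑ '' {k}ᶜ := by
      rw [show ((Finset.univ.erase k : Finset σ) : Set σ) = {k}ᶜ by ext; simp]
      exact Set.image_congr fun j hj => hθ'j j hj
    refine .insert (Finset.notMem_erase _ _) ((hb2.isRegularOn _).congr fun j hj => ?_) ?_
    · exact (hθ'j j (Finset.ne_of_mem_erase hj)).symm
    · rw [himg, hθ'k]
      exact hreg
  set I := Ideal.span (Set.range θ') with hI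
  have hJI : J ≤ I := by
    refine Ideal.span_le.2 ?_
    rintro _ ⟨j, hj, rfl⟩
    rw [← hθ'j j hj]
    exact Ideal.subset_span ⟨j, rfl⟩
  have hhI : h ∈ I := hθ'k ▸ Ideal.subset_span ⟨k, rfl⟩
  have htop := exists_sub_sum_mem (I := I) (k := k) (t := t) hb2.2
    (fun j hj => hJI (Ideal.subset_span ⟨j, hj, rfl⟩)) (by
      have h1 := Ideal.sub_mem _ (hJI hrel) (Ideal.mul_mem_right h' _ hhI)
      rw [add_sub_cancel_right] at h1
      have h3 := Ideal.mul_mem_left _ (C κ⁻¹) h1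
      rwa [← mul_assoc, ← C_mul, inv_mul_cancel₀ hκ, C_1, one_mul, ← hϑk] at h3)
  let v : Λ × Fin t → MvPolynomial ρ K := fun x => b x.1 * ϑ k ^ (x.2 : ℕ)
  let mk : MvPolynomial ρ K →ₗ[K] MvPolynomial ρ K ⧸ I := (Ideal.Quotient.mkₐ K I).toLinearMap
  have hmk : ∀ a, mk a = 0 ↔ a ∈ I := fun a => Ideal.Quotient.eq_zero_iff_mem
  obtain ⟨Λ', s, hs, hspan, hli⟩ := exists_linearIndependent' K (mk ∘ v)
  have : Finite Λ' := Finite.of_injective s hs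
  let _ := Fintype.ofFinite Λ'
  have hsum : ∀ c : Λ' → K, mk (∑ l, C (c l) * v (s l)) = ∑ l, c l • (mk ∘ v ∘ s) l := by
    intro c
    rw [map_sum]
    refine Finset.sum_congr rfl fun l _ => ?_
    rw [← smul_eq_C_mul, map_smul]
    rfl
  have hb'hom : ∀ l, ∃ d, (v (s l)).IsHomogeneous d := fun l => by
    obtain ⟨d, hd⟩ := hbh (s l).1
    have h1 : (ϑ k).IsHomogeneous 1 := hϑk ▸ hlin k hkF
    exact ⟨_, hd.mul (h1.pow _)⟩
  refine ⟨k, θ', Λ', inferInstance, v ∘ s, hkF, hθ'k, hθ'F, hθ'lin, hb'hom, ?_, ?_, ?_⟩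
  · calc Fintype.card Λ' ≤ Fintype.card (Λ × Fin t) := Fintype.card_le_of_injective s hs
      _ = Fintype.card Λ * t := by simp
      _ ≤ _ := Nat.mul_le_mul_left _ ht
  · refine injective_comb_of_isRegularOn hregular fun c hc => ?_
    have h1 := hsum c
    rw [show mk (∑ l, C (c l) * v (s l)) = 0 from (hmk _).2 hc] at h1
    exact _root_.funext (Fintype.linearIndependent_iff.1 hli c h1.symm)
  · refine surjective_comb hθ'hom hb'hom fun a => ?_
    have h1 : mk a ∈ Submodule.span K (Set.range (mk ∘ v ∘ s)) := by
      rw [show mk ∘ v ∘ s = (mk ∘ v) ∘ s from rfl, hspan, Set.range_comp, ← Submodule.map_span]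
      obtain ⟨w, hw, z, hz, rfl⟩ := Submodule.mem_sup.1 (htop ▸ Submodule.mem_top :
        a ∈ _ ⊔ I.restrictScalars K)
      rw [map_add, (hmk z).2 hz, add_zero]
      exact Submodule.mem_map_of_mem hw
    obtain ⟨c, hc⟩ := (Submodule.mem_span_range_iff_exists_fun K).1 h1
    refine ⟨c, (hmk _).1 ?_⟩
    rw [map_sub, sub_eq_zero]
    exact (hc.symm).trans (hsum c).symm

end MvPolynomial

end

section

open MvPolynomial

namespace MvPolynomial

section Flat

variable {K : Type u} [Field K]

lemma flat_rename {σ τ : Type} {f : σ → τ} (hf : Function.Injective f) :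
    (rename f : MvPolynomial σ K →ₐ[K] MvPolynomial τ K).toRingHom.Flat := by
  classical
  let e : (((Set.range f)ᶜ : Set τ) ⊕ σ) ≃ τ :=
    (Equiv.sumComm _ _).trans (((Equiv.ofInjective f hf).sumCongr (Equiv.refl _)).trans
      (Equiv.Set.sumCompl (Set.range f)))
  have he : f = e ∘ Sum.inr := by
    ext x
    simp [e]
  let ψ := (sumAlgEquiv K ((Set.range f)ᶜ : Set τ) σ).symm.trans (renameEquiv K e)
  have hψ : (rename f : MvPolynomial σ K →ₐ[K] MvPolynomial τ K).toRingHom =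
      (ψ.toRingEquiv.toRingHom).comp (algebraMap (MvPolynomial σ K) _) := by
    ext x
    · simp [ψ, algebraMap_eq]
    · simp [ψ, he, algebraMap_eq]
  rw [hψ]
  refine RingHom.Flat.comp ?_ (.of_bijective ψ.bijective)
  exact (RingHom.flat_algebraMap_iff).2 inferInstance

lemma IsFreeOver.flat {σ Λ : Type} [Fintype Λ] {A : Type u} [CommRing A] [Algebra K A]
    {θ : σ → A} {b : Λ → A} (h : IsFreeOver K θ b) :
    (aeval θ : MvPolynomial σ K →ₐ[K] A).toRingHom.Flat := by
  let _ : Algebra (MvPolynomial σ K) A := (aeval θ : MvPolynomial σ K →ₐ[K] A).toRingHom.toAlgebra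
  let f : (Λ → MvPolynomial σ K) →ₗ[MvPolynomial σ K] A :=
    { toFun := comb θ b
      map_add' := comb_add θ b
      map_smul' := fun q p => comb_mul θ b q p }
  exact Module.Flat.of_linearEquiv (LinearEquiv.ofBijective f h).symm

end Flat

variable {K : Type u} [Field K] {N c : ℕ}

/-- The family `y` is part of a homogeneous system of parameters, all of whose other members are
linear, such that the polynomial ring has a homogeneous basis with at most `e` elements over it. -/
def HasParameters (y : Fin c → MvPolynomial (Fin N) K) (e : ℕ) : Prop :=
  ∃ (θ : Fin N → MvPolynomial (Fin N) K) (pos : Fin c → Fin N) (Λ : Type) (_ : Fintype Λ)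
    (b : Λ → MvPolynomial (Fin N) K), Fintype.card Λ ≤ e ∧ Function.Injective pos ∧
    (∀ j, θ (pos j) = y j) ∧ (∀ j, ∃ d, 1 ≤ d ∧ (θ j).IsHomogeneous d) ∧
    (∀ j ∉ Set.range pos, (θ j).IsHomogeneous 1) ∧ (∀ l, ∃ d, (b l).IsHomogeneous d) ∧
    IsFreeOver K θ b

lemma hasParameters_zero (y : Fin 0 → MvPolynomial (Fin N) K) : HasParameters y 1 := by
  refine ⟨X, Fin.elim0, Unit, inferInstance, 1, by simp, fun j => j.elim0, fun j => j.elim0,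
    fun j => ⟨1, le_rfl, isHomogeneous_X _ _⟩, fun j _ => isHomogeneous_X _ _,
    fun _ => ⟨0, isHomogeneous_one _ _⟩, fun p q h => ?_, fun a => ⟨fun _ => a, ?_⟩⟩
  · ext1 x
    simpa [comb] using! h
  · simp [comb]

lemma HasParameters.flat {y : Fin c → MvPolynomial (Fin N) K} {e : ℕ} (h : HasParameters y e) :
    (aeval y : MvPolynomial (Fin c) K →ₐ[K] MvPolynomial (Fin N) K).toRingHom.Flat := by
  obtain ⟨θ, pos, Λ, _, b, -, hpos, hθ, -, -, -, hb⟩ := h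
  have : (aeval y : MvPolynomial (Fin c) K →ₐ[K] MvPolynomial (Fin N) K) =
      (aeval θ).comp (rename pos) := by
    ext j
    simp [hθ]
  rw [this]
  exact (flat_rename hpos).comp hb.flat

lemma HasParameters.snoc [Infinite K] {y : Fin c → MvPolynomial (Fin N) K} {e : ℕ}
    (h : HasParameters y e) {f : MvPolynomial (Fin N) K} {D : ℕ} (hD : 1 ≤ D)
    (hf : f.IsHomogeneous D)
    (htest : ∀ g : MvPolynomial (Fin N) K, g.totalDegree ≤ e * D →
      f * g ∈ Ideal.span (Set.range y) → g ∈ Ideal.span (Set.range y)) :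
    HasParameters (Fin.snoc y f : Fin (c + 1) → MvPolynomial (Fin N) K) (e * (e * D)) := by
  obtain ⟨θ, pos, Λ, _, b, hΛ, hpos, hθ, hθh, hθl, hbh, hb⟩ := h
  have hy : θ '' Set.range pos = Set.range y := by
    rw [← Set.range_comp]
    exact congrArg Set.range (_root_.funext hθ)
  obtain ⟨k, θ', Λ', _, b', hk, hθk, hθF, hθl', hbh', hΛ', hb'⟩ :=
    hb.exists_exchange hbh (F := Set.range pos) (fun j _ => hθh j) hθl hD hf (by
      rw [hy]
      exact fun g hg => htest g (hg.trans (Nat.mul_le_mul_right _ hΛ)))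
  refine ⟨θ', Fin.snoc pos k, Λ', inferInstance, b', hΛ'.trans (by gcongr), ?_, ?_, ?_, ?_,
    hbh', hb'⟩
  · exact Fin.snoc_injective_of_injective hpos hk
  · intro j
    induction j using Fin.lastCases with
    | last => simpa using hθk
    | cast j => simpa [hθF _ (Set.mem_range_self j)] using hθ j
  · intro j
    by_cases hjk : j = k
    · exact ⟨D, hD, by rw [hjk, hθk]; exact hf⟩
    by_cases hj : j ∈ Set.range pos
    · rw [hθF j hj]; exact hθh j
    · exact ⟨1, le_rfl, hθl' j hj hjk⟩
  · intro j hj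
    refine hθl' j (fun ⟨i, hi⟩ => hj ⟨i.castSucc, by simpa using hi⟩) fun hjk => ?_
    exact hj ⟨Fin.last c, by simp [hjk]⟩

end MvPolynomial

end

namespace MvPolynomial

section Hasse

variable {R σ : Type*} [CommRing R]

/-- Substitution of `x + t v` for the variables `x`. -/
noncomputable def taylorHom (v : σ → R) :
    MvPolynomial σ R →ₐ[R] Polynomial (MvPolynomial σ R) :=
  aeval fun j => Polynomial.C (X j) + Polynomial.C (C (v j)) * Polynomial.X

/-- The Hasse derivation of order `n` in the direction `v`. -/
noncomputable def hasse (v : σ → R) (n : ℕ) : MvPolynomial σ R →ₗ[R] MvPolynomial σ R :=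
  (Polynomial.lcoeff (MvPolynomial σ R) n).restrictScalars R ∘ₗ (taylorHom v).toLinearMap

lemma hasse_apply (v : σ → R) (n : ℕ) (f : MvPolynomial σ R) :
    hasse v n f = (taylorHom v f).coeff n := rfl

lemma hasse_mul (v : σ → R) (n : ℕ) (f g : MvPolynomial σ R) :
    hasse v n (f * g) =
      ∑ x ∈ Finset.HasAntidiagonal.antidiagonal n, hasse v x.1 f * hasse v x.2 g := by
  simp only [hasse_apply, map_mul, Polynomial.coeff_mul]

lemma taylorHom_C (v : σ → R) (c : R) : taylorHom v (C c) = Polynomial.C (C c) := by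
  rw [← algebraMap_eq, AlgHom.commutes]
  rfl

lemma hasse_C (v : σ → R) {n : ℕ} (hn : n ≠ 0) (c : R) : hasse v n (C c) = 0 := by
  rw [hasse_apply, taylorHom_C, Polynomial.coeff_C_of_ne_zero hn]

lemma taylorHom_X (v : σ → R) (j : σ) :
    taylorHom v (X j) = Polynomial.C (X j) + Polynomial.C (C (v j)) * Polynomial.X := by
  simp [taylorHom]

lemma hasse_zero_mul_X (v : σ → R) (f : MvPolynomial σ R) (j : σ) :
    hasse v 0 (f * X j) = hasse v 0 f * X j := by
  simp [hasse_apply, taylorHom_X, Polynomial.mul_coeff_zero]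

lemma hasse_succ_mul_X (v : σ → R) (n : ℕ) (f : MvPolynomial σ R) (j : σ) :
    hasse v (n + 1) (f * X j) = hasse v (n + 1) f * X j + C (v j) * hasse v n f := by
  rw [hasse_apply, map_mul, taylorHom_X, mul_add, Polynomial.coeff_add, Polynomial.coeff_mul_C,
    mul_left_comm, Polynomial.coeff_C_mul, Polynomial.coeff_mul_X]
  rfl

lemma hasse_zero (v : σ → R) (f : MvPolynomial σ R) : hasse v 0 f = f := by
  induction f using MvPolynomial.induction_on with
  | C c => rw [hasse_apply, taylorHom_C, Polynomial.coeff_C_zero]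
  | add f g hf hg => rw [map_add, hf, hg]
  | mul_X f j hf => rw [hasse_zero_mul_X, hf]

lemma homogeneousComponent_C_eq_zero {n : ℕ} (hn : n ≠ 0) (c : R) :
    homogeneousComponent n (C c : MvPolynomial σ R) = 0 := by
  classical
  rw [homogeneousComponent_of_mem (isHomogeneous_C σ c), if_neg hn]

lemma hasse_homogeneousComponent_of_lt (v : σ → R) {n m : ℕ} (hm : m < n)
    (f : MvPolynomial σ R) : hasse v n (homogeneousComponent m f) = 0 := by
  induction f using MvPolynomial.induction_on generalizing n m with
  | C c =>
    rcases Nat.eq_zero_or_pos m with rfl | hm0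
    · rw [homogeneousComponent_zero, hasse_C v (by omega)]
    · rw [homogeneousComponent_C_eq_zero (by omega), map_zero]
  | add f g hf hg => rw [map_add, map_add, hf hm, hg hm, add_zero]
  | mul_X f j hf =>
    obtain ⟨n, rfl⟩ := Nat.exists_eq_succ_of_ne_zero (n := n) (by omega)
    rw [homogeneousComponent_mul_of_isHomogeneous (isHomogeneous_X R j)]
    split_ifs with h
    · rw [hasse_succ_mul_X, hf (by omega), hf (by omega), zero_mul, mul_zero, add_zero]
    · rw [map_zero]

lemma homogeneousComponent_hasse (v : σ → R) (n e : ℕ) (f : MvPolynomial σ R) :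
    homogeneousComponent e (hasse v n f) = hasse v n (homogeneousComponent (e + n) f) := by
  induction f using MvPolynomial.induction_on generalizing n e with
  | C c =>
    by_cases hn : n = 0
    · subst hn
      simp [hasse_zero]
    · rw [hasse_C v hn, homogeneousComponent_C_eq_zero (by omega), map_zero, map_zero]
  | add f g hf hg => simp only [map_add, hf, hg]
  | mul_X f j hf =>
    have hX := homogeneousComponent_mul_of_isHomogeneous (isHomogeneous_X R j)
    rcases n with _ | n
    · simp [hasse_zero]
    rw [hasse_succ_mul_X, map_add, hX, hX, homogeneousComponent_C_mul, hf, hf,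
      if_pos (show 1 ≤ e + (n + 1) by omega), hasse_succ_mul_X,
      show e + (n + 1) - 1 = e + n by omega]
    rcases e with _ | e
    · rw [if_neg (by omega), hasse_homogeneousComponent_of_lt v (show 0 + n < n + 1 by omega)]
      simp
    · rw [if_pos (by omega), show e + 1 - 1 + (n + 1) = e + 1 + n by omega]

lemma totalDegree_le_of_homogeneousComponent {f : MvPolynomial σ R} {d : ℕ}
    (h : ∀ e, d < e → homogeneousComponent e f = 0) : f.totalDegree ≤ d := by
  rw [← sum_homogeneousComponent f]
  refine totalDegree_finsetSum_le fun e _ => ?_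
  by_cases he : d < e
  · rw [h e he, totalDegree_zero]
    exact Nat.zero_le _
  · exact (homogeneousComponent_isHomogeneous e f).totalDegree_le.trans (not_lt.1 he)

lemma totalDegree_hasse_le (v : σ → R) (n : ℕ) (f : MvPolynomial σ R) :
    (hasse v n f).totalDegree ≤ f.totalDegree :=
  totalDegree_le_of_homogeneousComponent fun e he => by
    rw [homogeneousComponent_hasse, homogeneousComponent_eq_zero _ _ (by omega), map_zero]

lemma totalDegree_homogeneousComponent_le (n : ℕ) (f : MvPolynomial σ R) :
    (homogeneousComponent n f).totalDegree ≤ f.totalDegree := by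
  by_cases h : f.totalDegree < n
  · rw [homogeneousComponent_eq_zero _ _ h, totalDegree_zero]
    exact Nat.zero_le _
  · exact (homogeneousComponent_isHomogeneous n f).totalDegree_le.trans (not_lt.1 h)

lemma hasse_single [DecidableEq σ] (j : σ) (f : MvPolynomial σ R) :
    hasse (Pi.single j 1) 1 f = pderiv j f := by
  induction f using MvPolynomial.induction_on with
  | C c => rw [hasse_C _ one_ne_zero, pderiv_C]
  | add f g hf hg => rw [map_add, map_add, hf, hg]
  | mul_X f i hf =>
    rw [hasse_succ_mul_X, zero_add, hf, hasse_zero, Derivation.leibniz, pderiv_X, smul_eq_mul,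
      smul_eq_mul, add_comm, mul_comm (X i)]
    by_cases h : i = j
    · subst h; simp
    · simp [h]

lemma hasse_pow_char {p : ℕ} (hp : p.Prime) [CharP R p] (v : σ → R) (n : ℕ)
    (f : MvPolynomial σ R) : hasse v n (f ^ p) = if p ∣ n then hasse v (n / p) f ^ p else 0 := by
  have := Fact.mk hp
  rw [hasse_apply, map_pow, ← Polynomial.map_frobenius_expand, Polynomial.coeff_map,
    Polynomial.coeff_expand hp.pos]
  split_ifs
  · rfl
  · exact map_zero _

end Hasse

section Constants

variable {k σ : Type*} [Field k]

lemma coeff_pderiv_sub {f : MvPolynomial σ k} (hf : ∀ j, pderiv j f = 0) {m : σ →₀ ℕ} {j : σ}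
    (hj : m j ≠ 0) : coeff m f * (m j : k) = 0 := by
  have hmj : m = m - Finsupp.single j 1 + Finsupp.single j 1 := by
    refine (tsub_add_cancel_of_le ?_).symm
    rw [Finsupp.single_le_iff]
    exact Nat.one_le_iff_ne_zero.2 hj
  have h1 := coeff_pderiv (i := j) f (m - Finsupp.single j 1)
  rw [hf, coeff_zero, ← hmj] at h1
  rw [h1]
  congr 1
  conv_lhs => rw [hmj]
  simp

lemma eq_C_of_pderiv_eq_zero {f : MvPolynomial σ k} (hf : ∀ j, pderiv j f = 0)
    (hk : ∀ n : ℕ, 1 ≤ n → n ≤ f.totalDegree → (n : k) ≠ 0) : f = C (coeff 0 f) := by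
  classical
  ext m
  rw [coeff_C]
  split_ifs with hm
  · rw [hm]
  · obtain ⟨j, hj⟩ := Finsupp.ne_iff.1 (Ne.symm hm)
    by_contra hne
    have h1 := coeff_pderiv_sub hf hj
    have h2 : m j ≤ f.totalDegree :=
      (Finsupp.le_degree j m).trans (le_totalDegree (mem_support_iff.2 hne))
    exact (mul_ne_zero hne (hk _ (Nat.one_le_iff_ne_zero.2 hj) h2)) h1

lemma exists_pow_eq_of_pderiv_eq_zero {p : ℕ} (hp : p.Prime) [CharP k p] [PerfectRing k p]
    {f : MvPolynomial σ k} (hf : ∀ j, pderiv j f = 0) :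
    ∃ g, g ^ p = f ∧ g.totalDegree ≤ f.totalDegree / p := by
  have := Fact.mk hp
  have hdvd : ∀ m ∈ f.support, ∀ j, p ∣ m j := by
    intro m hm j
    by_cases hj : m j = 0
    · rw [hj]; exact dvd_zero p
    rw [← CharP.cast_eq_zero_iff k p]
    exact (mul_eq_zero.1 (coeff_pderiv_sub hf hj)).resolve_left (mem_support_iff.1 hm)
  obtain ⟨h, hh⟩ : ∃ h, expand p h = f := by
    refine ⟨∑ m ∈ f.support, monomial (m.mapRange (· / p) (Nat.zero_div p)) (coeff m f), ?_⟩
    rw [map_sum]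
    conv_rhs => rw [f.as_sum]
    refine Finset.sum_congr rfl fun m hm => ?_
    rw [expand_monomial]
    refine congrArg (fun m => monomial m _) (Finsupp.ext fun j => ?_)
    simp [Nat.mul_div_cancel' (hdvd m hm j)]
  have hpow : (map (frobeniusEquiv k p).symm.toRingHom h) ^ p = f := by
    rw [← map_frobenius_expand, ← map_expand, map_map, hh]
    convert map_id f
    ext x
    exact (frobeniusEquiv k p).apply_symm_apply x
  refine ⟨_, hpow, ?_⟩
  rw [Nat.le_div_iff_mul_le hp.pos, ← totalDegree_expand, ← map_expand, hh]
  exact totalDegree_le_of_support_subset (support_map_subset _ _)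

end Constants

lemma exists_sum_mul_of_mem_span {R σ : Type*} [CommRing R] {ι : Type*} [Fintype ι]
    {y : ι → MvPolynomial σ R} (hy : ∀ l, ∃ d, (y l).IsHomogeneous d) {f : MvPolynomial σ R}
    (hf : f ∈ Ideal.span (Set.range y)) :
    ∃ a : ι → MvPolynomial σ R, (∀ l, (a l).totalDegree ≤ f.totalDegree) ∧
      ∑ l, a l * y l = f := by
  obtain ⟨a, ha⟩ := (Ideal.mem_span_range_iff_exists_fun).1 hf
  choose d hd using hy
  refine ⟨fun l => ∑ e ∈ Finset.range (f.totalDegree + 1),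
    if d l ≤ e then homogeneousComponent (e - d l) (a l) else 0, fun l => ?_, ?_⟩
  · refine totalDegree_finsetSum_le fun e he => ?_
    have := Finset.mem_range.1 he
    split_ifs
    · exact (homogeneousComponent_isHomogeneous _ _).totalDegree_le.trans (by omega)
    · simp
  · conv_rhs => rw [← sum_homogeneousComponent f]
    simp only [Finset.sum_mul]
    rw [Finset.sum_comm]
    refine Finset.sum_congr rfl fun e _ => ?_
    conv_rhs => rw [← ha, map_sum]
    refine Finset.sum_congr rfl fun l _ => ?_
    rw [homogeneousComponent_mul_of_isHomogeneous (hd l), ite_mul, zero_mul]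

end MvPolynomial

section

open Filter MvPolynomial

namespace UltraProd

section MapFun

variable {U : Ultrafilter ℕ} {B : ℕ → Type u} [∀ i, CommRing (B i)]

/-- The map of ultraproducts induced by a family of functions. -/
noncomputable def mapFun {B' : ℕ → Type u} [∀ i, CommRing (B' i)] (L : ∀ i, B i → B' i)
    (x : UltraProd U B) : UltraProd U B' :=
  mk U fun i => L i ((mk_surjective x).choose i)

lemma mapFun_mk {B' : ℕ → Type u} [∀ i, CommRing (B' i)] (L : ∀ i, B i → B' i)
    (f : ∀ i, B i) : mapFun L (mk U f) = mk U fun i => L i (f i) := by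
  rw [mapFun, mk_eq_mk]
  filter_upwards [mk_eq_mk.1 (mk_surjective (mk U f)).choose_spec] with i hi
  rw [hi]

end MapFun

variable (U : Ultrafilter ℕ) (k : ℕ → Type u) [∀ i, Field (k i)] (N : ℕ → ℕ)

noncomputable instance mvPolynomialAlgebra :
    Algebra (UltraProd U k) (UltraProd U fun i => MvPolynomial (Fin (N i)) (k i)) :=
  (map U fun i => (C : k i →+* MvPolynomial (Fin (N i)) (k i))).toAlgebra

lemma algebraMap_mk (c : ∀ i, k i) :
    algebraMap (UltraProd U k) (UltraProd U fun i => MvPolynomial (Fin (N i)) (k i)) (mk U c) =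
      mk U fun i => C (c i) := rfl

/-- The elements of bounded degree in an ultraproduct of polynomial rings. -/
noncomputable def boundedDegree :
    Subalgebra (UltraProd U k) (UltraProd U fun i => MvPolynomial (Fin (N i)) (k i)) where
  carrier := {s | ∃ (f : ∀ i, MvPolynomial (Fin (N i)) (k i)) (d : ℕ),
    (∀ i, (f i).totalDegree ≤ d) ∧ mk U f = s}
  add_mem' := by
    rintro _ _ ⟨f, d, hf, rfl⟩ ⟨g, e, hg, rfl⟩
    exact ⟨f + g, max d e, fun i => (totalDegree_add _ _).trans (max_le_max (hf i) (hg i)),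
      map_add _ _ _⟩
  mul_mem' := by
    rintro _ _ ⟨f, d, hf, rfl⟩ ⟨g, e, hg, rfl⟩
    exact ⟨f * g, d + e, fun i => (totalDegree_mul _ _).trans (Nat.add_le_add (hf i) (hg i)),
      map_mul _ _ _⟩
  algebraMap_mem' := by
    intro c
    obtain ⟨c, rfl⟩ := mk_surjective c
    exact ⟨fun i => C (c i), 0, fun i => (totalDegree_C _).le, rfl⟩

instance : IsDomain (UltraProd U fun i => MvPolynomial (Fin (N i)) (k i)) := by
  have : Nontrivial (UltraProd U fun i => MvPolynomial (Fin (N i)) (k i)) :=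
    (map_injective (U := U) (φ := fun i => (C : k i →+* MvPolynomial (Fin (N i)) (k i)))
      fun i => C_injective _ _).nontrivial
  have : NoZeroDivisors (UltraProd U fun i => MvPolynomial (Fin (N i)) (k i)) := by
    refine ⟨fun {x y} hxy => ?_⟩
    obtain ⟨f, rfl⟩ := mk_surjective x
    obtain ⟨g, rfl⟩ := mk_surjective y
    rw [← map_mul, mk_eq_zero] at hxy
    rw [mk_eq_zero, mk_eq_zero, ← Ultrafilter.eventually_or]
    filter_upwards [hxy] with i hi
    exact mul_eq_zero.1 hi
  exact NoZeroDivisors.to_isDomain _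

variable {U k N}

/-- The element of bounded degree given by a sequence of polynomials. -/
noncomputable def ofBounded (f : ∀ i, MvPolynomial (Fin (N i)) (k i)) (d : ℕ)
    (hf : ∀ i, (f i).totalDegree ≤ d) : boundedDegree U k N :=
  ⟨mk U f, f, d, hf, rfl⟩

/-- The linear map induced by a family of linear maps which do not raise the degree. -/
noncomputable def liftLinear
    (L : ∀ i, MvPolynomial (Fin (N i)) (k i) →ₗ[k i] MvPolynomial (Fin (N i)) (k i))
    (hL : ∀ i f, (L i f).totalDegree ≤ f.totalDegree) :
    boundedDegree U k N →ₗ[UltraProd U k] boundedDegree U k N where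
  toFun s := ⟨mapFun (fun i => L i) s.1, by
    obtain ⟨f, d, hf, hs⟩ := s.2
    exact ⟨fun i => L i (f i), d, fun i => (hL i _).trans (hf i), by rw [← hs, mapFun_mk]⟩⟩
  map_add' := by
    rintro ⟨_, f, d, hf, rfl⟩ ⟨_, g, e, hg, rfl⟩
    ext1
    change mapFun _ (mk U f + mk U g) = mapFun _ (mk U f) + mapFun _ (mk U g)
    rw [← map_add, mapFun_mk, mapFun_mk, mapFun_mk, ← map_add]
    congr 1
    ext1 i
    exact map_add (L i) _ _
  map_smul' := by
    rintro c ⟨_, f, d, hf, rfl⟩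
    obtain ⟨c, rfl⟩ := mk_surjective c
    ext1
    change mapFun _ (mk U c • mk U f) = mk U c • mapFun _ (mk U f)
    rw [Algebra.smul_def, Algebra.smul_def, algebraMap_mk, ← map_mul, mapFun_mk, mapFun_mk,
      ← map_mul]
    congr 1
    ext1 i
    change L i (C (c i) * f i) = C (c i) * L i (f i)
    rw [← smul_eq_C_mul, map_smul, smul_eq_C_mul]

lemma coe_liftLinear
    (L : ∀ i, MvPolynomial (Fin (N i)) (k i) →ₗ[k i] MvPolynomial (Fin (N i)) (k i))
    (hL : ∀ i f, (L i f).totalDegree ≤ f.totalDegree) {s : boundedDegree U k N}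
    {f : ∀ i, MvPolynomial (Fin (N i)) (k i)} (hs : mk U f = s) :
    (liftLinear L hL s : UltraProd U fun i => MvPolynomial (Fin (N i)) (k i)) =
      mk U fun i => L i (f i) := by
  change mapFun _ s.1 = _
  rw [← hs, mapFun_mk]

variable (U k N)

/-- The Hasse derivations and homogeneous components on elements of bounded degree. -/
noncomputable def hasseGraded :
    HasseGraded (UltraProd U k) (boundedDegree U k N) (∀ i, Fin (N i) → k i) where
  D v n := liftLinear (fun i => hasse (v i) n) fun i => totalDegree_hasse_le _ _
  pr e := liftLinear (fun i => homogeneousComponent e) fun i => totalDegree_homogeneousComponent_le _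
  D_zero v s := by
    obtain ⟨f, d, hf, hs⟩ := s.2
    ext1
    rw [coe_liftLinear _ _ hs, ← hs]
    simp only [hasse_zero]
  D_mul v n a b := by
    obtain ⟨f, d, hf, hs⟩ := a.2
    obtain ⟨g, e, hg, ht⟩ := b.2
    ext1
    rw [coe_liftLinear (f := f * g) _ _ (by rw [map_mul, hs, ht]; rfl), AddSubmonoidClass.coe_finsetSum]
    simp only [MulMemClass.coe_mul, coe_liftLinear _ _ hs, coe_liftLinear _ _ ht, Pi.mul_apply,
      hasse_mul]
    simp only [← map_mul, ← map_sum]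
    congr 1
    ext1 i
    simp
  D_alg v n c hn := by
    obtain ⟨c, rfl⟩ := mk_surjective c
    ext1
    rw [coe_liftLinear (f := fun i => C (c i)) _ _ rfl]
    simp only [hasse_C _ hn]
    exact map_zero _
  pr_same e s := by
    obtain ⟨f, d, hf, hs⟩ := s.2
    ext1
    rw [coe_liftLinear _ _ (coe_liftLinear _ _ hs).symm, coe_liftLinear _ _ hs]
    simp only [homogeneousComponent_eq_self (homogeneousComponent_isHomogeneous e _)]
  pr_ne e e' s h := by
    obtain ⟨f, d, hf, hs⟩ := s.2
    ext1
    rw [coe_liftLinear _ _ (coe_liftLinear _ _ hs).symm]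
    simp only [homogeneousComponent_of_mem (homogeneousComponent_isHomogeneous e' _), if_neg h]
    exact map_zero _
  pr_mul n a b := by
    obtain ⟨f, d, hf, hs⟩ := a.2
    obtain ⟨g, e, hg, ht⟩ := b.2
    ext1
    rw [coe_liftLinear (f := f * g) _ _ (by rw [map_mul, hs, ht]; rfl), AddSubmonoidClass.coe_finsetSum]
    simp only [MulMemClass.coe_mul, coe_liftLinear _ _ hs, coe_liftLinear _ _ ht, Pi.mul_apply,
      homogeneousComponent_mul]
    simp only [← map_mul, ← map_sum]
    congr 1
    ext1 i
    simp
  pr_alg c := by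
    obtain ⟨c, rfl⟩ := mk_surjective c
    ext1
    rw [coe_liftLinear (f := fun i => C (c i)) _ _ rfl]
    simp only [homogeneousComponent_zero, coeff_zero_C]
    rfl
  pr_zero_mem s := by
    obtain ⟨f, d, hf, hs⟩ := s.2
    refine ⟨mk U fun i => coeff 0 (f i), ?_⟩
    ext1
    rw [coe_liftLinear _ _ hs]
    simp only [homogeneousComponent_zero]
    rfl
  pr_sum s := by
    obtain ⟨f, d, hf, hs⟩ := s.2
    refine ⟨d + 1, ?_⟩
    ext1
    rw [AddSubmonoidClass.coe_finsetSum]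
    simp only [coe_liftLinear _ _ hs]
    rw [← map_sum, ← hs]
    congr 1
    ext1 i
    rw [Finset.sum_apply]
    conv_lhs => rw [← sum_homogeneousComponent (f i)]
    refine Finset.sum_subset (Finset.range_subset_range.2 (by have := hf i; omega)) fun e _ he => ?_
    exact homogeneousComponent_eq_zero _ _ (by simpa using he)
  D_pr v n e s := by
    obtain ⟨f, d, hf, hs⟩ := s.2
    ext1
    rw [coe_liftLinear _ _ (coe_liftLinear _ _ hs).symm,
      coe_liftLinear _ _ (coe_liftLinear _ _ hs).symm]
    simp only [homogeneousComponent_hasse]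

end UltraProd

end

section

open Filter MvPolynomial

namespace UltraProd

variable {U : Ultrafilter ℕ} {k : ℕ → Type u} [∀ i, Field (k i)] {N : ℕ → ℕ}

lemma coe_D {s : boundedDegree U k N} {f : ∀ i, MvPolynomial (Fin (N i)) (k i)}
    (hs : mk U f = s) (v : ∀ i, Fin (N i) → k i) (n : ℕ) :
    ((hasseGraded U k N).D v n s).1 = mk U fun i => hasse (v i) n (f i) :=
  coe_liftLinear (fun i => hasse (v i) n) (fun _ => totalDegree_hasse_le _ _) hs

lemma coe_pr {s : boundedDegree U k N} {f : ∀ i, MvPolynomial (Fin (N i)) (k i)}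
    (hs : mk U f = s) (e : ℕ) :
    ((hasseGraded U k N).pr e s).1 = mk U fun i => homogeneousComponent e (f i) :=
  coe_liftLinear (fun _ => homogeneousComponent e)
    (fun _ => totalDegree_homogeneousComponent_le _) hs

lemma eventually_forall_lt {P : ℕ → ℕ → Prop} {n : ℕ} (h : ∀ j < n, ∀ᶠ i in U, P i j) :
    ∀ᶠ i in U, ∀ j < n, P i j :=
  (Filter.eventually_all_finite (Set.finite_lt_nat n)).2 h

lemma killed_iff {s : boundedDegree U k N} {f : ∀ i, MvPolynomial (Fin (N i)) (k i)}
    (hs : mk U f = s) (h : (hasseGraded U k N).Killed s) :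
    ∀ᶠ i in U, ∀ j, pderiv j (f i) = 0 := by
  classical
  by_contra H
  rw [← Ultrafilter.eventually_not] at H
  have : ∀ i, ∃ v : Fin (N i) → k i, (¬ ∀ j, pderiv j (f i) = 0) → hasse v 1 (f i) ≠ 0 := by
    intro i
    by_cases hi : ∀ j, pderiv j (f i) = 0
    · exact ⟨0, fun h => absurd hi h⟩
    · obtain ⟨j, hj⟩ := not_forall.1 hi
      exact ⟨Pi.single j 1, fun _ => by rwa [hasse_single]⟩
  choose v hv using this
  have h1 := congrArg Subtype.val (h v)
  have h2 := (coe_D hs v 1).symm.trans h1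
  rw [ZeroMemClass.coe_zero, mk_eq_zero] at h2
  obtain ⟨i, hi, hi'⟩ := (h2.and H).exists
  exact hv i hi' hi

lemma degLE_iff {s : boundedDegree U k N} {f : ∀ i, MvPolynomial (Fin (N i)) (k i)} {d : ℕ}
    (hf : ∀ i, (f i).totalDegree ≤ d) (hs : mk U f = s) {e : ℕ}
    (h : (hasseGraded U k N).DegLE e s) : ∀ᶠ i in U, (f i).totalDegree ≤ e := by
  have h1 : ∀ᶠ i in U, ∀ j < d + 1, e < j → homogeneousComponent j (f i) = 0 := by
    refine eventually_forall_lt fun j _ => ?_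
    by_cases hj : e < j
    · have h2 := congrArg Subtype.val (h j hj)
      have h3 := (coe_pr hs j).symm.trans h2
      rw [ZeroMemClass.coe_zero, mk_eq_zero] at h3
      filter_upwards [h3] with i hi _
      exact hi
    · exact Eventually.of_forall fun i h => absurd h hj
  filter_upwards [h1] with i hi
  refine totalDegree_le_of_homogeneousComponent fun j hj => ?_
  by_cases hjd : j < d + 1
  · exact hi j hjd hj
  · exact homogeneousComponent_eq_zero _ _ (by have := hf i; omega)

lemma degLE_ofBounded {f : ∀ i, MvPolynomial (Fin (N i)) (k i)} {e : ℕ}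
    (hf : ∀ i, (f i).totalDegree ≤ e) :
    (hasseGraded U k N).DegLE e (ofBounded f e hf) := by
  intro j hj
  ext1
  refine (coe_pr (f := f) rfl j).trans ?_
  rw [ZeroMemClass.coe_zero, mk_eq_zero]
  exact Eventually.of_forall fun i => homogeneousComponent_eq_zero _ _ ((hf i).trans_lt hj)

lemma natCast_eq_mk (n : ℕ) : (n : UltraProd U k) = mk U fun i => (n : k i) :=
  (map_natCast (mk U) n).symm

lemma charP_of_prime {F : Type*} [Field F] {p : ℕ} (hp : p.Prime) (h : (p : F) = 0) :
    CharP F p := by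
  obtain ⟨q, hq⟩ := CharP.exists F
  have : q = p := by
    rcases (Nat.dvd_prime hp).1 ((CharP.cast_eq_zero_iff F q p).1 h) with h1 | h1
    · exact absurd h1 (CharP.char_ne_one F q)
    · exact h1
  exact this ▸ hq

lemma charP {p : ℕ} (hp : p.Prime) (h : ∀ᶠ i in U, (p : k i) = 0) : CharP (UltraProd U k) p := by
  refine charP_of_prime hp ?_
  rw [natCast_eq_mk, mk_eq_zero]
  exact h

lemma charZero (h : ∀ p : ℕ, p.Prime → ∀ᶠ i in U, (p : k i) ≠ 0) : CharZero (UltraProd U k) := by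
  obtain ⟨q, hq⟩ := CharP.exists (UltraProd U k)
  rcases CharP.char_is_prime_or_zero (UltraProd U k) q with hp | rfl
  · have h1 := CharP.cast_eq_zero (UltraProd U k) q
    rw [natCast_eq_mk, mk_eq_zero] at h1
    obtain ⟨i, hi, hi'⟩ := (h1.and (h q hp)).exists
    exact absurd hi hi'
  · exact CharP.charP_to_charZero _

lemma exists_eq_algebraMap_of_killed (h : ∀ p : ℕ, p.Prime → ∀ᶠ i in U, (p : k i) ≠ 0)
    (s : boundedDegree U k N) (hk : (hasseGraded U k N).Killed s) :
    ∃ c, s = algebraMap (UltraProd U k) _ c := by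
  obtain ⟨f, d, hf, hs⟩ := s.2
  have hcz := charZero h
  refine ⟨mk U fun i => coeff 0 (f i), ?_⟩
  ext1
  refine hs.symm.trans (Eq.trans ?_ (algebraMap_mk U k N _).symm)
  rw [mk_eq_mk]
  have h1 : ∀ᶠ i in U, ∀ n < d + 1, 1 ≤ n → (n : k i) ≠ 0 := by
    refine eventually_forall_lt fun n _ => ?_
    by_cases hn : 1 ≤ n
    · have : (n : UltraProd U k) ≠ 0 := Nat.cast_ne_zero.2 (by omega)
      rw [natCast_eq_mk, ne_eq, mk_eq_zero, ← Ultrafilter.eventually_not] at this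
      filter_upwards [this] with i hi _
      exact hi
    · exact Eventually.of_forall fun i h => absurd h hn
  filter_upwards [h1, killed_iff hs hk] with i hi hki
  exact eq_C_of_pderiv_eq_zero hki fun n hn hnd => hi n (by have := hf i; omega) hn

variable [∀ i, IsAlgClosed (k i)]

lemma frobeniusData {p : ℕ} (hp : p.Prime) (h : ∀ᶠ i in U, (p : k i) = 0) :
    (hasseGraded U k N).FrobeniusData p where
  frob v n s := by
    obtain ⟨f, d, hf, hs⟩ := s.2
    ext1
    rw [SubmonoidClass.coe_pow]
    refine (coe_D (f := f ^ p) (by rw [map_pow, hs]; rfl) v _).trans ?_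
    refine Eq.trans ?_ (congrArg (· ^ p) (coe_D hs v n).symm)
    rw [← map_pow, mk_eq_mk]
    filter_upwards [h] with i hi
    have := charP_of_prime hp hi
    rw [Pi.pow_apply, Pi.pow_apply, hasse_pow_char hp, if_pos (dvd_mul_right _ _),
      Nat.mul_div_cancel_left _ hp.pos]
  root e s hk he := by
    obtain ⟨f, d, hf, hs⟩ := s.2
    have : ∀ i, ∃ g : MvPolynomial (Fin (N i)) (k i), g.totalDegree ≤ e / p ∧
        ((p : k i) = 0 → (∀ j, pderiv j (f i) = 0) → (f i).totalDegree ≤ e → g ^ p = f i) := by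
      intro i
      by_cases hi : (p : k i) = 0 ∧ (∀ j, pderiv j (f i) = 0) ∧ (f i).totalDegree ≤ e
      · have := charP_of_prime hp hi.1
        have := Fact.mk hp
        obtain ⟨g, hg, hgd⟩ := exists_pow_eq_of_pderiv_eq_zero hp hi.2.1
        exact ⟨g, hgd.trans (Nat.div_le_div_right hi.2.2), fun _ _ _ => hg⟩
      · exact ⟨0, by simp, fun h1 h2 h3 => absurd ⟨h1, h2, h3⟩ hi⟩
    choose g hgd hg using this
    refine ⟨ofBounded g (e / p) hgd, degLE_ofBounded hgd, ?_⟩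
    ext1
    rw [SubmonoidClass.coe_pow]
    change mk U g ^ p = s
    rw [← map_pow, ← hs, mk_eq_mk]
    filter_upwards [h, killed_iff hs hk, degLE_iff hf hs he] with i h1 h2 h3
    exact hg i h1 h2 h3

variable (U k N) in
/-- The elements of bounded degree form a polynomial ring. -/
theorem exists_generators : ∃ (ι : Type u) (E : (hasseGraded U k N).Generators ι),
    AlgebraicIndependent (UltraProd U k) E.gen := by
  by_cases h : ∃ p : ℕ, p.Prime ∧ ∀ᶠ i in U, (p : k i) = 0
  · obtain ⟨p, hp, h⟩ := h
    have := charP hp h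
    exact HasseGraded.exists_generators_of_frobeniusData _ hp (frobeniusData hp h)
  · replace h : ∀ p : ℕ, p.Prime → ∀ᶠ i in U, (p : k i) ≠ 0 := fun p hp =>
      Ultrafilter.eventually_not.2 fun hp' => h ⟨p, hp, hp'⟩
    have := charZero h
    refine HasseGraded.exists_generators_of_charZero _ (exists_eq_algebraMap_of_killed h) ?_
    intro c
    obtain ⟨c, rfl⟩ := mk_surjective c
    choose r hr using fun i => IsAlgClosed.exists_pow_nat_eq (c i) (n := 2) (by norm_num)
    exact ⟨mk U r, by rw [← map_pow]; exact congrArg _ (_root_.funext hr)⟩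

end UltraProd

end

section

open Filter MvPolynomial

namespace UltraProd

variable {U : Ultrafilter ℕ} {k : ℕ → Type u} [∀ i, Field (k i)] {N : ℕ → ℕ}

lemma exists_isHomogeneous_rep {s : boundedDegree U k N} {e : ℕ}
    (hs : (hasseGraded U k N).pr e s = s) :
    ∃ f : ∀ i, MvPolynomial (Fin (N i)) (k i), (∀ i, (f i).IsHomogeneous e) ∧ mk U f = s := by
  obtain ⟨f, d, hf, hfs⟩ := s.2
  refine ⟨_, fun i => homogeneousComponent_isHomogeneous e (f i), ?_⟩
  rw [← coe_pr hfs, hs]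

lemma exists_bounded_rep (s : boundedDegree U k N) :
    ∃ f : ∀ i, MvPolynomial (Fin (N i)) (k i), (∃ d, ∀ i, (f i).totalDegree ≤ d) ∧ mk U f = s := by
  obtain ⟨f, d, hf, hfs⟩ := s.2
  exact ⟨f, ⟨d, hf⟩, hfs⟩

variable [∀ i, Infinite (k i)]

/-- Finitely many of the generators of the ring of elements of bounded degree specialize to
families of parameters. -/
theorem exists_hasParameters {ι : Type u} (E : (hasseGraded U k N).Generators ι)
    (hE : AlgebraicIndependent (UltraProd U k) E.gen) (c : ℕ) (j : Fin c → ι)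
    (hj : Function.Injective j) (Y : Fin c → ∀ i, MvPolynomial (Fin (N i)) (k i))
    (hY : ∀ l i, (Y l i).IsHomogeneous (E.deg (j l))) (hYj : ∀ l, mk U (Y l) = E.gen (j l)) :
    ∃ e, ∀ᶠ i in U, HasParameters (fun l => Y l i) e := by
  induction c with
  | zero => exact ⟨1, Eventually.of_forall fun i => hasParameters_zero _⟩
  | succ c ih =>
    obtain ⟨e, he⟩ := ih (fun l => j l.castSucc) (hj.comp (Fin.castSucc_injective c))
      (fun l => Y l.castSucc) (fun l => hY _) (fun l => hYj _)
    set D := E.deg (j (Fin.last c)) with hD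
    refine ⟨e * (e * D), ?_⟩
    by_contra H
    rw [← Ultrafilter.eventually_not] at H
    have key : ∀ i, ∃ g : MvPolynomial (Fin (N i)) (k i), g.totalDegree ≤ e * D ∧
        (HasParameters (fun l : Fin c => Y l.castSucc i) e →
          ¬ HasParameters (fun l => Y l i) (e * (e * D)) →
          Y (Fin.last c) i * g ∈ Ideal.span (Set.range fun l : Fin c => Y l.castSucc i) ∧
          g ∉ Ideal.span (Set.range fun l : Fin c => Y l.castSucc i)) := by
      intro i
      by_contra hcon
      push Not at hcon
      obtain ⟨h1, h2, -⟩ := hcon 0 (by simp)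
      refine h2 ?_
      have h3 := h1.snoc (E.deg_pos (j (Fin.last c))) (hY (Fin.last c) i) fun g hg hgs => by
        obtain ⟨-, -, h4⟩ := hcon g hg
        exact h4 hgs
      rw [← hD] at h3
      convert h3 using 1
      exact (Fin.snoc_init_self fun l => Y l i).symm
    choose g hgd hg using key
    have hg' : ∀ᶠ i in U,
        Y (Fin.last c) i * g i ∈ Ideal.span (Set.range fun l : Fin c => Y l.castSucc i) ∧
        g i ∉ Ideal.span (Set.range fun l : Fin c => Y l.castSucc i) := by
      filter_upwards [he, H] with i h1 h2
      exact hg i h1 h2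
    have hcoef : ∀ i, ∃ a : Fin c → MvPolynomial (Fin (N i)) (k i),
        (∀ l, (a l).totalDegree ≤ D + e * D) ∧
        (Y (Fin.last c) i * g i ∈ Ideal.span (Set.range fun l : Fin c => Y l.castSucc i) →
          ∑ l, a l * Y l.castSucc i = Y (Fin.last c) i * g i) := by
      intro i
      by_cases hi : Y (Fin.last c) i * g i ∈ Ideal.span (Set.range fun l : Fin c => Y l.castSucc i)
      · obtain ⟨a, ha, hsum⟩ := exists_sum_mul_of_mem_span (fun l => ⟨_, hY _ i⟩) hi
        refine ⟨a, fun l => (ha l).trans ((totalDegree_mul _ _).trans ?_), fun _ => hsum⟩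
        exact Nat.add_le_add (hY _ i).totalDegree_le (hgd i)
      · exact ⟨0, by simp, fun h => absurd h hi⟩
    choose a had hasum using hcoef
    let γ : boundedDegree U k N := ofBounded g _ hgd
    have hmul : E.gen (j (Fin.last c)) * γ =
        ∑ l : Fin c, ofBounded (fun i => a i l) _ (fun i => had i l) * E.gen (j l.castSucc) := by
      ext1
      rw [AddSubmonoidClass.coe_finsetSum]
      simp only [MulMemClass.coe_mul, ← hYj]
      change mk U _ * mk U g = ∑ l : Fin c, mk U _ * mk U _
      simp only [← map_mul, ← map_sum]
      rw [mk_eq_mk]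
      filter_upwards [hg'] with i hi
      rw [Finset.sum_apply]
      exact (hasum i hi.1).symm
    have hT : j (Fin.last c) ∉ Set.range fun l : Fin c => j l.castSucc := by
      rintro ⟨l, hl⟩
      exact (Fin.castSucc_lt_last l).ne (hj hl)
    have hspan : γ ∈ Ideal.span (Set.range fun l : Fin c => E.gen (j l.castSucc)) := by
      have h1 := hE.mem_span_of_mul_mem E.adjoin_eq_top hT (g := γ)
      rw [← Set.range_comp] at h1
      refine h1 ?_
      rw [hmul]
      exact Ideal.sum_mem _ fun l _ => Ideal.mul_mem_left _ _ (Ideal.subset_span ⟨l, rfl⟩)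
    obtain ⟨q, hq⟩ := Ideal.mem_span_range_iff_exists_fun.1 hspan
    choose r _ hr using fun l => exists_bounded_rep (q l)
    have h1 := congrArg Subtype.val hq
    rw [AddSubmonoidClass.coe_finsetSum] at h1
    simp only [MulMemClass.coe_mul, ← hYj, ← hr] at h1
    replace h1 : _ = mk U g := h1
    simp only [← map_mul, ← map_sum] at h1
    rw [mk_eq_mk] at h1
    obtain ⟨i, hi, hi'⟩ := (h1.and hg').exists
    refine hi'.2 ?_
    rw [← hi, Finset.sum_apply]
    exact Ideal.sum_mem _ fun l _ => Ideal.mul_mem_left _ _ (Ideal.subset_span ⟨l, rfl⟩)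

end UltraProd

end

section

open Filter MvPolynomial

section Exact

variable {R C : Type u} [CommRing R] [CommRing C]

lemma RingHom.Flat.exact_mulVec {φ : R →+* C} (hφ : φ.Flat) {a b c : ℕ}
    {A : Matrix (Fin a) (Fin b) R} {B : Matrix (Fin b) (Fin c) R}
    (h : LinearMap.ker A.mulVecLin = LinearMap.range B.mulVecLin) :
    LinearMap.ker (A.map φ).mulVecLin = LinearMap.range (B.map φ).mulVecLin := by
  algebraize [φ]
  refine le_antisymm (fun x hx => ?_) ?_
  · replace hx : (A.map φ).mulVec x = 0 := hx
    have hxA : (Fintype.linearCombination R x) ∘ₗ A.transpose.mulVecLin = 0 := by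
      ext i
      have := congrFun hx i
      simp only [Matrix.mulVec, dotProduct, Matrix.map_apply, Pi.zero_apply] at this
      simp [Fintype.linearCombination_apply, Algebra.smul_def]
      exact this
    obtain ⟨κ, f, y, hxy, hf⟩ := Module.Flat.exists_factorization_of_comp_eq_zero_of_free hxA
    let w : Fin κ → Fin b → R := fun l s => f (Pi.single s 1) l
    have hw : ∀ l, w l ∈ LinearMap.ker A.mulVecLin := by
      intro l
      rw [LinearMap.mem_ker]
      ext r
      have h1 := congrArg (fun z => z l) (LinearMap.congr_fun hf (Pi.single r 1))
      simp only [LinearMap.comp_apply, Matrix.mulVecLin_apply, Matrix.mulVec_single_one,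
        LinearMap.zero_apply, Finsupp.zero_apply] at h1
      have h2 : A.transpose.col r = ∑ s, A r s • (Pi.single s 1 : Fin b → R) := by
        ext s
        simp [Finset.sum_apply, Pi.single_apply]
      rw [h2, map_sum, Finsupp.finsetSum_apply] at h1
      simp only [map_smul, Finsupp.smul_apply, smul_eq_mul] at h1
      exact h1
    have hx' : x = ∑ l, y (Finsupp.single l 1) • fun s => φ (w l s) := by
      ext s
      have h1 := LinearMap.congr_fun hxy (Pi.single s 1)
      rw [Fintype.linearCombination_apply_single, one_smul] at h1
      rw [h1, LinearMap.comp_apply, ← Finsupp.univ_sum_single (f (Pi.single s 1)), map_sum,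
        Finset.sum_apply]
      refine Finset.sum_congr rfl fun l _ => ?_
      rw [← Finsupp.smul_single_one, map_smul, Algebra.smul_def, mul_comm]
      rfl
    rw [hx']
    refine Submodule.sum_mem _ fun l _ => Submodule.smul_mem _ _ ?_
    obtain ⟨z, hz⟩ := h ▸ hw l
    refine ⟨fun t => φ (z t), ?_⟩
    rw [← hz]
    exact _root_.funext fun i => (RingHom.map_mulVec φ B z i).symm
  · rintro _ ⟨w, rfl⟩
    have hAB : A * B = 0 := by
      refine Matrix.ext_of_mulVec_single fun t => ?_
      rw [← Matrix.mulVec_mulVec, Matrix.zero_mulVec]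
      exact LinearMap.mem_ker.1 (h ▸ LinearMap.mem_range_self B.mulVecLin (Pi.single t 1))
    change (A.map φ).mulVec ((B.map φ).mulVec w) = 0
    rw [Matrix.mulVec_mulVec, ← Matrix.map_mul, hAB]
    simp

end Exact

end

section

open Filter

namespace UltraProd

section Matrix

variable {U : Ultrafilter ℕ} {B : ℕ → Type u} [∀ i, CommRing (B i)] {a b c : ℕ}

/-- The matrix over an ultraproduct represented by a sequence of matrices. -/
def mkMatrix (U : Ultrafilter ℕ) (A : ∀ i, Matrix (Fin a) (Fin b) (B i)) :
    Matrix (Fin a) (Fin b) (UltraProd U B) :=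
  Matrix.of fun r s => mk U fun i => A i r s

lemma mkMatrix_mulVec (A : ∀ i, Matrix (Fin a) (Fin b) (B i)) (v : ∀ i, Fin b → B i) :
    (mkMatrix U A).mulVec (fun s => mk U fun i => v i s) =
      fun r => mk U fun i => (A i).mulVec (v i) r := by
  ext r
  have : (fun i => (A i).mulVec (v i) r) = ∑ s, (fun i => A i r s) * fun i => v i s := by
    ext i
    rw [Finset.sum_apply]
    rfl
  rw [this, map_sum]
  simp only [map_mul]
  rfl

lemma mk_vec_eq_iff {v w : ∀ i, Fin a → B i} :
    ((fun r => mk U fun i => v i r) = fun r => mk U fun i => w i r) ↔ ∀ᶠ i in U, v i = w i := by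
  simp only [funext_iff, eventually_all, mk_eq_mk]

lemma exists_vec_rep (v : Fin a → UltraProd U B) :
    ∃ w : ∀ i, Fin a → B i, (fun r => mk U fun i => w i r) = v := by
  choose w hw using fun r => mk_surjective (v r)
  exact ⟨fun i r => w r i, funext hw⟩

lemma eventually_exact {A : ∀ i, Matrix (Fin a) (Fin b) (B i)}
    {A' : ∀ i, Matrix (Fin b) (Fin c) (B i)}
    (h : LinearMap.ker (mkMatrix U A).mulVecLin = LinearMap.range (mkMatrix U A').mulVecLin) :
    ∀ᶠ i in U, LinearMap.ker (A i).mulVecLin = LinearMap.range (A' i).mulVecLin := by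
  have h1 : ∀ᶠ i in U, ∀ v, (A i).mulVec v = 0 → ∃ w, (A' i).mulVec w = v := by
    by_contra hcon
    rw [← Ultrafilter.eventually_not] at hcon
    have hbad : ∀ i, ∃ v, (¬ ∀ v, (A i).mulVec v = 0 → ∃ w, (A' i).mulVec w = v) →
        (A i).mulVec v = 0 ∧ ¬ ∃ w, (A' i).mulVec w = v := by
      intro i
      by_cases hi : ∀ v, (A i).mulVec v = 0 → ∃ w, (A' i).mulVec w = v
      · exact ⟨0, fun h => absurd hi h⟩
      · push Not at hi
        obtain ⟨v, hv, hv'⟩ := hi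
        exact ⟨v, fun _ => ⟨hv, by push Not; exact hv'⟩⟩
    choose v hv using hbad
    have hker : (fun s => mk U fun i => v i s) ∈ LinearMap.ker (mkMatrix U A).mulVecLin := by
      rw [LinearMap.mem_ker, Matrix.mulVecLin_apply, mkMatrix_mulVec]
      refine (mk_vec_eq_iff (w := fun _ => 0)).2 ?_
      filter_upwards [hcon] with i hi
      exact (hv i hi).1
    rw [h] at hker
    obtain ⟨w, hw⟩ := hker
    obtain ⟨w, rfl⟩ := exists_vec_rep w
    rw [Matrix.mulVecLin_apply, mkMatrix_mulVec, mk_vec_eq_iff] at hw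
    obtain ⟨i, hi, hi'⟩ := (hw.and hcon).exists
    exact (hv i hi').2 ⟨_, hi⟩
  have h2 : ∀ᶠ i in U, ∀ w, (A i).mulVec ((A' i).mulVec w) = 0 := by
    by_contra hcon
    rw [← Ultrafilter.eventually_not] at hcon
    have hbad : ∀ i, ∃ w, (¬ ∀ w, (A i).mulVec ((A' i).mulVec w) = 0) →
        (A i).mulVec ((A' i).mulVec w) ≠ 0 := by
      intro i
      by_cases hi : ∀ w, (A i).mulVec ((A' i).mulVec w) = 0
      · exact ⟨0, fun h => absurd hi h⟩
      · push Not at hi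
        obtain ⟨w, hw⟩ := hi
        exact ⟨w, fun _ => hw⟩
    choose w hw using hbad
    have hker : (mkMatrix U A').mulVec (fun s => mk U fun i => w i s) ∈
        LinearMap.ker (mkMatrix U A).mulVecLin := by
      rw [h]
      exact ⟨_, rfl⟩
    rw [mkMatrix_mulVec, LinearMap.mem_ker, Matrix.mulVecLin_apply, mkMatrix_mulVec] at hker
    have hker' := (mk_vec_eq_iff (w := fun _ => 0)).1 hker
    obtain ⟨i, hi, hi'⟩ := (hker'.and hcon).exists
    exact hw i hi' hi
  filter_upwards [h1, h2] with i hi1 hi2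
  refine le_antisymm (fun v hv => hi1 v hv) ?_
  rintro _ ⟨w, rfl⟩
  exact hi2 w

end Matrix

end UltraProd

namespace HasFiniteFreeResolution

variable {R : Type u} [CommRing R]

/-- A finite free resolution given by matrices. -/
lemma exists_matrices {k : ℕ} {M : Type u} [AddCommGroup M] [Module R M]
    (h : HasFiniteFreeResolution R k M) :
    ∃ (b : ℕ → ℕ) (A : ∀ i, Matrix (Fin (b i)) (Fin (b (i + 1))) R) (g : (Fin (b 0) → R) →ₗ[R] M),
      Function.Surjective g ∧ LinearMap.ker g = LinearMap.range (A 0).mulVecLin ∧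
      (∀ i, LinearMap.ker (A i).mulVecLin = LinearMap.range (A (i + 1)).mulVecLin) ∧
      ∀ i, k ≤ i → b i = 0 := by
  induction k generalizing M with
  | zero =>
    have : Subsingleton M := h
    exact ⟨fun _ => 0, fun _ => 0, 0, fun m => ⟨0, Subsingleton.elim _ _⟩,
      Subsingleton.elim _ _, fun _ => Subsingleton.elim _ _, fun _ _ => rfl⟩
  | succ k ih =>
    obtain ⟨b₀, f, hf, hk⟩ := h
    obtain ⟨b, A, g, hg, hg0, hA, hb⟩ := ih hk
    set G : (Fin (b 0) → R) →ₗ[R] (Fin b₀ → R) := (LinearMap.ker f).subtype ∘ₗ g with hG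
    have hmat : (LinearMap.toMatrix' G).mulVecLin = G := Matrix.toLin'_toMatrix' G
    refine ⟨fun i => Nat.casesOn i b₀ b, fun i => match i with
      | 0 => LinearMap.toMatrix' G
      | i + 1 => A i, f, hf, ?_, ?_, ?_⟩
    · change _ = LinearMap.range (LinearMap.toMatrix' G).mulVecLin
      rw [hmat, hG, LinearMap.range_comp, LinearMap.range_eq_top.2 hg, Submodule.map_top,
        Submodule.range_subtype]
    · rintro (_ | i)
      · change LinearMap.ker (LinearMap.toMatrix' G).mulVecLin = LinearMap.range (A 0).mulVecLin
        rw [hmat, hG, LinearMap.ker_comp_of_ker_eq_bot _ (Submodule.ker_subtype _), hg0]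
      · exact hA i
    · rintro (_ | i) hi
      · omega
      · exact hb i (by omega)

end HasFiniteFreeResolution

end

section

open Filter MvPolynomial

section Ranges

variable {R : Type*} [CommRing R] {m n l : ℕ}

lemma Matrix.range_mulVecLin_mul_le (A : Matrix (Fin m) (Fin n) R) (B : Matrix (Fin n) (Fin l) R) :
    LinearMap.range (A * B).mulVecLin ≤ LinearMap.range A.mulVecLin := by
  rw [Matrix.mulVecLin_mul]
  exact LinearMap.range_comp_le_range _ _

lemma Matrix.exists_eq_mul_of_range_le {A : Matrix (Fin m) (Fin n) R} {B : Matrix (Fin m) (Fin l) R}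
    (h : LinearMap.range B.mulVecLin ≤ LinearMap.range A.mulVecLin) :
    ∃ Q : Matrix (Fin n) (Fin l) R, B = A * Q := by
  choose q hq using fun t : Fin l => h (LinearMap.mem_range_self B.mulVecLin (Pi.single t 1))
  refine ⟨Matrix.of fun s t => q t s, Matrix.ext_of_mulVec_single fun t => ?_⟩
  rw [← Matrix.mulVec_mulVec, Matrix.mulVec_single_one (Matrix.of _)]
  exact (hq t).symm

end Ranges

lemma Matrix.exists_resolution {K : Type u} [Field K] {c m n : ℕ}
    (P : Matrix (Fin m) (Fin n) (MvPolynomial (Fin c) K)) :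
    ∃ (k : ℕ) (b : ℕ → ℕ) (A : ∀ i, Matrix (Fin (b i)) (Fin (b (i + 1))) (MvPolynomial (Fin c) K))
      (G : Matrix (Fin m) (Fin (b 0)) (MvPolynomial (Fin c) K)),
      LinearMap.range G.mulVecLin = LinearMap.range P.mulVecLin ∧
      LinearMap.ker G.mulVecLin = LinearMap.range (A 0).mulVecLin ∧
      (∀ i, LinearMap.ker (A i).mulVecLin = LinearMap.range (A (i + 1)).mulVecLin) ∧
      ∀ i, k ≤ i → b i = 0 := by
  obtain ⟨k, hk⟩ := HasFiniteFreeResolution.mvPolynomial (K := K) c (LinearMap.range P.mulVecLin)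
  obtain ⟨b, A, g, hg, hg0, hA, hb⟩ := hk.exists_matrices
  have hmat : (LinearMap.toMatrix' ((LinearMap.range P.mulVecLin).subtype ∘ₗ g)).mulVecLin =
      (LinearMap.range P.mulVecLin).subtype ∘ₗ g := Matrix.toLin'_toMatrix' _
  refine ⟨k, b, A, LinearMap.toMatrix' ((LinearMap.range P.mulVecLin).subtype ∘ₗ g), ?_, ?_, hA, hb⟩
  · rw [hmat, LinearMap.range_comp, LinearMap.range_eq_top.2 hg, Submodule.map_top,
      Submodule.range_subtype]
  · rw [hmat, LinearMap.ker_comp_of_ker_eq_bot _ (Submodule.ker_subtype _), hg0]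

namespace UltraProd

variable {U : Ultrafilter ℕ} {k : ℕ → Type u} [∀ i, Field (k i)] {N : ℕ → ℕ} {c : ℕ}

/-- Representatives of the image of a polynomial over an ultraproduct. -/
noncomputable def rep (p : MvPolynomial (Fin c) (UltraProd U k)) (i : ℕ) :
    MvPolynomial (Fin c) (k i) :=
  (mk_surjective (ofMvPolynomial U k (Fin c) p)).choose i

lemma mk_rep (p : MvPolynomial (Fin c) (UltraProd U k)) :
    mk U (rep p) = ofMvPolynomial U k (Fin c) p :=
  (mk_surjective (ofMvPolynomial U k (Fin c) p)).choose_spec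

lemma eventually_exact_rep [∀ i, Infinite (k i)] {a b d : ℕ}
    {A : Matrix (Fin a) (Fin b) (MvPolynomial (Fin c) (UltraProd U k))}
    {A' : Matrix (Fin b) (Fin d) (MvPolynomial (Fin c) (UltraProd U k))}
    (h : LinearMap.ker A.mulVecLin = LinearMap.range A'.mulVecLin) :
    ∀ᶠ i in U, LinearMap.ker (A.map fun p => rep p i).mulVecLin =
      LinearMap.range (A'.map fun p => rep p i).mulVecLin := by
  have hmap : ∀ {a b : ℕ} (A : Matrix (Fin a) (Fin b) (MvPolynomial (Fin c) (UltraProd U k))),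
      mkMatrix U (fun i => A.map fun p => rep p i) = A.map (ofMvPolynomial U k (Fin c)) := by
    intro a b A
    ext r s
    exact mk_rep (A r s)
  refine eventually_exact ?_
  rw [hmap, hmap]
  exact (flat_ofMvPolynomial c).exact_mulVec h

variable (Y : Fin c → ∀ i, MvPolynomial (Fin (N i)) (k i))

/-- The specializations of a polynomial over an ultraproduct. -/
noncomputable def spec (i : ℕ) (p : MvPolynomial (Fin c) (UltraProd U k)) :
    MvPolynomial (Fin (N i)) (k i) :=
  aeval (fun l => Y l i) (rep p i)

lemma mk_spec (p : MvPolynomial (Fin c) (UltraProd U k)) :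
    mk U (fun i => spec Y i p) = aeval (fun l => mk U (Y l)) p := by
  have h : (map U fun i => (aeval fun l => Y l i : MvPolynomial (Fin c) (k i) →ₐ[k i] _).toRingHom).comp
      (ofMvPolynomial U k (Fin c)) = (aeval fun l => mk U (Y l)).toRingHom := by
    refine ringHom_ext (fun a => ?_) fun l => ?_
    · obtain ⟨a, rfl⟩ := mk_surjective a
      rw [RingHom.comp_apply, ofMvPolynomial_C, map_mk]
      simp only [AlgHom.toRingHom_eq_coe, RingHom.coe_coe, aeval_C]
      rfl
    · rw [RingHom.comp_apply, ofMvPolynomial_X, map_mk]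
      simp only [AlgHom.toRingHom_eq_coe, RingHom.coe_coe, aeval_X]
  have h' := RingHom.congr_fun h p
  rw [RingHom.comp_apply, ← mk_rep, map_mk] at h'
  exact h'

lemma eventually_spec_mul {a b d : ℕ}
    (A : Matrix (Fin a) (Fin b) (MvPolynomial (Fin c) (UltraProd U k)))
    (A' : Matrix (Fin b) (Fin d) (MvPolynomial (Fin c) (UltraProd U k))) :
    ∀ᶠ i in U, (A * A').map (spec Y i) = A.map (spec Y i) * A'.map (spec Y i) := by
  simp only [← Matrix.ext_iff, eventually_all]
  intro r t
  have h : mk U (fun i => spec Y i ((A * A') r t)) =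
      mk U (∑ s, (fun i => spec Y i (A r s)) * fun i => spec Y i (A' s t)) := by
    rw [map_sum, mk_spec, Matrix.mul_apply, map_sum]
    exact Finset.sum_congr rfl fun s _ => by rw [map_mul, map_mul, mk_spec, mk_spec]
  filter_upwards [mk_eq_mk.1 h] with i hi
  rw [Matrix.map_apply, hi, Finset.sum_apply]
  rfl

lemma eventually_range_spec_eq {a b d : ℕ}
    {A : Matrix (Fin a) (Fin b) (MvPolynomial (Fin c) (UltraProd U k))}
    {A' : Matrix (Fin a) (Fin d) (MvPolynomial (Fin c) (UltraProd U k))}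
    (h : LinearMap.range A.mulVecLin = LinearMap.range A'.mulVecLin) :
    ∀ᶠ i in U, LinearMap.range (A.map (spec Y i)).mulVecLin =
      LinearMap.range (A'.map (spec Y i)).mulVecLin := by
  obtain ⟨Q, hQ⟩ := Matrix.exists_eq_mul_of_range_le h.le
  obtain ⟨Q', hQ'⟩ := Matrix.exists_eq_mul_of_range_le h.ge
  have h1 := eventually_spec_mul Y A' Q
  have h2 := eventually_spec_mul Y A Q'
  rw [← hQ] at h1
  rw [← hQ'] at h2
  filter_upwards [h1, h2] with i hi1 hi2
  refine le_antisymm ?_ ?_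
  · rw [hi1]
    exact Matrix.range_mulVecLin_mul_le _ _
  · rw [hi2]
    exact Matrix.range_mulVecLin_mul_le _ _

lemma exists_totalDegree_spec_le (hY : ∀ l, mk U (Y l) ∈ boundedDegree U k N)
    (p : MvPolynomial (Fin c) (UltraProd U k)) : ∃ d, ∀ᶠ i in U, (spec Y i p).totalDegree ≤ d := by
  have hmem : mk U (fun i => spec Y i p) ∈ boundedDegree U k N := by
    rw [mk_spec]
    have := ((aeval fun l => (⟨mk U (Y l), hY l⟩ : boundedDegree U k N)) p).2
    rwa [← Subalgebra.coe_val, comp_aeval_apply] at this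
  obtain ⟨f, ⟨d, hd⟩, hf⟩ := exists_bounded_rep ⟨_, hmem⟩
  refine ⟨d, ?_⟩
  filter_upwards [mk_eq_mk.1 hf] with i hi
  rw [← hi]
  exact hd i

lemma exists_totalDegree_map_spec_le (hY : ∀ l, mk U (Y l) ∈ boundedDegree U k N) {a b : ℕ}
    (A : Matrix (Fin a) (Fin b) (MvPolynomial (Fin c) (UltraProd U k))) :
    ∃ d, ∀ᶠ i in U, ∀ r s, ((A.map (spec Y i)) r s).totalDegree ≤ d := by
  choose d hd using fun r s => exists_totalDegree_spec_le Y hY (A r s)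
  refine ⟨∑ r, ∑ s, d r s, ?_⟩
  simp only [eventually_all]
  intro r s
  filter_upwards [hd r s] with i hi
  refine hi.trans ((Finset.single_le_sum (f := fun s => d r s) (fun _ _ => Nat.zero_le _)
    (Finset.mem_univ s)).trans ?_)
  exact Finset.single_le_sum (f := fun r => ∑ s, d r s) (fun _ _ => Nat.zero_le _)
    (Finset.mem_univ r)

lemma eventually_exact_spec [∀ i, Infinite (k i)]
    (hY : ∀ᶠ i in U, (aeval fun l => Y l i : MvPolynomial (Fin c) (k i) →ₐ[k i] _).toRingHom.Flat)
    {a b d : ℕ} {A : Matrix (Fin a) (Fin b) (MvPolynomial (Fin c) (UltraProd U k))}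
    {A' : Matrix (Fin b) (Fin d) (MvPolynomial (Fin c) (UltraProd U k))}
    (h : LinearMap.ker A.mulVecLin = LinearMap.range A'.mulVecLin) :
    ∀ᶠ i in U, LinearMap.ker (A.map (spec Y i)).mulVecLin =
      LinearMap.range (A'.map (spec Y i)).mulVecLin := by
  filter_upwards [hY, eventually_exact_rep h] with i hi hi'
  exact hi.exact_mulVec hi'

end UltraProd

end

section

open Filter MvPolynomial

/-- The column space of a matrix has a finite free resolution whose length, ranks and degrees are
bounded by `p`. -/
def Matrix.HasBoundedResolution {K : Type u} [Field K] {N m n : ℕ} (p : ℕ)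
    (𝓜 : Matrix (Fin m) (Fin n) (MvPolynomial (Fin N) K)) : Prop :=
  ∃ (k : ℕ) (b : ℕ → ℕ)
    (A : ∀ i : ℕ, Matrix (Fin (b i)) (Fin (b (i + 1))) (MvPolynomial (Fin N) K))
    (g : (Fin (b 0) → MvPolynomial (Fin N) K) →ₗ[MvPolynomial (Fin N) K]
          (Fin m → MvPolynomial (Fin N) K)),
    k ≤ p ∧
    (∀ i, b i ≤ p) ∧
    (∀ i, k < i → b i = 0) ∧
    (∀ (i : ℕ) r c, ((A i) r c).totalDegree ≤ p) ∧
    LinearMap.range g = LinearMap.range 𝓜.mulVecLin ∧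
    LinearMap.ker g = LinearMap.range (A 0).mulVecLin ∧
    (∀ i : ℕ, LinearMap.ker (A i).mulVecLin = LinearMap.range (A (i + 1)).mulVecLin)

lemma Matrix.HasBoundedResolution.mono {K : Type u} [Field K] {N m n p q : ℕ} (hpq : p ≤ q)
    {𝓜 : Matrix (Fin m) (Fin n) (MvPolynomial (Fin N) K)} (h : 𝓜.HasBoundedResolution p) :
    𝓜.HasBoundedResolution q := by
  obtain ⟨k, b, A, g, hk, hb, hb', hA, h⟩ := h
  exact ⟨k, b, A, g, hk.trans hpq, fun i => (hb i).trans hpq, hb',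
    fun i r c => (hA i r c).trans hpq, h⟩

namespace UltraProd

variable {U : Ultrafilter ℕ} {k : ℕ → Type u} [∀ i, Field (k i)] [∀ i, IsAlgClosed (k i)]
  {N : ℕ → ℕ}

/-- Finitely many families of polynomials of bounded degree are specializations of polynomials in
finitely many families which are eventually flat. -/
lemma exists_spec_eq {m n d : ℕ}
    (𝓜 : ∀ i, Matrix (Fin m) (Fin n) (MvPolynomial (Fin (N i)) (k i)))
    (h𝓜 : ∀ i r s, (𝓜 i r s).totalDegree ≤ d) :
    ∃ (c : ℕ) (Y : Fin c → ∀ i, MvPolynomial (Fin (N i)) (k i))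
      (P : Matrix (Fin m) (Fin n) (MvPolynomial (Fin c) (UltraProd U k))),
      (∀ l, mk U (Y l) ∈ boundedDegree U k N) ∧
      (∀ᶠ i in U,
        (aeval fun l => Y l i : MvPolynomial (Fin c) (k i) →ₐ[k i] _).toRingHom.Flat) ∧
      ∀ᶠ i in U, 𝓜 i = P.map (spec Y i) := by
  classical
  have hinf : ∀ i, Infinite (k i) := fun i => IsAlgClosed.instInfinite
  obtain ⟨ι, E, hE⟩ := exists_generators U k N
  let M : Fin m → Fin n → boundedDegree U k N := fun r s =>
    ofBounded (fun i => 𝓜 i r s) d fun i => h𝓜 i r s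
  obtain ⟨T, hT⟩ := exists_finset_forall_mem_adjoin E.adjoin_eq_top
    (Finset.univ.image fun q : Fin m × Fin n => M q.1 q.2)
  obtain ⟨j, hj, hjT⟩ : ∃ j : Fin T.card → ι, Function.Injective j ∧ Set.range j = T :=
    ⟨fun l => T.equivFin.symm l, Subtype.val_injective.comp T.equivFin.symm.injective, by
      rw [Set.range_comp' Subtype.val, T.equivFin.symm.surjective.range_eq]
      simp⟩
  choose Y hY hYj using fun l => exists_isHomogeneous_rep (E.pr_gen (j l))
  have hP : ∀ r s, ∃ p : MvPolynomial (Fin T.card) (UltraProd U k),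
      aeval (fun l => E.gen (j l)) p = M r s := by
    intro r s
    have h := hT (M r s) (Finset.mem_image_of_mem (fun q : Fin m × Fin n => M q.1 q.2)
      (Finset.mem_univ (r, s)))
    rw [← hjT, ← Set.range_comp, Algebra.adjoin_range_eq_range_aeval] at h
    exact h
  choose P hP using hP
  refine ⟨T.card, Y, Matrix.of P, fun l => ?_, ?_, ?_⟩
  · rw [hYj]
    exact (E.gen (j l)).2
  · obtain ⟨e, he⟩ := exists_hasParameters E hE T.card j hj Y hY hYj
    filter_upwards [he] with i hi
    exact hi.flat
  · simp only [← Matrix.ext_iff, eventually_all]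
    intro r s
    refine mk_eq_mk.1 ?_
    change mk U (fun i => 𝓜 i r s) = mk U fun i => spec Y i (P r s)
    rw [mk_spec]
    simp only [hYj]
    have := congrArg (boundedDegree U k N).val (hP r s)
    rw [comp_aeval_apply] at this
    exact this.symm

theorem exists_eventually_hasBoundedResolution {m n d : ℕ}
    (𝓜 : ∀ i, Matrix (Fin m) (Fin n) (MvPolynomial (Fin (N i)) (k i)))
    (h𝓜 : ∀ i r s, (𝓜 i r s).totalDegree ≤ d) :
    ∃ p, ∀ᶠ i in U, (𝓜 i).HasBoundedResolution p := by
  have hinf : ∀ i, Infinite (k i) := fun i => IsAlgClosed.instInfinite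
  obtain ⟨c, Y, P, hY, hflat, hP⟩ := exists_spec_eq (U := U) 𝓜 h𝓜
  obtain ⟨K, b, A, G, hG, hG0, hA, hb⟩ := P.exists_resolution
  choose D hD using fun j => exists_totalDegree_map_spec_le Y hY (A j)
  refine ⟨K + ∑ j ∈ Finset.range K, b j + ∑ j ∈ Finset.range K, D j, ?_⟩
  have hDev : ∀ᶠ i in U, ∀ j ∈ Finset.range K, ∀ r s,
      (((A j).map (spec Y i)) r s).totalDegree ≤ D j :=
    (Filter.eventually_all_finset _).2 fun j _ => hD j
  have hAev : ∀ᶠ i in U, ∀ j ∈ Finset.range K, LinearMap.ker ((A j).map (spec Y i)).mulVecLin =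
      LinearMap.range ((A (j + 1)).map (spec Y i)).mulVecLin :=
    (Filter.eventually_all_finset _).2 fun j _ => eventually_exact_spec Y hflat (hA j)
  filter_upwards [hP, hDev, hAev, eventually_range_spec_eq Y hG, eventually_exact_spec Y hflat hG0]
    with i hPi hDi hAi hGi hG0i
  refine ⟨K, b, fun j => (A j).map (spec Y i), (G.map (spec Y i)).mulVecLin, by omega, ?_,
    fun j hj => hb j hj.le, ?_, ?_, hG0i, ?_⟩
  · intro j
    rcases lt_or_ge j K with hj | hj
    · have := Finset.single_le_sum (f := b) (fun _ _ => Nat.zero_le _) (Finset.mem_range.2 hj)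
      omega
    · rw [hb j hj]
      exact Nat.zero_le _
  · intro j r s
    rcases lt_or_ge j K with hj | hj
    · have := Finset.single_le_sum (f := D) (fun _ _ => Nat.zero_le _) (Finset.mem_range.2 hj)
      exact (hDi j (Finset.mem_range.2 hj) r s).trans (by omega)
    · have := hb j hj
      exact absurd r.2 (by omega)
  · rw [hGi, hPi]
  · intro j
    rcases lt_or_ge j K with hj | hj
    · exact hAi j (Finset.mem_range.2 hj)
    · have : IsEmpty (Fin (b (j + 1))) := by
        rw [hb (j + 1) (by omega)]
        infer_instance
      exact Subsingleton.elim _ _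

end UltraProd

theorem Matrix.exists_hasBoundedResolution (m n d : ℕ) : ∃ p : ℕ,
    ∀ (K : Type u) [Field K] [IsAlgClosed K] (N : ℕ)
      (𝓜 : Matrix (Fin m) (Fin n) (MvPolynomial (Fin N) K)),
      (∀ i j, (𝓜 i j).totalDegree ≤ d) → 𝓜.HasBoundedResolution p := by
  by_contra! h
  choose k hk hk' N 𝓜 h𝓜 hbad using h
  obtain ⟨p, hp⟩ := UltraProd.exists_eventually_hasBoundedResolution (U := hyperfilter ℕ) 𝓜 h𝓜
  have hge : ∀ᶠ i in (hyperfilter ℕ : Filter ℕ), p ≤ i :=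
    (Nat.hyperfilter_le_atTop : _ ≤ atTop) (eventually_ge_atTop p)
  obtain ⟨i, hi, hpi⟩ := (hp.and hge).exists
  exact hbad i (hi.mono hpi)

end

/-- There is a function `P`, independent of `N` and `K`, such that for every
algebraically closed field `K` and every `m × n` matrix `𝓜` over `R = K[x_1, …, x_N]` with
entries of degree at most `d`, the column space `M ⊆ R^m` of `𝓜` has a finite free resolution
`0 → R^{b k} → ⋯ → R^{b 1} → R^{b 0} → M → 0` of length `k ≤ P m n d` in which every rank
`b i` is at most `P m n d` and all entries of all the matrices `A i` of the maps
`R^{b (i+1)} → R^{b i}` have degree at most `P m n d`.  (Setting `b i = 0` for `i > k` makes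
the chain of exactness conditions encode both finiteness of the resolution and injectivity of
its last map.) -/
theorem statement8 :
    ∃ P : ℕ → ℕ → ℕ → ℕ,
      ∀ (K : Type u) [Field K] [IsAlgClosed K] (N m n d : ℕ)
        (𝓜 : Matrix (Fin m) (Fin n) (MvPolynomial (Fin N) K)),
        (∀ i j, (𝓜 i j).totalDegree ≤ d) →
        ∃ (k : ℕ) (b : ℕ → ℕ)
          (A : ∀ i : ℕ, Matrix (Fin (b i)) (Fin (b (i + 1))) (MvPolynomial (Fin N) K))
          (g : (Fin (b 0) → MvPolynomial (Fin N) K) →ₗ[MvPolynomial (Fin N) K]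
                (Fin m → MvPolynomial (Fin N) K)),
          k ≤ P m n d ∧
          (∀ i, b i ≤ P m n d) ∧
          (∀ i, k < i → b i = 0) ∧
          (∀ (i : ℕ) r c, ((A i) r c).totalDegree ≤ P m n d) ∧
          LinearMap.range g = LinearMap.range 𝓜.mulVecLin ∧
          LinearMap.ker g = LinearMap.range (A 0).mulVecLin ∧
          (∀ i : ℕ, LinearMap.ker (A i).mulVecLin = LinearMap.range (A (i + 1)).mulVecLin) := by
  choose P hP using Matrix.exists_hasBoundedResolution.{u}
  exact ⟨P, fun K _ _ N m n d 𝓜 h𝓜 => hP m n d K N 𝓜 h𝓜⟩
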